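/- Let 0 < p < q < 2 and α > 1. If f is holomorphic on the unit disk 𝔻 with ∫_𝔻 |f(z)|^p dA_α(z) < ∞, then with r ≥ 0 defined by r² = max{ p/2, (pα − p)/(qα − p) } one has (∫_𝔻 |f(rz)|^q dA_α(z))^{1/q} ≤ (∫_𝔻 |f(z)|^p dA_α(z))^{1/p}. -/

import Mathlib

open MeasureTheory Metric

/-- The weighted Bergman measure `dA_α` on the unit disk:
density `((α-1)/π)(1-|z|²)^(α-2)` with respect to Lebesgue area measure. -/
noncomputable def bergmanMeasure (α : ℝ) : Measure ℂ :=
  (volume.restrict (ball (0 : ℂ) 1)).withDensity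
    (fun z => ENNReal.ofReal ((α - 1) / Real.pi * (1 - ‖z‖ ^ 2) ^ (α - 2)))

namespace HC
open Set Filter Topology

noncomputable def dens (α : ℝ) (z : ℂ) : ℝ := (α - 1) / Real.pi * (1 - ‖z‖ ^ 2) ^ (α - 2)

lemma dens_nonneg {α : ℝ} (hα : 1 < α) {z : ℂ} (hz : z ∈ ball (0:ℂ) 1) : 0 ≤ dens α z := by
  have : ‖z‖ < 1 := by simpa using hz
  have h2 : 0 ≤ 1 - ‖z‖^2 := by nlinarith [norm_nonneg z]
  have : 0 ≤ α - 1 := by linarith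
  have := Real.pi_pos
  unfold dens
  positivity

lemma measurable_dens (α : ℝ) : Measurable (dens α) := by
  unfold dens
  fun_prop

lemma radial_int {b : ℝ} (hb : 0 < b) :
    IntegrableOn (fun y : ℝ => 2 * b * y * (1 - y^2) ^ (b - 1)) (Ioc 0 1) ∧
    ∫ y in (0:ℝ)..1, 2 * b * y * (1 - y^2) ^ (b - 1) = 1 := by
  have hcont : ContinuousOn (fun y : ℝ => -(1 - y^2) ^ b) (Icc 0 1) := by
    apply ContinuousOn.neg
    apply ContinuousOn.rpow_const (by fun_prop)
    intro x hx; right; exact hb.le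
  have hder : ∀ y ∈ Ioo (0:ℝ) 1, HasDerivAt (fun y : ℝ => -(1 - y^2) ^ b)
      (2 * b * y * (1 - y^2) ^ (b - 1)) y := by
    intro y hy
    have h1 : HasDerivAt (fun y : ℝ => 1 - y^2) (-(2*y)) y := by
      simpa using ((hasDerivAt_id y).pow 2).const_sub 1
    have hpos : 0 < 1 - y^2 := by nlinarith [hy.1, hy.2]
    have h2 := (h1.rpow_const (p := b) (Or.inl hpos.ne')).fun_neg
    exact h2.congr_deriv (by ring)
  have hint : IntegrableOn (fun y : ℝ => 2 * b * y * (1 - y^2) ^ (b - 1)) (Ioc 0 1) := by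
    refine intervalIntegral.integrableOn_deriv_of_nonneg hcont hder ?_
    intro y hy
    have hpos : 0 < 1 - y^2 := by nlinarith [hy.1, hy.2]
    have := hy.1
    positivity
  refine ⟨hint, ?_⟩
  rw [intervalIntegral.integral_eq_sub_of_hasDerivAt_of_le zero_le_one hcont hder
    ((intervalIntegrable_iff_integrableOn_Ioc_of_le zero_le_one).2 hint)]
  simp [Real.zero_rpow hb.ne']

lemma dens_int {α : ℝ} (hα : 1 < α) :
    IntegrableOn (dens α) (ball (0:ℂ) 1) ∧ ∫ z in ball (0:ℂ) 1, dens α z = 1 := by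
  have hb : 0 < α - 1 := by linarith
  obtain ⟨h1, h2⟩ := radial_int hb
  set g : ℝ → ℝ := fun y => (Iio (1:ℝ)).indicator (fun y => (α - 1) / Real.pi * (1 - y ^ 2) ^ (α - 2)) y with hg
  have e1 : (ball (0:ℂ) 1).indicator (dens α) = fun z => g ‖z‖ := by
    ext z
    by_cases hz : z ∈ ball (0:ℂ) 1
    · have : ‖z‖ ∈ Iio (1:ℝ) := by simpa using hz
      simp only [hg, indicator_of_mem hz, indicator_of_mem this, dens]
    · have : ‖z‖ ∉ Iio (1:ℝ) := by simpa using hz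
      simp only [hg, indicator_of_notMem hz, indicator_of_notMem this]
  have e2 : (fun y : ℝ => y ^ (Module.finrank ℝ ℂ - 1) • g y) =
      (Iio (1:ℝ)).indicator (fun y => (1/(2*Real.pi)) * (2 * (α-1) * y * (1 - y^2) ^ (α - 1 - 1))) := by
    ext y
    by_cases hy : y ∈ Iio (1:ℝ)
    · simp only [hg, indicator_of_mem hy, Complex.finrank_real_complex]
      have := Real.pi_pos
      rw [show α - 1 - 1 = α - 2 by ring]
      simp
      field_simp
    · simp only [hg, indicator_of_notMem hy]; simp
  have hI : IntegrableOn (fun y : ℝ => y ^ (Module.finrank ℝ ℂ - 1) • g y) (Ioi 0) := by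
    rw [e2, integrableOn_indicator_iff measurableSet_Iio]
    exact IntegrableOn.mono_set (t := Ioc 0 1) (h1.const_mul (1/(2*Real.pi))) (fun y hy => ⟨hy.2, le_of_lt hy.1⟩)
  constructor
  · rw [← integrable_indicator_iff measurableSet_ball, e1, integrable_fun_norm_addHaar]
    exact hI
  · rw [← integral_indicator measurableSet_ball, e1, integral_fun_norm_addHaar, e2,
      setIntegral_indicator measurableSet_Iio, integral_const_mul]
    have : Ioi (0:ℝ) ∩ Iio 1 = Ioo 0 1 := rfl
    rw [this, ← integral_Ioc_eq_integral_Ioo, ← intervalIntegral.integral_of_le zero_le_one, h2]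
    have hv : (volume : Measure ℂ).real (ball 0 1) = Real.pi := by
      simp [Measure.real, Complex.volume_ball]
    rw [hv, Complex.finrank_real_complex]
    have := Real.pi_pos
    simp

lemma integral_berg {α : ℝ} (hα : 1 < α) (F : ℂ → ℝ) :
    ∫ z, F z ∂(bergmanMeasure α) = ∫ z in ball (0:ℂ) 1, dens α z * F z := by
  unfold bergmanMeasure
  rw [integral_withDensity_eq_integral_toReal_smul₀]
  · refine setIntegral_congr_fun measurableSet_ball ?_
    intro z hz
    have := dens_nonneg hα hz
    simp only [smul_eq_mul]
    rw [ENNReal.toReal_ofReal]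
    · rfl
    · exact this
  · exact ((measurable_dens α).ennreal_ofReal).aemeasurable
  · exact ae_of_all _ (fun z => ENNReal.ofReal_lt_top)

lemma integrable_berg_iff {α : ℝ} (hα : 1 < α) (F : ℂ → ℝ) :
    Integrable F (bergmanMeasure α) ↔ IntegrableOn (fun z => dens α z * F z) (ball (0:ℂ) 1) := by
  unfold bergmanMeasure
  rw [integrable_withDensity_iff_integrable_smul₀']
  · refine integrable_congr ?_
    filter_upwards [ae_restrict_mem measurableSet_ball] with z hz
    have := dens_nonneg hα hz
    simp only [smul_eq_mul]
    rw [ENNReal.toReal_ofReal]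
    · rfl
    · exact this
  · exact ((measurable_dens α).ennreal_ofReal).aemeasurable
  · exact ae_of_all _ (fun z => ENNReal.ofReal_lt_top)

lemma berg_prob {α : ℝ} (hα : 1 < α) : IsProbabilityMeasure (bergmanMeasure α) := by
  constructor
  unfold bergmanMeasure
  rw [withDensity_apply _ MeasurableSet.univ, Measure.restrict_univ]
  obtain ⟨h1, h2⟩ := dens_int hα
  change ∫⁻ z in ball (0:ℂ) 1, ENNReal.ofReal (dens α z) = 1
  rw [← ofReal_integral_eq_lintegral_ofReal h1, h2]
  · simp
  · filter_upwards [ae_restrict_mem measurableSet_ball] with z hz using dens_nonneg hα hz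

lemma berg_ae_ball (α : ℝ) : ∀ᵐ z ∂(bergmanMeasure α), z ∈ ball (0:ℂ) 1 :=
  (withDensity_absolutelyContinuous _ _).ae_le (ae_restrict_mem measurableSet_ball)

lemma berg_ac (α : ℝ) : bergmanMeasure α ≪ volume.restrict (ball (0:ℂ) 1) :=
  withDensity_absolutelyContinuous _ _

lemma aesm_berg {E : Type*} [NormedAddCommGroup E] {α : ℝ} {F : ℂ → E}
    [SecondCountableTopology E] (hF : ContinuousOn F (ball (0:ℂ) 1)) :
    AEStronglyMeasurable F (bergmanMeasure α) :=
  (hF.aestronglyMeasurable measurableSet_ball).mono_ac (berg_ac α)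

lemma integrable_of_bdd {α : ℝ} (hα : 1 < α) {F : ℂ → ℝ} (hF : ContinuousOn F (ball (0:ℂ) 1))
    {C : ℝ} (hC : ∀ z ∈ ball (0:ℂ) 1, |F z| ≤ C) : Integrable F (bergmanMeasure α) := by
  have := berg_prob hα
  refine Integrable.mono' (integrable_const C) (aesm_berg hF) ?_
  filter_upwards [berg_ae_ball α] with z hz using hC z hz

lemma integrable_cont {α : ℝ} (hα : 1 < α) {F : ℂ → ℝ} (hF : ContinuousOn F (closedBall (0:ℂ) 1)) :
    Integrable F (bergmanMeasure α) := by
  obtain ⟨C, hC⟩ := (isCompact_closedBall (0:ℂ) 1).exists_bound_of_continuousOn hF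
  exact integrable_of_bdd hα (hF.mono ball_subset_closedBall)
    (fun z hz => hC z (ball_subset_closedBall hz))

lemma integral_succ {α : ℝ} (hα : 1 < α) (F : ℂ → ℝ) :
    ∫ z, F z ∂(bergmanMeasure (α+1)) = α/(α-1) * ∫ z, (1 - ‖z‖^2) * F z ∂(bergmanMeasure α) := by
  rw [integral_berg hα, integral_berg (by linarith), ← integral_const_mul]
  refine setIntegral_congr_fun measurableSet_ball ?_
  intro z hz
  have : ‖z‖ < 1 := by simpa using hz
  have h2 : 0 < 1 - ‖z‖^2 := by nlinarith [norm_nonneg z]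
  have h3 : α - 1 ≠ 0 := by linarith
  simp only [dens]
  rw [show α + 1 - 2 = (α - 2) + 1 by ring, Real.rpow_add h2, Real.rpow_one]
  have := Real.pi_pos
  field_simp
  ring

end HC
namespace HC
open Set Filter Topology

lemma slice0 {b : ℝ} (hb : 0 < b) (c : ℝ) (X X1 : ℝ → ℝ)
    (hX : ContinuousOn X {x | x^2 + c^2 ≤ 1})
    (hd : ∀ x, x^2 + c^2 < 1 → HasDerivAt X (X1 x) x) :
    ∫ x, {x : ℝ | x^2 + c^2 < 1}.indicator
      (fun x => (1 - (x^2+c^2))^b * X1 x - 2*b*x*(1 - (x^2+c^2))^(b-1) * X x) x = 0 := by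
  set g : ℝ → ℝ := fun x => (1 - (x^2+c^2))^b * X1 x - 2*b*x*(1 - (x^2+c^2))^(b-1) * X x with hg
  rcases le_or_gt 1 (c^2) with h | h
  · have : {x : ℝ | x^2 + c^2 < 1} = ∅ := by
      ext x; simp; nlinarith [sq_nonneg x]
    simp [this]
  set a := Real.sqrt (1 - c^2) with ha
  have ha2 : a^2 = 1 - c^2 := Real.sq_sqrt (by linarith)
  have ha0 : 0 < a := Real.sqrt_pos.2 (by linarith)
  have hs : {x : ℝ | x^2 + c^2 < 1} = Ioo (-a) a := by
    ext x
    have h1 : x^2 + c^2 < 1 ↔ x^2 < a^2 := by rw [ha2]; constructor <;> intro h <;> linarith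
    simp only [mem_ofPred_eq, mem_Ioo, h1, sq_lt_sq, abs_of_pos ha0, abs_lt]
  have hs' : {x : ℝ | x^2 + c^2 ≤ 1} = Icc (-a) a := by
    ext x
    have h1 : x^2 + c^2 ≤ 1 ↔ x^2 ≤ a^2 := by rw [ha2]; constructor <;> intro h <;> linarith
    simp only [mem_ofPred_eq, mem_Icc, h1, sq_le_sq, abs_of_pos ha0, abs_le]
  rw [hs, integral_indicator measurableSet_Ioo]
  by_cases hi : IntegrableOn g (Ioo (-a) a)
  swap
  · exact integral_undef hi
  have hle : -a ≤ a := by linarith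
  rw [← integral_Ioc_eq_integral_Ioo, ← intervalIntegral.integral_of_le hle]
  rw [hs'] at hX
  rw [intervalIntegral.integral_eq_sub_of_hasDerivAt_of_le (f := fun x => (1 - (x^2+c^2))^b * X x) hle]
  · have e1 : 1 - (a^2 + c^2) = 0 := by rw [ha2]; ring
    have e2 : 1 - ((-a)^2 + c^2) = 0 := by rw [neg_sq, ha2]; ring
    simp only [e1, e2, Real.zero_rpow hb.ne']
    simp
  · refine ContinuousOn.mul ?_ hX
    exact ContinuousOn.rpow_const (by fun_prop) (fun x _ => Or.inr hb.le)
  · intro x hx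
    have hx' : x^2 + c^2 < 1 := by
      have : x ∈ {x : ℝ | x^2 + c^2 < 1} := by rw [hs]; exact hx
      exact this
    have h1 : HasDerivAt (fun x : ℝ => 1 - (x^2 + c^2)) (-(2*x)) x := by
      simpa using (((hasDerivAt_id x).pow 2).add_const (c^2)).const_sub 1
    have h2 := (h1.rpow_const (p := b) (Or.inl (by linarith))).fun_mul (hd x hx')
    exact h2.congr_deriv (by simp only [hg]; ring)
  · rw [intervalIntegrable_iff_integrableOn_Ioo_of_le hle]
    exact hi

lemma norm_sq_mk (x y : ℝ) : ‖(⟨x, y⟩ : ℂ)‖^2 = x^2 + y^2 := by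
  rw [← Complex.normSq_eq_norm_sq, Complex.normSq_mk]; ring

lemma mem_ball_mk (x y : ℝ) : (⟨x, y⟩ : ℂ) ∈ ball (0:ℂ) 1 ↔ x^2 + y^2 < 1 := by
  rw [mem_ball_zero_iff, ← norm_sq_mk, sq_lt_one_iff₀ (norm_nonneg _)]

lemma mem_cball_mk (x y : ℝ) : (⟨x, y⟩ : ℂ) ∈ closedBall (0:ℂ) 1 ↔ x^2 + y^2 ≤ 1 := by
  rw [mem_closedBall_zero_iff, ← norm_sq_mk, sq_le_one_iff₀ (norm_nonneg _)]

/-- partial derivative data -/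
def HasDx (s : Set ℂ) (X X1 : ℂ → ℝ) : Prop :=
  ∀ z ∈ s, HasDerivAt (fun t : ℝ => X ⟨t, z.im⟩) (X1 z) z.re
def HasDy (s : Set ℂ) (X X1 : ℂ → ℝ) : Prop :=
  ∀ z ∈ s, HasDerivAt (fun t : ℝ => X ⟨z.re, t⟩) (X1 z) z.im

lemma div_aux {α : ℝ} (hα : 1 < α) {X X1 ℓ : ℂ → ℝ} (hℓ : Continuous ℓ)
    (hX : ContinuousOn X (closedBall (0:ℂ) 1)) (hX1 : ContinuousOn X1 (closedBall (0:ℂ) 1))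
    (h0 : IntegrableOn (fun z => (1 - ‖z‖^2)^(α-1) * X1 z - 2*(α-1)*ℓ z*(1-‖z‖^2)^(α-1-1) * X z)
        (ball (0:ℂ) 1) → 
       ∫ z in ball (0:ℂ) 1, ((1 - ‖z‖^2)^(α-1) * X1 z - 2*(α-1)*ℓ z*(1-‖z‖^2)^(α-1-1) * X z) = 0) :
    ∫ z, X1 z ∂(bergmanMeasure (α+1)) = 2*α * ∫ z, ℓ z * X z ∂(bergmanMeasure α) := by
  have hb : 0 < α - 1 := by linarith
  have i1 := (integrable_berg_iff (α := α+1) (by linarith) X1).1 (integrable_cont (by linarith) hX1)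
  have i2 := (integrable_berg_iff hα (fun z => ℓ z * X z)).1 (integrable_cont hα (hℓ.continuousOn.mul hX))
  have pip := Real.pi_pos
  have e : (fun z => (1 - ‖z‖^2)^(α-1) * X1 z - 2*(α-1)*ℓ z*(1-‖z‖^2)^(α-1-1) * X z)
      = fun z => (Real.pi/α) * (dens (α+1) z * X1 z) - 2*Real.pi * (dens α z * (ℓ z * X z)) := by
    ext z
    simp only [dens]
    rw [show α + 1 - 2 = α - 1 by ring, show α - 1 - 1 = α - 2 by ring]
    have : α ≠ 0 := by linarith
    field_simp
    ring
  have j1 := i1.const_mul (Real.pi/α)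
  have j2 := i2.const_mul (2*Real.pi)
  rw [e] at h0
  have := h0 (j1.sub j2)
  rw [integral_sub j1 j2, integral_const_mul, integral_const_mul] at this
  rw [integral_berg hα, integral_berg (by linarith)]
  have ha : α ≠ 0 := by linarith
  generalize (∫ z in ball (0:ℂ) 1, dens (α+1) z * X1 z) = A at *
  generalize (∫ z in ball (0:ℂ) 1, dens α z * (ℓ z * X z)) = B at *
  field_simp at this
  have h3 := mul_eq_zero.1 (this.trans (mul_zero _))
  rcases h3 with h3 | h3
  · exact absurd h3 pip.ne'
  · linarith

lemma int_prod (G : ℂ → ℝ) (s : Set ℂ) (hs : MeasurableSet s) :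
    ∫ z in s, G z = ∫ p : ℝ × ℝ, s.indicator G ⟨p.1, p.2⟩ := by
  rw [← integral_indicator hs, ← Complex.volume_preserving_equiv_real_prod.symm.integral_comp
    Complex.measurableEquivRealProd.symm.measurableEmbedding]
  rfl

lemma integrable_prod' {G : ℂ → ℝ} {s : Set ℂ} (hs : MeasurableSet s) (h : IntegrableOn G s) :
    Integrable (fun p : ℝ × ℝ => s.indicator G ⟨p.1, p.2⟩) := by
  have := (Complex.volume_preserving_equiv_real_prod.symm.integrable_comp_emb
    Complex.measurableEquivRealProd.symm.measurableEmbedding).2 ((integrable_indicator_iff hs).2 h)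
  exact this

lemma div_re {α : ℝ} (hα : 1 < α) {X X1 : ℂ → ℝ} 
    (hX : ContinuousOn X (closedBall (0:ℂ) 1)) (hX1 : ContinuousOn X1 (closedBall (0:ℂ) 1))
    (hd : HasDx (ball (0:ℂ) 1) X X1) :
    ∫ z, X1 z ∂(bergmanMeasure (α+1)) = 2*α * ∫ z, z.re * X z ∂(bergmanMeasure α) := by
  refine div_aux hα Complex.continuous_re hX hX1 ?_
  intro hi
  rw [int_prod _ _ measurableSet_ball]
  rw [Measure.volume_eq_prod, integral_prod_symm _ (integrable_prod' measurableSet_ball hi)]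
  refine integral_eq_zero_of_ae (ae_of_all _ fun y => ?_)
  have := slice0 (b := α - 1) (by linarith) y (fun x => X ⟨x,y⟩) (fun x => X1 ⟨x,y⟩) ?_ ?_
  · simp only [Pi.zero_apply]
    rw [← this]
    congr 1
    ext x
    simp only [indicator, mem_ofPred_eq, mem_ball_mk, norm_sq_mk]
  · refine hX.comp (Continuous.continuousOn ?_) (fun x hx => (mem_cball_mk x y).2 hx)
    exact Complex.equivRealProdCLM.symm.continuous.comp (Continuous.prodMk_left y)
  · intro x hx
    exact hd ⟨x,y⟩ ((mem_ball_mk x y).2 hx)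

lemma div_im {α : ℝ} (hα : 1 < α) {X X1 : ℂ → ℝ} 
    (hX : ContinuousOn X (closedBall (0:ℂ) 1)) (hX1 : ContinuousOn X1 (closedBall (0:ℂ) 1))
    (hd : HasDy (ball (0:ℂ) 1) X X1) :
    ∫ z, X1 z ∂(bergmanMeasure (α+1)) = 2*α * ∫ z, z.im * X z ∂(bergmanMeasure α) := by
  refine div_aux hα Complex.continuous_im hX hX1 ?_
  intro hi
  rw [int_prod _ _ measurableSet_ball]
  rw [Measure.volume_eq_prod, integral_prod _ (integrable_prod' measurableSet_ball hi)]
  refine integral_eq_zero_of_ae (ae_of_all _ fun y => ?_)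
  have := slice0 (b := α - 1) (by linarith) y (fun x => X ⟨y,x⟩) (fun x => X1 ⟨y,x⟩) ?_ ?_
  · simp only [Pi.zero_apply]
    rw [← this]
    congr 1
    ext x
    simp only [indicator, mem_ofPred_eq, mem_ball_mk, norm_sq_mk, add_comm (y^2)]
  · refine hX.comp (Continuous.continuousOn ?_) (fun x hx => (mem_cball_mk y x).2 (by rw [add_comm]; exact hx))
    exact Complex.equivRealProdCLM.symm.continuous.comp (Continuous.prodMk_right y)
  · intro x hx
    exact hd ⟨y,x⟩ ((mem_ball_mk y x).2 (by rw [add_comm]; exact hx))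

end HC
namespace HC
open Set Filter Topology

/-- evaluation of a real bivariate polynomial at a complex number -/
noncomputable def ev (P : MvPolynomial (Fin 2) ℝ) (z : ℂ) : ℝ := MvPolynomial.eval ![z.re, z.im] P

noncomputable abbrev d0 (P : MvPolynomial (Fin 2) ℝ) := MvPolynomial.pderiv (0 : Fin 2) P
noncomputable abbrev d1 (P : MvPolynomial (Fin 2) ℝ) := MvPolynomial.pderiv (1 : Fin 2) P

@[simp] lemma ev_add (P Q) (z : ℂ) : ev (P + Q) z = ev P z + ev Q z := by simp [ev]
@[simp] lemma ev_sub (P Q) (z : ℂ) : ev (P - Q) z = ev P z - ev Q z := by simp [ev]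
@[simp] lemma ev_mul (P Q) (z : ℂ) : ev (P * Q) z = ev P z * ev Q z := by simp [ev]
@[simp] lemma ev_pow (P) (n : ℕ) (z : ℂ) : ev (P ^ n) z = ev P z ^ n := by simp [ev]
@[simp] lemma ev_C (a : ℝ) (z : ℂ) : ev (MvPolynomial.C a) z = a := by simp [ev]
@[simp] lemma ev_one (z : ℂ) : ev 1 z = 1 := by simp [ev]
@[simp] lemma ev_zero (z : ℂ) : ev 0 z = 0 := by simp [ev]
@[simp] lemma ev_two (z : ℂ) : ev 2 z = 2 := by simp [ev]
@[simp] lemma ev_X0 (z : ℂ) : ev (MvPolynomial.X 0) z = z.re := by simp [ev]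
@[simp] lemma ev_X1 (z : ℂ) : ev (MvPolynomial.X 1) z = z.im := by simp [ev]
@[simp] lemma ev_smul (a : ℝ) (P) (z : ℂ) : ev (a • P) z = a * ev P z := by simp [ev, MvPolynomial.smul_eval]

@[fun_prop] lemma continuous_ev (P) : Continuous (ev P) := by
  induction P using MvPolynomial.induction_on with
  | C a => simp only [funext (ev_C a)]; fun_prop
  | add P Q hP hQ => simp only [funext (ev_add P Q)]; fun_prop
  | mul_X P i hP =>
    simp only [funext (ev_mul P _)]
    refine hP.mul ?_
    fin_cases i
    · exact (continuous_congr ev_X0).2 Complex.continuous_re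
    · exact (continuous_congr ev_X1).2 Complex.continuous_im

lemma ev_hasDeriv (P) {x y : ℝ → ℝ} {x' y' t : ℝ} (hx : HasDerivAt x x' t) (hy : HasDerivAt y y' t) :
    HasDerivAt (fun t => ev P ⟨x t, y t⟩) (x' * ev (d0 P) ⟨x t, y t⟩ + y' * ev (d1 P) ⟨x t, y t⟩) t := by
  induction P using MvPolynomial.induction_on with
  | C a => simpa using hasDerivAt_const t a
  | add P Q hP hQ =>
    simp only [ev_add, map_add]
    exact (hP.add hQ).congr_deriv (by ring)
  | mul_X P i hP =>
    have hi : HasDerivAt (fun t => ev (MvPolynomial.X i) ⟨x t, y t⟩)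
        (x' * ev (d0 (MvPolynomial.X i)) ⟨x t, y t⟩ + y' * ev (d1 (MvPolynomial.X i)) ⟨x t, y t⟩) t := by
      fin_cases i
      · simpa [MvPolynomial.pderiv_X] using hx
      · simpa [MvPolynomial.pderiv_X] using hy
    simp only [ev_mul, Derivation.leibniz, ev_add, smul_eq_mul]
    exact (hP.mul hi).congr_deriv (by ring)

lemma ev_dx (P) (s : Set ℂ) : HasDx s (ev P) (ev (d0 P)) := by
  intro z _
  have := ev_hasDeriv P (hasDerivAt_id z.re) (hasDerivAt_const z.re z.im)
  simpa using this
lemma ev_dy (P) (s : Set ℂ) : HasDy s (ev P) (ev (d1 P)) := by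
  intro z _
  have := ev_hasDeriv P (hasDerivAt_const z.im z.re) (hasDerivAt_id z.im)
  simpa using this

/-- ∫ x·Y dμ_α = (1/2α)∫ div Y dμ_{α+1} -/
lemma div_thm {α : ℝ} (hα : 1 < α) {X Y X1 Y2 : ℂ → ℝ}
    (hX : ContinuousOn X (closedBall (0:ℂ) 1)) (hX1 : ContinuousOn X1 (closedBall (0:ℂ) 1))
    (hY : ContinuousOn Y (closedBall (0:ℂ) 1)) (hY2 : ContinuousOn Y2 (closedBall (0:ℂ) 1))
    (hdx : HasDx (ball (0:ℂ) 1) X X1) (hdy : HasDy (ball (0:ℂ) 1) Y Y2) :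
    ∫ z, (X1 z + Y2 z) ∂(bergmanMeasure (α+1)) =
      2*α * ∫ z, (z.re * X z + z.im * Y z) ∂(bergmanMeasure α) := by
  rw [integral_add (integrable_cont (by linarith) hX1) (integrable_cont (by linarith) hY2),
    integral_add (f := fun z : ℂ => z.re * X z) (g := fun z : ℂ => z.im * Y z)
      (integrable_cont hα (Complex.continuous_re.continuousOn.mul hX))
      (integrable_cont hα (Complex.continuous_im.continuousOn.mul hY)), div_re hα hX hX1 hdx,
      div_im hα hY hY2 hdy]
  ring

/-- 2α∫w dμ_{α+1} + ∫ Rw dμ_{α+1} = 2α∫w dμ_α -/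
lemma shift_id {α : ℝ} (hα : 1 < α) {w w1 w2 : ℂ → ℝ}
    (hw : ContinuousOn w (closedBall (0:ℂ) 1)) (hw1 : ContinuousOn w1 (closedBall (0:ℂ) 1))
    (hw2 : ContinuousOn w2 (closedBall (0:ℂ) 1))
    (hdx : HasDx (ball (0:ℂ) 1) w w1) (hdy : HasDy (ball (0:ℂ) 1) w w2) :
    2*α*∫ z, w z ∂(bergmanMeasure (α+1)) + ∫ z, (z.re * w1 z + z.im * w2 z) ∂(bergmanMeasure (α+1)) =
      2*α*∫ z, w z ∂(bergmanMeasure α) := by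
  have cr := Complex.continuous_re.continuousOn (s := closedBall (0:ℂ) 1)
  have ci := Complex.continuous_im.continuousOn (s := closedBall (0:ℂ) 1)
  have h1 := div_thm hα (X := fun z => z.re * w z) (Y := fun z => z.im * w z)
    (X1 := fun z => w z + z.re * w1 z) (Y2 := fun z => w z + z.im * w2 z)
    (cr.mul hw) (hw.add (cr.mul hw1)) (ci.mul hw) (hw.add (ci.mul hw2))
    (fun z hz => ((hasDerivAt_id z.re).mul (hdx z hz)).congr_deriv (by simp))
    (fun z hz => ((hasDerivAt_id z.im).mul (hdy z hz)).congr_deriv (by simp))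
  have h2 := integral_succ hα w
  have hα' : 1 < α + 1 := by linarith
  have e1 : ∫ z, (w z + z.re * w1 z + (w z + z.im * w2 z)) ∂(bergmanMeasure (α+1)) =
      2 * ∫ z, w z ∂(bergmanMeasure (α+1)) + ∫ z, (z.re * w1 z + z.im * w2 z) ∂(bergmanMeasure (α+1)) := by
    rw [← integral_const_mul, ← integral_add]
    · congr 1; ext z; ring
    · exact (integrable_cont hα' hw).const_mul 2
    · exact integrable_cont hα' ((cr.mul hw1).add (ci.mul hw2))
  have cn : ContinuousOn (fun z : ℂ => 1 - ‖z‖^2) (closedBall (0:ℂ) 1) := by fun_prop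
  have e2 : ∫ z, (z.re * (z.re * w z) + z.im * (z.im * w z)) ∂(bergmanMeasure α) =
      ∫ z, w z ∂(bergmanMeasure α) - ∫ z, (1 - ‖z‖^2) * w z ∂(bergmanMeasure α) := by
    rw [← integral_sub]
    · congr 1; ext z
      rw [← Complex.normSq_eq_norm_sq, Complex.normSq_apply]; ring
    · exact integrable_cont hα hw
    · exact integrable_cont hα (cn.mul hw)
  rw [e1, e2] at h1
  have hb : α - 1 ≠ 0 := by linarith
  rw [div_mul_eq_mul_div, eq_div_iff hb] at h2
  linarith

lemma int_R {α : ℝ} (hα : 1 < α) {w1 w2 w11 w22 : ℂ → ℝ}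
    (hw1 : ContinuousOn w1 (closedBall (0:ℂ) 1)) (hw2 : ContinuousOn w2 (closedBall (0:ℂ) 1))
    (hw11 : ContinuousOn w11 (closedBall (0:ℂ) 1)) (hw22 : ContinuousOn w22 (closedBall (0:ℂ) 1))
    (hdx : HasDx (ball (0:ℂ) 1) w1 w11) (hdy : HasDy (ball (0:ℂ) 1) w2 w22) :
    ∫ z, (z.re * w1 z + z.im * w2 z) ∂(bergmanMeasure α) =
     1/(2*α) * ∫ z, (w11 z + w22 z) ∂(bergmanMeasure (α+1)) := by
  rw [div_thm hα hw1 hw11 hw2 hw22 hdx hdy]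
  field_simp

/-- the polynomial |f|^2+ε with its jets -/
structure Jet (f : Polynomial ℂ) (ε : ℝ) (V : MvPolynomial (Fin 2) ℝ) : Prop where
  val : ∀ z, ev V z = ‖f.eval z‖^2 + ε
  grad : ∀ z, (ev (d0 V) z)^2 + (ev (d1 V) z)^2 = 4 * ‖f.eval z‖^2 * ‖f.derivative.eval z‖^2
  lap : ∀ z, ev (d0 (d0 V)) z + ev (d1 (d1 V)) z = 4 * ‖f.derivative.eval z‖^2

lemma exists_reim (f : Polynomial ℂ) : ∃ P Q : MvPolynomial (Fin 2) ℝ,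
    ∀ z, (f.eval z).re = ev P z ∧ (f.eval z).im = ev Q z := by
  induction f using Polynomial.induction_on' with
  | add p q hp hq =>
    obtain ⟨P, Q, h⟩ := hp
    obtain ⟨P', Q', h'⟩ := hq
    exact ⟨P + P', Q + Q', fun z => by simp [(h z).1, (h z).2, (h' z).1, (h' z).2]⟩
  | monomial n a =>
    induction n with
    | zero => exact ⟨MvPolynomial.C a.re, MvPolynomial.C a.im, fun z => by simp⟩
    | succ n ih =>
      obtain ⟨P, Q, h⟩ := ih
      refine ⟨P * MvPolynomial.X 0 - Q * MvPolynomial.X 1, P * MvPolynomial.X 1 + Q * MvPolynomial.X 0,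
        fun z => ?_⟩
      have : (Polynomial.monomial (n+1) a).eval z = (Polynomial.monomial n a).eval z * z := by
        simp [pow_succ]; ring
      rw [this]
      simp only [Complex.mul_re, Complex.mul_im, ev_add, ev_sub, ev_mul, ev_X0, ev_X1, (h z).1, (h z).2]
      simp

lemma reim_deriv {f : Polynomial ℂ} {P Q : MvPolynomial (Fin 2) ℝ}
    (h : ∀ z, (f.eval z).re = ev P z ∧ (f.eval z).im = ev Q z) (z : ℂ) :
    ev (d0 P) z = (f.derivative.eval z).re ∧ ev (d0 Q) z = (f.derivative.eval z).im ∧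
    ev (d1 P) z = -(f.derivative.eval z).im ∧ ev (d1 Q) z = (f.derivative.eval z).re := by
  have hf := f.hasDerivAt z
  have hx : HasDerivAt (fun t : ℝ => (⟨t, z.im⟩ : ℂ)) 1 z.re := by
    have h1 := (Complex.ofRealCLM.hasDerivAt (x := z.re)).add_const (z.im * Complex.I)
    have : (fun t : ℝ => (⟨t, z.im⟩ : ℂ)) = fun t : ℝ => Complex.ofRealCLM t + z.im * Complex.I := by
      ext t; simp [Complex.mk_eq_add_mul_I]
    rw [this]; simpa using h1
  have hy : HasDerivAt (fun t : ℝ => (⟨z.re, t⟩ : ℂ)) Complex.I z.im := by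
    have h1 := ((Complex.ofRealCLM.hasDerivAt (x := z.im)).mul_const Complex.I).const_add (z.re : ℂ)
    have : (fun t : ℝ => (⟨z.re, t⟩ : ℂ)) = fun t : ℝ => (z.re:ℂ) + Complex.ofRealCLM t * Complex.I := by
      ext t; simp [Complex.mk_eq_add_mul_I]
    rw [this]; simpa using h1
  have ex := HasDerivAt.comp (h := fun t : ℝ => (⟨t, z.im⟩ : ℂ)) (h₂ := fun w => f.eval w) z.re hf hx
  have ey := HasDerivAt.comp (h := fun t : ℝ => (⟨z.re, t⟩ : ℂ)) (h₂ := fun w => f.eval w) z.im hf hy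
  have exr := Complex.reCLM.hasFDerivAt.comp_hasDerivAt z.re ex
  have exi := Complex.imCLM.hasFDerivAt.comp_hasDerivAt z.re ex
  have eyr := Complex.reCLM.hasFDerivAt.comp_hasDerivAt z.im ey
  have eyi := Complex.imCLM.hasFDerivAt.comp_hasDerivAt z.im ey
  have key : ∀ (R : MvPolynomial (Fin 2) ℝ), ev R z = ev R z := fun _ => rfl
  refine ⟨?_, ?_, ?_, ?_⟩
  · refine (ev_dx P univ z trivial).unique ?_
    convert exr using 1
    · ext t; simp [(h _).1]
    · simp
  · refine (ev_dx Q univ z trivial).unique ?_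
    convert exi using 1
    · ext t; simp [(h _).2]
    · simp
  · refine (ev_dy P univ z trivial).unique ?_
    convert eyr using 1
    · ext t; simp [(h _).1]
    · simp
  · refine (ev_dy Q univ z trivial).unique ?_
    convert eyi using 1
    · ext t; simp [(h _).2]
    · simp

lemma exists_jet (f : Polynomial ℂ) (ε : ℝ) : ∃ V, Jet f ε V := by
  obtain ⟨P, Q, h⟩ := exists_reim f
  have h1 := reim_deriv h
  have hx : ∀ z, (f.derivative.eval z).re = ev (d0 P) z ∧ (f.derivative.eval z).im = ev (d0 Q) z :=
    fun z => ⟨(h1 z).1.symm, (h1 z).2.1.symm⟩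
  have hy : ∀ z, (f.derivative.eval z).re = ev (d1 Q) z ∧ (f.derivative.eval z).im = ev (-d1 P) z :=
    fun z => ⟨(h1 z).2.2.2.symm, by simp only [ev, map_neg]; have := (h1 z).2.2.1; simp only [ev] at this; linarith⟩
  have h2 := reim_deriv hx
  have h3 := reim_deriv hy
  have nsq : ∀ w : ℂ, ‖w‖^2 = w.re^2 + w.im^2 := fun w => by
    rw [← Complex.normSq_eq_norm_sq, Complex.normSq_apply]; ring
  have neg : ∀ R z, ev (-R) z = - ev R z := fun R z => by simp [ev]
  refine ⟨P*P + Q*Q + MvPolynomial.C ε, ?_, ?_, ?_⟩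
  · intro z
    simp only [ev_add, ev_mul, ev_C, nsq, (h z).1, (h z).2]; ring
  · intro z
    obtain ⟨a1, a2, a3, a4⟩ := h1 z
    simp only [map_add, Derivation.leibniz, MvPolynomial.pderiv_C, ev_add, ev_mul, smul_eq_mul, ev_zero,
      nsq, (h z).1, (h z).2, a1, a2, a3, a4]
    ring
  · intro z
    obtain ⟨a1, a2, a3, a4⟩ := h1 z
    obtain ⟨b1, b2, b3, b4⟩ := h2 z
    obtain ⟨c1, c2, c3, c4⟩ := h3 z
    simp only [map_neg, neg] at c2 c4
    have c4' : ev (d1 (d1 P)) z = - (f.derivative.derivative.eval z).re := by linarith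
    simp only [map_add, Derivation.leibniz, MvPolynomial.pderiv_C, ev_add, ev_mul, smul_eq_mul, ev_zero,
      nsq, a1, a2, a3, a4, b1, b2, c3, c4', map_zero]
    ring

end HC
namespace HC
open Set Filter Topology

lemma HasDx.mul {S : Set ℂ} {A A1 B B1 : ℂ → ℝ} (hA : HasDx S A A1) (hB : HasDx S B B1) :
    HasDx S (fun z => A z * B z) (fun z => A1 z * B z + A z * B1 z) :=
  fun z hz => (hA z hz).mul (hB z hz)
lemma HasDy.mul {S : Set ℂ} {A A1 B B1 : ℂ → ℝ} (hA : HasDy S A A1) (hB : HasDy S B B1) :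
    HasDy S (fun z => A z * B z) (fun z => A1 z * B z + A z * B1 z) :=
  fun z hz => (hA z hz).mul (hB z hz)
lemma HasDx.const_mul {S : Set ℂ} {A A1 : ℂ → ℝ} (c : ℝ) (hA : HasDx S A A1) :
    HasDx S (fun z => c * A z) (fun z => c * A1 z) :=
  fun z hz => (hA z hz).const_mul c
lemma HasDy.const_mul {S : Set ℂ} {A A1 : ℂ → ℝ} (c : ℝ) (hA : HasDy S A A1) :
    HasDy S (fun z => c * A z) (fun z => c * A1 z) :=
  fun z hz => (hA z hz).const_mul c

lemma hasDerivAt_int {α : ℝ} (hα : 1 < α) {F F' : ℝ → ℂ → ℝ} {a b t : ℝ} (ht : t ∈ Ioo a b)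
    (hF : ∀ t ∈ Icc a b, ContinuousOn (F t) (closedBall (0:ℂ) 1))
    (hF' : ContinuousOn (fun q : ℝ × ℂ => F' q.1 q.2) (Icc a b ×ˢ closedBall (0:ℂ) 1))
    (hd : ∀ t ∈ Ioo a b, ∀ z ∈ ball (0:ℂ) 1, HasDerivAt (fun t => F t z) (F' t z) t) :
    HasDerivAt (fun t => ∫ z, F t z ∂(bergmanMeasure α)) (∫ z, F' t z ∂(bergmanMeasure α)) t := by
  have := berg_prob hα
  obtain ⟨C, hC⟩ := (isCompact_Icc.prod (isCompact_closedBall (0:ℂ) 1)).exists_bound_of_continuousOn hF'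
  have hs : Ioo a b ∈ 𝓝 t := isOpen_Ioo.mem_nhds ht
  refine (hasDerivAt_integral_of_dominated_loc_of_deriv_le (F := F) (F' := F') (bound := fun _ => C) hs
    ?_ ?_ ?_ ?_ (integrable_const C) ?_).2
  · filter_upwards [hs] with t ht
    exact (integrable_cont hα (hF t (Ioo_subset_Icc_self ht))).aestronglyMeasurable
  · exact integrable_cont hα (hF t (Ioo_subset_Icc_self ht))
  · refine (integrable_cont hα ?_).aestronglyMeasurable
    exact hF'.comp (Continuous.continuousOn (by fun_prop : Continuous fun z : ℂ => (t, z)))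
      (fun z hz => ⟨Ioo_subset_Icc_self ht, hz⟩)
  · filter_upwards [berg_ae_ball α] with z hz t ht
    exact hC (t, z) ⟨Ioo_subset_Icc_self ht, ball_subset_closedBall hz⟩
  · filter_upwards [berg_ae_ball α] with z hz t ht
    exact hd t ht z hz

lemma continuousOn_int {α : ℝ} (hα : 1 < α) {F : ℝ → ℂ → ℝ} {a b : ℝ}
    (hF : ContinuousOn (fun q : ℝ × ℂ => F q.1 q.2) (Icc a b ×ˢ closedBall (0:ℂ) 1)) :
    ContinuousOn (fun t => ∫ z, F t z ∂(bergmanMeasure α)) (Icc a b) := by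
  have := berg_prob hα
  obtain ⟨C, hC⟩ := (isCompact_Icc.prod (isCompact_closedBall (0:ℂ) 1)).exists_bound_of_continuousOn hF
  intro t ht
  refine tendsto_integral_filter_of_dominated_convergence (fun _ => C) ?_ ?_ (integrable_const C) ?_
  · filter_upwards [self_mem_nhdsWithin] with t ht
    refine (integrable_cont hα ?_).aestronglyMeasurable
    exact hF.comp (Continuous.continuousOn (by fun_prop : Continuous fun z : ℂ => (t, z)))
      (fun z hz => ⟨ht, hz⟩)
  · filter_upwards [self_mem_nhdsWithin] with t ht
    filter_upwards [berg_ae_ball α] with z hz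
    exact hC (t, z) ⟨ht, ball_subset_closedBall hz⟩
  · filter_upwards [berg_ae_ball α] with z hz
    have hc : ContinuousOn (fun t => F t z) (Icc a b) :=
      hF.comp (Continuous.continuousOn (by fun_prop : Continuous fun t : ℝ => (t, z)))
        (fun t ht => ⟨ht, ball_subset_closedBall hz⟩)
    exact hc t ht

lemma ofReal_mul_mk (ρ x y : ℝ) : (ρ:ℂ) * ⟨x, y⟩ = ⟨ρ*x, ρ*y⟩ := by
  apply Complex.ext <;> simp

lemma pw_dx {V : MvPolynomial (Fin 2) ℝ} (hV : ∀ z, 0 < ev V z) (s ρ : ℝ) (S : Set ℂ) :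
    HasDx S (fun z => (ev V (ρ*z))^s) (fun z => ρ * (s * (ev V (ρ*z))^(s-1) * ev (d0 V) (ρ*z))) := by
  intro z _
  have h1 := ev_hasDeriv V ((hasDerivAt_id z.re).const_mul ρ) (hasDerivAt_const z.re (ρ*z.im))
  have h2 := h1.rpow_const (p := s) (Or.inl (hV _).ne')
  have ez : (ρ:ℂ) * z = ⟨ρ*z.re, ρ*z.im⟩ := ofReal_mul_mk ρ z.re z.im
  simp only [ofReal_mul_mk]
  rw [ez]
  refine h2.congr_deriv ?_
  simp; ring

lemma pw_dy {V : MvPolynomial (Fin 2) ℝ} (hV : ∀ z, 0 < ev V z) (s ρ : ℝ) (S : Set ℂ) :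
    HasDy S (fun z => (ev V (ρ*z))^s) (fun z => ρ * (s * (ev V (ρ*z))^(s-1) * ev (d1 V) (ρ*z))) := by
  intro z _
  have h1 := ev_hasDeriv V (hasDerivAt_const z.im (ρ*z.re)) ((hasDerivAt_id z.im).const_mul ρ)
  have h2 := h1.rpow_const (p := s) (Or.inl (hV _).ne')
  have ez : (ρ:ℂ) * z = ⟨ρ*z.re, ρ*z.im⟩ := ofReal_mul_mk ρ z.re z.im
  simp only [ofReal_mul_mk]
  rw [ez]
  refine h2.congr_deriv ?_
  simp; ring

lemma evρ_dx (V : MvPolynomial (Fin 2) ℝ) (ρ : ℝ) (S : Set ℂ) :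
    HasDx S (fun z => ev V (ρ*z)) (fun z => ρ * ev (d0 V) (ρ*z)) := by
  intro z _
  have h1 := ev_hasDeriv V ((hasDerivAt_id z.re).const_mul ρ) (hasDerivAt_const z.re (ρ*z.im))
  have ez : (ρ:ℂ) * z = ⟨ρ*z.re, ρ*z.im⟩ := ofReal_mul_mk ρ z.re z.im
  simp only [ofReal_mul_mk]
  rw [ez]
  exact h1.congr_deriv (by simp)

lemma evρ_dy (V : MvPolynomial (Fin 2) ℝ) (ρ : ℝ) (S : Set ℂ) :
    HasDy S (fun z => ev V (ρ*z)) (fun z => ρ * ev (d1 V) (ρ*z)) := by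
  intro z _
  have h1 := ev_hasDeriv V (hasDerivAt_const z.im (ρ*z.re)) ((hasDerivAt_id z.im).const_mul ρ)
  have ez : (ρ:ℂ) * z = ⟨ρ*z.re, ρ*z.im⟩ := ofReal_mul_mk ρ z.re z.im
  simp only [ofReal_mul_mk]
  rw [ez]
  exact h1.congr_deriv (by simp)

lemma continuous_pw {V : MvPolynomial (Fin 2) ℝ} (hV : ∀ z, 0 < ev V z) (s : ℝ) :
    Continuous (fun z => (ev V z)^s) :=
  (continuous_ev V).rpow_const (fun z => Or.inl (hV z).ne')

lemma Jet.pos {f ε V} (h : Jet f ε V) (hε : 0 < ε) : ∀ z, 0 < ev V z := fun z => by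
  rw [h.val]; positivity

/-- Laplacian of V^s. -/
noncomputable def lapP (f : Polynomial ℂ) (ε : ℝ) (V : MvPolynomial (Fin 2) ℝ) (s : ℝ) (z : ℂ) : ℝ :=
  4 * s * (ev V z)^(s-2) * ‖f.derivative.eval z‖^2 * (s * ‖f.eval z‖^2 + ε)

lemma continuous_lapP {f ε V} (h : Jet f ε V) (hε : 0 < ε) (s : ℝ) : Continuous (lapP f ε V s) := by
  unfold lapP
  have := continuous_pw (h.pos hε) (s-2)
  fun_prop

lemma lapP_nonneg {f ε V} (h : Jet f ε V) (hε : 0 < ε) {s : ℝ} (hs : 0 ≤ s) (z) : 0 ≤ lapP f ε V s z := by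
  unfold lapP
  have := h.pos hε z
  positivity

lemma intR_pow {f ε V} (h : Jet f ε V) (hε : 0 < ε) {α : ℝ} (hα : 1 < α) (s ρ : ℝ) :
    ∫ z : ℂ, (z.re * (ρ * (s * (ev V (ρ*z))^(s-1) * ev (d0 V) (ρ*z))) +
        z.im * (ρ * (s * (ev V (ρ*z))^(s-1) * ev (d1 V) (ρ*z)))) ∂(bergmanMeasure α) =
      1/(2*α) * (ρ^2 * ∫ z, lapP f ε V s (ρ*z) ∂(bergmanMeasure (α+1))) := by
  have hV := h.pos hε
  have c1 : Continuous fun z : ℂ => (ev V (ρ*z))^(s-1) := (continuous_pw hV (s-1)).comp (by fun_prop)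
  have c2 : Continuous fun z : ℂ => (ev V (ρ*z))^(s-1-1) := (continuous_pw hV (s-1-1)).comp (by fun_prop)
  have hx := pw_dx hV (s-1) ρ (ball (0:ℂ) 1)
  have hy := pw_dy hV (s-1) ρ (ball (0:ℂ) 1)
  have hx1 := evρ_dx (d0 V) ρ (ball (0:ℂ) 1)
  have hy1 := evρ_dy (d1 V) ρ (ball (0:ℂ) 1)
  rw [int_R hα 
    (w11 := fun z => ρ * s * ((ρ * ((s-1) * (ev V (ρ*z))^(s-1-1) * ev (d0 V) (ρ*z))) * ev (d0 V) (ρ*z)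
        + (ev V (ρ*z))^(s-1) * (ρ * ev (d0 (d0 V)) (ρ*z))))
    (w22 := fun z => ρ * s * ((ρ * ((s-1) * (ev V (ρ*z))^(s-1-1) * ev (d1 V) (ρ*z))) * ev (d1 V) (ρ*z)
        + (ev V (ρ*z))^(s-1) * (ρ * ev (d1 (d1 V)) (ρ*z))))]
  · congr 1
    rw [← integral_const_mul]
    congr 1
    ext z
    set y : ℂ := ρ * z
    unfold lapP
    have hy := hV y
    have e1 : (ev V y)^(s-1) = (ev V y)^(s-2) * ev V y := by
      rw [show s - 1 = (s-2) + 1 by ring, Real.rpow_add hy, Real.rpow_one]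
    rw [show s - 1 - 1 = s - 2 by ring, e1]
    have g := h.grad y
    have l := h.lap y
    have v := h.val y
    calc _ = ρ^2 * s * (ev V y)^(s-2) * ((s-1) * ((ev (d0 V) y)^2 + (ev (d1 V) y)^2)
          + ev V y * (ev (d0 (d0 V)) y + ev (d1 (d1 V)) y)) := by ring
      _ = _ := by rw [g, l]; nth_rw 2 [v]; ring
  · exact Continuous.continuousOn (by fun_prop)
  · exact Continuous.continuousOn (by fun_prop)
  · exact Continuous.continuousOn (by fun_prop)
  · exact Continuous.continuousOn (by fun_prop)
  · have := (hx.mul hx1).const_mul (ρ*s)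
    convert this using 2
    ring
  · have := (hy.mul hy1).const_mul (ρ*s)
    convert this using 2
    ring

lemma shift_le {f ε V} (h : Jet f ε V) (hε : 0 < ε) {α : ℝ} (hα : 1 < α) {s : ℝ} (hs : 0 ≤ s) (ρ : ℝ) :
    ∫ z : ℂ, (ev V (ρ*z))^s ∂(bergmanMeasure (α+1)) ≤ ∫ z : ℂ, (ev V (ρ*z))^s ∂(bergmanMeasure α) := by
  have hV := h.pos hε
  have c0 : Continuous fun z : ℂ => (ev V (ρ*z))^s := (continuous_pw hV s).comp (by fun_prop)
  have c1 : Continuous fun z : ℂ => (ev V (ρ*z))^(s-1) := (continuous_pw hV (s-1)).comp (by fun_prop)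
  have := shift_id hα (w := fun z => (ev V (ρ*z))^s) (by fun_prop) (by fun_prop) (by fun_prop)
    (pw_dx hV s ρ _) (pw_dy hV s ρ _)
  rw [intR_pow h hε (by linarith : 1 < α + 1)] at this
  have hn : 0 ≤ ∫ z : ℂ, lapP f ε V s (ρ*z) ∂(bergmanMeasure (α+1+1)) :=
    integral_nonneg fun z => lapP_nonneg h hε hs _
  have : 0 ≤ 1 / (2 * (α + 1)) * (ρ ^ 2 * ∫ z : ℂ, lapP f ε V s (ρ*z) ∂(bergmanMeasure (α+1+1))) := by
    positivity
  have h2 : 2*α*∫ z : ℂ, (ev V (ρ*z))^s ∂(bergmanMeasure (α+1)) ≤ 2*α*∫ z : ℂ, (ev V (ρ*z))^s ∂(bergmanMeasure α) := by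
    linarith
  exact le_of_mul_le_mul_left h2 (by linarith)

lemma pw_ray {V : MvPolynomial (Fin 2) ℝ} (hV : ∀ z, 0 < ev V z) (s : ℝ) (z : ℂ) (ρ : ℝ) :
    HasDerivAt (fun ρ : ℝ => (ev V (ρ*z))^s)
     (z.re * (s * (ev V (ρ*z))^(s-1) * ev (d0 V) (ρ*z)) +
        z.im * (s * (ev V (ρ*z))^(s-1) * ev (d1 V) (ρ*z))) ρ := by
  have h1 := ev_hasDeriv V ((hasDerivAt_id ρ).mul_const z.re) ((hasDerivAt_id ρ).mul_const z.im)
  have h2 := h1.rpow_const (p := s) (Or.inl (hV _).ne')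
  have ez : ∀ ρ : ℝ, (ρ:ℂ) * z = ⟨ρ*z.re, ρ*z.im⟩ := fun ρ => ofReal_mul_mk ρ z.re z.im
  simp only [ez]
  refine h2.congr_deriv ?_
  simp; ring

lemma dil_deriv {f ε V} (h : Jet f ε V) (hε : 0 < ε) {α : ℝ} (hα : 1 < α) (s : ℝ) {ρ : ℝ} (hρ : 0 < ρ) :
    HasDerivAt (fun ρ : ℝ => ∫ z : ℂ, (ev V (ρ*z))^s ∂(bergmanMeasure α))
      (ρ/(2*α) * ∫ z, lapP f ε V s (ρ*z) ∂(bergmanMeasure (α+1))) ρ := by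
  have hV := h.pos hε
  have c0 := continuous_pw hV s
  have c1 := continuous_pw hV (s-1)
  have key := hasDerivAt_int hα (F := fun ρ z => (ev V (ρ*z))^s)
    (F' := fun ρ z => z.re * (s * (ev V (ρ*z))^(s-1) * ev (d0 V) (ρ*z)) +
        z.im * (s * (ev V (ρ*z))^(s-1) * ev (d1 V) (ρ*z))) (a := ρ - 1) (b := ρ + 1) (t := ρ)
    ⟨by linarith, by linarith⟩ ?_ ?_ ?_
  · refine key.congr_deriv ?_
    have := intR_pow h hε hα s ρ
    have e : ∀ z : ℂ, (z.re * (ρ * (s * (ev V (ρ*z))^(s-1) * ev (d0 V) (ρ*z))) +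
        z.im * (ρ * (s * (ev V (ρ*z))^(s-1) * ev (d1 V) (ρ*z)))) =
        ρ * (z.re * (s * (ev V (ρ*z))^(s-1) * ev (d0 V) (ρ*z)) +
        z.im * (s * (ev V (ρ*z))^(s-1) * ev (d1 V) (ρ*z))) := fun z => by ring
    simp only [e, integral_const_mul] at this
    apply mul_left_cancel₀ hρ.ne'
    rw [this]; ring
  · intro t _
    exact (c0.comp (by fun_prop : Continuous fun z : ℂ => (t:ℂ)*z)).continuousOn
  · apply Continuous.continuousOn
    have cm : Continuous fun q : ℝ × ℂ => (q.1:ℂ) * q.2 := by fun_prop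
    have c1' : Continuous fun q : ℝ × ℂ => (ev V (q.1 * q.2))^(s-1) := c1.comp cm
    fun_prop
  · intro t _ z _
    exact pw_ray hV s z t

lemma dil_cont {f ε V} (h : Jet f ε V) (hε : 0 < ε) {α : ℝ} (hα : 1 < α) (s : ℝ) (a b : ℝ) :
    ContinuousOn (fun ρ : ℝ => ∫ z : ℂ, (ev V (ρ*z))^s ∂(bergmanMeasure α)) (Icc a b) := by
  refine continuousOn_int hα (F := fun ρ z => (ev V (ρ*z))^s) (Continuous.continuousOn ?_)
  exact (continuous_pw (h.pos hε) s).comp (by fun_prop : Continuous fun q : ℝ × ℂ => (q.1:ℂ) * q.2)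

/-- dilation monotonicity -/
lemma dil_mono {f ε V} (h : Jet f ε V) (hε : 0 < ε) {α : ℝ} (hα : 1 < α) {s : ℝ} (hs : 0 ≤ s) :
    MonotoneOn (fun ρ : ℝ => ∫ z : ℂ, (ev V (ρ*z))^s ∂(bergmanMeasure α)) (Icc 0 1) := by
  refine monotoneOn_of_deriv_nonneg (convex_Icc 0 1) (dil_cont h hε hα s 0 1) ?_ ?_
  · intro x hx
    rw [interior_Icc] at hx
    exact (dil_deriv h hε hα s hx.1).differentiableAt.differentiableWithinAt
  · intro x hx
    rw [interior_Icc] at hx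
    rw [(dil_deriv h hε hα s hx.1).deriv]
    have hn : 0 ≤ ∫ z : ℂ, lapP f ε V s (x*z) ∂(bergmanMeasure (α+1)) :=
      integral_nonneg fun z => lapP_nonneg h hε hs _
    have := hx.1
    positivity

end HC
namespace HC
open Set Filter Topology

lemma memLp_cont {α : ℝ} (hα : 1 < α) {F : ℂ → ℝ} (hF : ContinuousOn F (closedBall (0:ℂ) 1)) (p : ENNReal) :
    MemLp F p (bergmanMeasure α) := by
  have := berg_prob hα
  obtain ⟨C, hC⟩ := (isCompact_closedBall (0:ℂ) 1).exists_bound_of_continuousOn hF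
  refine MemLp.of_bound (aesm_berg (hF.mono ball_subset_closedBall)) C ?_
  filter_upwards [berg_ae_ball α] with z hz using hC z (ball_subset_closedBall hz)

lemma holder {α : ℝ} (hα : 1 < α) {A B : ℂ → ℝ} (hA : ContinuousOn A (closedBall (0:ℂ) 1))
    (hB : ContinuousOn B (closedBall (0:ℂ) 1)) (hA0 : ∀ z, 0 ≤ A z) (hB0 : ∀ z, 0 ≤ B z) {θ : ℝ}
    (h0 : 0 < θ) (h1 : θ < 1) :
    ∫ z, (A z)^θ * (B z)^(1-θ) ∂(bergmanMeasure α) ≤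
      (∫ z, A z ∂(bergmanMeasure α))^θ * (∫ z, B z ∂(bergmanMeasure α))^(1-θ) := by
  have h1' : 0 < 1 - θ := by linarith
  have hpq : (1/θ).HolderConjugate (1/(1-θ)) := by
    rw [Real.holderConjugate_iff]
    constructor
    · rw [lt_div_iff₀ h0]; linarith
    · simp
  have cA : ContinuousOn (fun z => (A z)^θ) (closedBall (0:ℂ) 1) := hA.rpow_const (fun z _ => Or.inr h0.le)
  have cB : ContinuousOn (fun z => (B z)^(1-θ)) (closedBall (0:ℂ) 1) := hB.rpow_const (fun z _ => Or.inr h1'.le)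
  have := integral_mul_le_Lp_mul_Lq_of_nonneg (μ := bergmanMeasure α) hpq
    (f := fun z => (A z)^θ) (g := fun z => (B z)^(1-θ))
    (ae_of_all _ fun z => Real.rpow_nonneg (hA0 z) _) (ae_of_all _ fun z => Real.rpow_nonneg (hB0 z) _)
    (memLp_cont hα cA _) (memLp_cont hα cB _)
  have e1 : ∀ z, ((A z)^θ)^(1/θ) = A z := fun z => by
    rw [← Real.rpow_mul (hA0 z), mul_one_div_cancel h0.ne', Real.rpow_one]
  have e2 : ∀ z, ((B z)^(1-θ))^(1/(1-θ)) = B z := fun z => by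
    rw [← Real.rpow_mul (hB0 z), mul_one_div_cancel h1'.ne', Real.rpow_one]
  simp only [e1, e2, one_div_one_div] at this
  exact this

lemma eps_le {f : Polynomial ℂ} {ε : ℝ} {V} (h : Jet f ε V) (hε : 0 < ε) {α : ℝ} (hα : 1 < α) {s : ℝ}
    (hs : 0 < s) (hs1 : s ≤ 1) :
    ∫ z, (ev V z)^s ∂(bergmanMeasure α) ≤ ∫ z, ‖f.eval z‖^(2*s) ∂(bergmanMeasure α) + ε^s := by
  have := berg_prob hα
  have i1 : Integrable (fun z : ℂ => ‖f.eval z‖^(2*s)) (bergmanMeasure α) :=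
    integrable_cont hα ((by fun_prop : Continuous fun z : ℂ => ‖f.eval z‖).rpow_const
      (fun z => Or.inr (by linarith))).continuousOn
  have : ∫ z, ‖f.eval z‖^(2*s) ∂(bergmanMeasure α) + ε^s
      = ∫ z, (‖f.eval z‖^(2*s) + ε^s) ∂(bergmanMeasure α) := by
    rw [integral_add i1 (integrable_const _)]; simp
  rw [this]
  refine integral_mono (integrable_cont hα (continuous_pw (h.pos hε) s).continuousOn)
    (i1.add (integrable_const _)) fun z => ?_
  simp only [h.val]
  refine (Real.rpow_add_le_add_rpow (by positivity) hε.le hs.le hs1).trans (le_of_eq ?_)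
  rw [Real.rpow_mul (norm_nonneg _)]; norm_num

/-- the ε → 0 passage -/
lemma eps_lim {X c s : ℝ} (hs : 0 < s) (e : ℝ) (he : 0 ≤ e) (hc : 0 ≤ c)
    (h : ∀ ε > 0, X ≤ (c + ε^s)^e) : X ≤ c^e := by
  have : Tendsto (fun ε : ℝ => (c + ε^s)^e) (𝓝[>] 0) (𝓝 (c^e)) := by
    have h1 : ContinuousAt (fun ε : ℝ => (c + ε^s)^e) 0 := by
      refine ContinuousAt.rpow_const ?_ (Or.inr he)
      exact continuousAt_const.add (Real.continuousAt_rpow_const 0 s (Or.inr hs.le))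
    have h2 := h1.tendsto
    simp only [Real.zero_rpow hs.ne', add_zero] at h2
    exact h2.mono_left nhdsWithin_le_nhds
  refine ge_of_tendsto this ?_
  filter_upwards [self_mem_nhdsWithin] with ε hε using h ε hε

theorem thmB {s : ℝ} (hs : 0 < s) (hs1 : s < 1) (n : ℕ) : ∀ (f : Polynomial ℂ), f.natDegree ≤ n →
    ∀ α : ℝ, 1 < α → ∫ z : ℂ, ‖f.eval ((Real.sqrt s : ℂ) * z)‖^2 ∂(bergmanMeasure α) ≤
      (∫ z, ‖f.eval z‖^(2*s) ∂(bergmanMeasure α))^(1/s) := by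
  induction n with
  | zero =>
    intro f hf α hα
    have := berg_prob hα
    rw [Polynomial.eq_C_of_natDegree_le_zero hf]
    simp
    rw [← Real.rpow_mul (norm_nonneg _)]
    have : 2 * s * s⁻¹ = 2 := by field_simp
    rw [this]; norm_cast
  | succ n ih =>
    intro f hf α hα
    have := berg_prob hα
    have hα' : 1 < α + 1 := by linarith
    set r := Real.sqrt s with hr
    have hr0 : 0 < r := Real.sqrt_pos.2 hs
    have hr2 : r^2 = s := Real.sq_sqrt hs.le
    refine eps_lim hs (1/s) (by positivity) (integral_nonneg fun z => by positivity) ?_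
    intro ε hε
    obtain ⟨V, h⟩ := exists_jet f ε
    have hV := h.pos hε
    have key : MonotoneOn (fun ρ : ℝ => (∫ z : ℂ, (ev V (ρ*z))^s ∂(bergmanMeasure α))^(1/s) -
        ∫ z : ℂ, (ev V ((r*ρ : ℝ)*z))^(1:ℝ) ∂(bergmanMeasure α)) (Icc 0 1) := by
      have hpos : ∀ ρ : ℝ, 0 < ∫ z : ℂ, (ev V (ρ*z))^s ∂(bergmanMeasure α) := fun ρ => by
        have hc : Continuous fun z : ℂ => (ev V (ρ*z))^s := (continuous_pw hV s).comp (by fun_prop)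
        have hle : ε^s ≤ ∫ z : ℂ, (ev V (ρ*z))^s ∂(bergmanMeasure α) := by
          have : ∫ z : ℂ, ε^s ∂(bergmanMeasure α) = ε^s := by simp
          rw [← this]
          refine integral_mono (integrable_const _) (integrable_cont hα hc.continuousOn) fun z => ?_
          refine Real.rpow_le_rpow hε.le ?_ hs.le
          rw [h.val]; have := sq_nonneg ‖f.eval ((ρ:ℂ)*z)‖; linarith
        exact lt_of_lt_of_le (by positivity) hle
      have hder : ∀ ρ ∈ Ioo (0:ℝ) 1, HasDerivAt (fun ρ : ℝ => (∫ z : ℂ, (ev V (ρ*z))^s ∂(bergmanMeasure α))^(1/s) -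
        ∫ z : ℂ, (ev V ((r*ρ : ℝ)*z))^(1:ℝ) ∂(bergmanMeasure α)) 
        ((ρ/(2*α) * ∫ z, lapP f ε V s (ρ*z) ∂(bergmanMeasure (α+1))) * (1/s) *
          (∫ z : ℂ, (ev V (ρ*z))^s ∂(bergmanMeasure α))^(1/s-1) - 
          ((r*ρ)/(2*α) * ∫ z, lapP f ε V 1 ((r*ρ:ℝ)*z) ∂(bergmanMeasure (α+1))) * r) ρ := by
        intro ρ hρ
        have d1 := (dil_deriv h hε hα s hρ.1).rpow_const (p := 1/s) (Or.inl (hpos ρ).ne')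
        have d2 := dil_deriv h hε hα 1 (mul_pos hr0 hρ.1)
        have d3 : HasDerivAt (fun ρ => r * ρ) r ρ := by simpa using (hasDerivAt_id ρ).const_mul r
        have d4 := HasDerivAt.comp ρ d2 d3
        exact d1.sub d4
      refine monotoneOn_of_deriv_nonneg (convex_Icc 0 1) ?_ ?_ ?_
      · refine ContinuousOn.sub ?_ ?_
        · exact (dil_cont h hε hα s 0 1).rpow_const (fun x _ => Or.inr (by positivity))
        · refine (dil_cont h hε hα 1 0 r).comp (by fun_prop : Continuous fun ρ : ℝ => r * ρ).continuousOn ?_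
          intro ρ hρ
          exact ⟨mul_nonneg hr0.le hρ.1, by nlinarith [hρ.2]⟩
      · intro x hx
        rw [interior_Icc] at hx
        exact (hder x hx).differentiableAt.differentiableWithinAt
      · intro ρ hρ
        rw [interior_Icc] at hρ
        rw [(hder ρ hρ).deriv]
        have hρ0 := hρ.1
        set J := ∫ z : ℂ, (ev V (ρ*z))^s ∂(bergmanMeasure α) with hJ
        have hJ0 : 0 < J := hpos ρ
        set K := ∫ z : ℂ, (ev V (ρ*z))^(s-1) * ‖f.derivative.eval (ρ*z)‖^2 ∂(bergmanMeasure (α+1)) with hK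
        have cV : ∀ t : ℝ, Continuous fun z : ℂ => (ev V (ρ*z))^t := fun t =>
          (continuous_pw hV t).comp (by fun_prop)
        have cf : Continuous fun z : ℂ => ‖f.derivative.eval (ρ*z)‖ := by fun_prop
        have cL : Continuous fun z : ℂ => lapP f ε V s (ρ*z) := (continuous_lapP h hε s).comp (by fun_prop)
        have hK0 : 0 ≤ K := integral_nonneg fun z => mul_nonneg (Real.rpow_nonneg (hV _).le _) (by positivity)
        -- lower bound of Laplacian
        have s1 : 4 * s^2 * K ≤ ∫ z, lapP f ε V s (ρ*z) ∂(bergmanMeasure (α+1)) := by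
          rw [hK, ← integral_const_mul]
          refine integral_mono ((integrable_cont hα' ((cV (s-1)).mul (cf.pow 2)).continuousOn).const_mul _)
            (integrable_cont hα' cL.continuousOn) fun z => ?_
          simp only [lapP]
          set y : ℂ := ρ * z
          have hy := hV y
          have e1 : (ev V y)^(s-1) = (ev V y)^(s-2) * ev V y := by
            rw [show s - 1 = (s-2) + 1 by ring, Real.rpow_add hy, Real.rpow_one]
          rw [e1]
          have hv := h.val y
          have h3 : s * ev V y ≤ s * ‖f.eval y‖^2 + ε := by rw [hv]; nlinarith
          have h4 : 0 ≤ 4 * s * (ev V y)^(s-2) * ‖f.derivative.eval y‖^2 := by positivity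
          nlinarith [mul_le_mul_of_nonneg_left h3 h4]
        -- second Laplacian
        have s2 : ∫ z, lapP f ε V 1 ((r*ρ:ℝ)*z) ∂(bergmanMeasure (α+1)) =
            4 * ∫ z : ℂ, ‖f.derivative.eval ((r*ρ:ℝ)*z)‖^2 ∂(bergmanMeasure (α+1)) := by
          rw [← integral_const_mul]
          congr 1; ext z
          simp only [lapP]
          set y : ℂ := (r*ρ:ℝ) * z
          have hy := hV y
          have hv := h.val y
          rw [show (1:ℝ) - 2 = -1 by norm_num, Real.rpow_neg_one, one_mul, ← hv]
          field_simp
        -- induction hypothesis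
        have s3 : ∫ z : ℂ, ‖f.derivative.eval ((r*ρ:ℝ)*z)‖^2 ∂(bergmanMeasure (α+1)) ≤
            (∫ z : ℂ, ‖f.derivative.eval (ρ*z)‖^(2*s) ∂(bergmanMeasure (α+1)))^(1/s) := by
          have hd : (f.derivative.comp (Polynomial.C (ρ:ℂ) * Polynomial.X)).natDegree ≤ n := by
            refine Polynomial.natDegree_comp_le.trans ?_
            have h1 : (Polynomial.C (ρ:ℂ) * Polynomial.X).natDegree ≤ 1 :=
              (Polynomial.natDegree_C_mul_le _ _).trans Polynomial.natDegree_X_le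
            have h2 := Polynomial.natDegree_derivative_le f
            calc _ ≤ f.derivative.natDegree * 1 := Nat.mul_le_mul_left _ h1
              _ ≤ n := by omega
          have := ih _ hd (α+1) hα'
          simp only [Polynomial.eval_comp, Polynomial.eval_mul, Polynomial.eval_C, Polynomial.eval_X] at this
          have e0 : ∀ z : ℂ, ((r*ρ:ℝ):ℂ) * z = ρ * (r * z) := fun z => by push_cast; ring
          simp only [e0]
          exact this
        -- Hölder
        have s4 : ∫ z : ℂ, ‖f.derivative.eval (ρ*z)‖^(2*s) ∂(bergmanMeasure (α+1)) ≤ K^s * J^(1-s) := by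
          have h1 := holder hα' (A := fun z : ℂ => (ev V (ρ*z))^(s-1) * ‖f.derivative.eval (ρ*z)‖^2)
            (B := fun z : ℂ => (ev V (ρ*z))^s) ((cV (s-1)).mul (cf.pow 2)).continuousOn (cV s).continuousOn
            (fun z => mul_nonneg (Real.rpow_nonneg (hV _).le _) (by positivity))
            (fun z => Real.rpow_nonneg (hV _).le _) hs hs1
          have h2 : ∀ z : ℂ, ((ev V (ρ*z))^(s-1) * ‖f.derivative.eval (ρ*z)‖^2)^s * ((ev V (ρ*z))^s)^(1-s)
              = ‖f.derivative.eval (ρ*z)‖^(2*s) := fun z => by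
            have hy := hV (ρ*z)
            rw [Real.mul_rpow (Real.rpow_nonneg hy.le _) (by positivity), ← Real.rpow_mul hy.le,
              ← Real.rpow_mul hy.le, mul_right_comm, ← Real.rpow_add hy, Real.rpow_mul (norm_nonneg _)]
            rw [show (s-1)*s + s*(1-s) = 0 by ring]
            norm_num
          simp only [h2] at h1
          refine h1.trans ?_
          refine mul_le_mul_of_nonneg_left ?_ (Real.rpow_nonneg hK0 _)
          refine Real.rpow_le_rpow (integral_nonneg fun z => Real.rpow_nonneg (hV _).le _) ?_ (by linarith)
          exact shift_le h hε hα hs.le ρ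
        have s5 : (∫ z : ℂ, ‖f.derivative.eval (ρ*z)‖^(2*s) ∂(bergmanMeasure (α+1)))^(1/s) ≤ K * J^(1/s-1) := by
          refine (Real.rpow_le_rpow (integral_nonneg fun z => by positivity) s4 (by positivity)).trans (le_of_eq ?_)
          rw [Real.mul_rpow (Real.rpow_nonneg hK0 _) (Real.rpow_nonneg hJ0.le _), ← Real.rpow_mul hK0,
            ← Real.rpow_mul hJ0.le, mul_one_div_cancel hs.ne', Real.rpow_one]
          congr 2; field_simp
        rw [s2]
        have s6 := s3.trans s5
        set M := ∫ z : ℂ, ‖f.derivative.eval ((r*ρ:ℝ)*z)‖^2 ∂(bergmanMeasure (α+1))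
        set N := ∫ z, lapP f ε V s (ρ*z) ∂(bergmanMeasure (α+1))
        have hJe : 0 ≤ J^(1/s-1) := Real.rpow_nonneg hJ0.le _
        have t1 : ρ/(2*α) * (4*s^2*K) * (1/s) * J^(1/s-1) ≤ ρ/(2*α) * N * (1/s) * J^(1/s-1) := by
          gcongr
        have t2 : r*ρ/(2*α) * (4*M) * r ≤ ρ/(2*α) * (4*s^2*K) * (1/s) * J^(1/s-1) := by
          have e1 : r*ρ/(2*α) * (4*M) * r = (ρ/(2*α)*4*s) * M := by
            rw [← hr2]; ring
          have e2 : ρ/(2*α) * (4*s^2*K) * (1/s) * J^(1/s-1) = (ρ/(2*α)*4*s) * (K * J^(1/s-1)) := by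
            field_simp
          rw [e1, e2]
          exact mul_le_mul_of_nonneg_left s6 (by positivity)
        linarith
    have k1 := key (left_mem_Icc.2 zero_le_one) (right_mem_Icc.2 zero_le_one) zero_le_one
    simp only [mul_zero, Complex.ofReal_zero, zero_mul, Real.rpow_one, integral_const, probReal_univ,
      one_smul, mul_one, Complex.ofReal_one, one_mul] at k1
    rw [← Real.rpow_mul (hV _).le, mul_one_div_cancel hs.ne', Real.rpow_one, sub_self] at k1
    have k2 : ∫ z : ℂ, ‖f.eval ((r : ℂ) * z)‖^2 ∂(bergmanMeasure α) ≤ ∫ z : ℂ, ev V (r*z) ∂(bergmanMeasure α) := by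
      refine integral_mono (integrable_cont hα (Continuous.continuousOn (by fun_prop)))
        (integrable_cont hα (Continuous.continuousOn (by fun_prop))) fun z => ?_
      simp only [h.val]; linarith
    have k3 := Real.rpow_le_rpow (integral_nonneg fun z => Real.rpow_nonneg (hV z).le _)
      (eps_le h hε hα hs hs1.le) (by positivity : 0 ≤ 1/s)
    linarith

end HC
namespace HC
open Set Filter Topology

lemma d_comm (P) : d1 (d0 P) = d0 (d1 P) := by
  induction P using MvPolynomial.induction_on with
  | C a => simp
  | add P Q hP hQ => simp only [map_add, hP, hQ]
  | mul_X P i hP =>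
    fin_cases i
    · simp [Derivation.leibniz, MvPolynomial.pderiv_X, hP, add_comm]
    · simp [Derivation.leibniz, MvPolynomial.pderiv_X, hP, add_comm]

lemma totalDegree_pderiv (P : MvPolynomial (Fin 2) ℝ) (i : Fin 2) :
    (MvPolynomial.pderiv i P).totalDegree ≤ P.totalDegree - 1 := by
  conv_lhs => rw [P.as_sum, map_sum]
  refine (MvPolynomial.totalDegree_finsetSum _ _).trans (Finset.sup_le fun s hs => ?_)
  rw [MvPolynomial.pderiv_monomial]
  by_cases h : s i = 0
  · simp [h]
  · refine (MvPolynomial.totalDegree_monomial_le _ _).trans ?_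
    have h1 : (s.sum fun _ e => e) ≤ P.totalDegree := MvPolynomial.le_totalDegree hs
    have h2 : s = (s - Finsupp.single i 1) + Finsupp.single i 1 := by
      rw [tsub_add_cancel_of_le]
      rw [Finsupp.single_le_iff]; omega
    have h3 : (s.sum fun _ e => e) = ((s - Finsupp.single i 1).sum fun _ e => e) + 1 := by
      conv_lhs => rw [h2]
      rw [Finsupp.sum_add_index' (by simp) (by simp)]; simp
    have : ((s - Finsupp.single i 1).sum fun _ => id) = ((s - Finsupp.single i 1).sum fun _ e => e) := rfl
    omega

noncomputable def Lop (b : ℝ) : MvPolynomial (Fin 2) ℝ →ₗ[ℝ] MvPolynomial (Fin 2) ℝ where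
  toFun P := (1 - MvPolynomial.X 0 ^ 2 - MvPolynomial.X 1 ^ 2) * (d0 (d0 P) + d1 (d1 P))
    - (2*b) • (MvPolynomial.X 0 * d0 P + MvPolynomial.X 1 * d1 P)
  map_add' P Q := by
    simp only [map_add, smul_add, mul_add]; abel
  map_smul' a P := by
    simp only [Derivation.map_smul, RingHom.id_apply, smul_sub, mul_add, smul_add, mul_smul_comm, smul_comm (2*b) a]

lemma Lop_apply (b P) : Lop b P = (1 - MvPolynomial.X 0 ^ 2 - MvPolynomial.X 1 ^ 2) * (d0 (d0 P) + d1 (d1 P))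
    - (2*b) • (MvPolynomial.X 0 * d0 P + MvPolynomial.X 1 * d1 P) := rfl

lemma Lop_deg (b P) {n : ℕ} (hn : 2 ≤ n) (hP : P.totalDegree ≤ n) : (Lop b P).totalDegree ≤ n := by
  have g0 : ∀ P, (d0 P).totalDegree ≤ P.totalDegree - 1 := fun P => totalDegree_pderiv P 0
  have g1 : ∀ P, (d1 P).totalDegree ≤ P.totalDegree - 1 := fun P => totalDegree_pderiv P 1
  rw [Lop_apply]
  refine (MvPolynomial.totalDegree_sub _ _).trans (max_le ?_ ?_)
  · refine (MvPolynomial.totalDegree_mul _ _).trans ?_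
    have h1 : (1 - MvPolynomial.X 0 ^ 2 - MvPolynomial.X 1 ^ 2 : MvPolynomial (Fin 2) ℝ).totalDegree ≤ 2 := by
      refine (MvPolynomial.totalDegree_sub _ _).trans (max_le ((MvPolynomial.totalDegree_sub _ _).trans (max_le ?_ ?_)) ?_)
      · simp
      · simp
      · simp
    have h2 : (d0 (d0 P) + d1 (d1 P)).totalDegree ≤ n - 2 := by
      refine (MvPolynomial.totalDegree_add _ _).trans (max_le ?_ ?_)
      · have := g0 (d0 P); have := g0 P; omega
      · have := g1 (d1 P); have := g1 P; omega
    omega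
  · refine (MvPolynomial.totalDegree_smul_le _ _).trans ?_
    refine (MvPolynomial.totalDegree_add _ _).trans (max_le ?_ ?_)
    · refine (MvPolynomial.totalDegree_mul _ _).trans ?_
      have := g0 P; simp only [MvPolynomial.totalDegree_X]; omega
    · refine (MvPolynomial.totalDegree_mul _ _).trans ?_
      have := g1 P; simp only [MvPolynomial.totalDegree_X]; omega

theorem exists_flow (b : ℝ) (U0 : MvPolynomial (Fin 2) ℝ) : ∃ (N : ℕ) (P : Fin N → MvPolynomial (Fin 2) ℝ)
    (c c' : ℝ → Fin N → ℝ), LinearIndependent ℝ P ∧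
    (∀ a : ℝ, ∃ e : Fin N → ℝ, ∑ i, e i • P i = MvPolynomial.C a) ∧
    (∀ i t, HasDerivAt (fun t => c t i) (c' t i) t) ∧ (∀ i, Continuous fun t => c' t i) ∧
    ∑ i, c 0 i • P i = U0 ∧ ∀ t, Lop b (∑ i, c t i • P i) = ∑ i, c' t i • P i := by
  set n := max 2 U0.totalDegree with hn
  let S := MvPolynomial.restrictTotalDegree (Fin 2) ℝ n
  have hS : ∀ P, P ∈ S ↔ P.totalDegree ≤ n := fun P => MvPolynomial.mem_restrictTotalDegree _ _ _
  have hinv : ∀ P ∈ S, Lop b P ∈ S := fun P hP => (hS _).2 (Lop_deg b P (le_max_left _ _) ((hS _).1 hP))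
  let LS : S →ₗ[ℝ] S := (Lop b).restrict hinv
  let B := Module.finBasis ℝ S
  let N := Module.finrank ℝ S
  let e := B.equivFun
  let A : (Fin N → ℝ) →L[ℝ] (Fin N → ℝ) :=
    LinearMap.toContinuousLinearMap (e.toLinearMap ∘ₗ LS ∘ₗ e.symm.toLinearMap)
  have hU0 : U0 ∈ S := (hS _).2 (le_max_right _ _)
  let c0 := e ⟨U0, hU0⟩
  let c : ℝ → Fin N → ℝ := fun t => NormedSpace.exp (t • A) c0
  have hsum : ∀ v : Fin N → ℝ, ∑ i, v i • ((B i : S) : MvPolynomial (Fin 2) ℝ) = ((e.symm v : S) : MvPolynomial (Fin 2) ℝ) := by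
    intro v
    rw [Module.Basis.equivFun_symm_apply, Submodule.coe_sum]; rfl
  have hd : ∀ t, HasDerivAt c (A (c t)) t := by
    intro t
    have h1 := hasDerivAt_exp_smul_const' A t
    have h2 := (ContinuousLinearMap.apply ℝ (Fin N → ℝ) c0).hasFDerivAt.comp_hasDerivAt t h1
    simpa [Function.comp_def] using h2
  refine ⟨N, fun i => ((B i : S) : MvPolynomial (Fin 2) ℝ), c, fun t => A (c t), ?_, ?_, ?_, ?_, ?_, ?_⟩
  · exact B.linearIndependent.map' S.subtype (Submodule.ker_subtype S)
  · intro a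
    have ha : MvPolynomial.C a ∈ S := (hS _).2 (by simp)
    exact ⟨e ⟨_, ha⟩, by rw [hsum]; simp⟩
  · intro i t
    exact (hasDerivAt_pi.1 (hd t)) i
  · intro i
    have hc : Continuous c := continuous_iff_continuousAt.2 fun t => (hd t).continuousAt
    exact (continuous_apply i).comp (A.continuous.comp hc)
  · rw [hsum]
    simp [c, c0, NormedSpace.exp_zero]
  · intro t
    rw [hsum, hsum]
    simp only [A, LinearMap.coe_toContinuousLinearMap', LinearMap.comp_apply]
    simp [LS]

end HC
namespace HC
open Set Filter Topology

structure Flow (b : ℝ) (U : ℝ → MvPolynomial (Fin 2) ℝ) : Prop where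
  deriv : ∀ (D : MvPolynomial (Fin 2) ℝ →ₗ[ℝ] MvPolynomial (Fin 2) ℝ) (z : ℂ) (t : ℝ),
    HasDerivAt (fun t => ev (D (U t)) z) (ev (D (Lop b (U t))) z) t
  cont : ∀ (D : MvPolynomial (Fin 2) ℝ →ₗ[ℝ] MvPolynomial (Fin 2) ℝ),
    Continuous fun q : ℝ × ℂ => ev (D (U q.1)) q.2

lemma ev_sum {ι : Type*} (s : Finset ι) (P : ι → MvPolynomial (Fin 2) ℝ) (z : ℂ) :
    ev (∑ i ∈ s, P i) z = ∑ i ∈ s, ev (P i) z := by simp [ev]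

lemma Lop_ev (b P) (z : ℂ) : ev (Lop b P) z = (1 - ‖z‖^2) * (ev (d0 (d0 P)) z + ev (d1 (d1 P)) z)
    - 2*b*(z.re * ev (d0 P) z + z.im * ev (d1 P) z) := by
  rw [Lop_apply, ← Complex.normSq_eq_norm_sq, Complex.normSq_apply]
  simp only [ev_sub, ev_mul, ev_add, ev_smul, ev_one, ev_pow, ev_X0, ev_X1]
  ring

lemma second_deriv_nonneg {g g' : ℝ → ℝ} {x g2 : ℝ} (h1 : ∀ y, HasDerivAt g (g' y) y) (h2 : HasDerivAt g' g2 x)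
    (hm : IsLocalMin g x) : 0 ≤ g2 := by
  by_contra hc
  push Not at hc
  have e0 : g' x = 0 := hm.hasDerivAt_eq_zero (h1 x)
  have e1 : deriv g = g' := funext fun y => (h1 y).deriv
  have hM : IsLocalMin (fun y => - g y) x := by
    have e2 : deriv (fun y => - g y) = fun y => - g' y := funext fun y => (h1 y).neg.deriv
    refine isLocalMin_of_deriv_deriv_pos ?_ ?_ (h1 x).continuousAt.neg
    · rw [e2, h2.fun_neg.deriv]; linarith
    · rw [e2]; simp [e0]
  have hconst : ∀ᶠ y in 𝓝 x, g y = g x := by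
    filter_upwards [hm, hM] with y h3 h4
    simp only [neg_le_neg_iff] at h4
    exact le_antisymm h4 h3
  have hz : ∀ᶠ y in 𝓝 x, g' y = 0 := by
    filter_upwards [hconst.eventually_nhds] with y hy
    exact (h1 y).unique ((hasDerivAt_const y (g x)).congr_of_eventuallyEq hy)
  have := h2.unique ((hasDerivAt_const x (0:ℝ)).congr_of_eventuallyEq hz)
  linarith

lemma left_nonpos {g : ℝ → ℝ} {g' a x : ℝ} (ha : a < x) (hd : HasDerivAt g g' x)
    (h : ∀ y ∈ Ioo a x, g x ≤ g y) : g' ≤ 0 := by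
  have h1 := (hasDerivAt_iff_tendsto_slope_left_right.1 hd).1
  refine le_of_tendsto h1 ?_
  filter_upwards [Ioo_mem_nhdsLT ha] with y hy
  rw [slope_def_field]
  exact div_nonpos_of_nonneg_of_nonpos (by linarith [h y hy]) (by linarith [hy.2])

lemma min_L {b : ℝ} (hb : 0 ≤ b) {P : MvPolynomial (Fin 2) ℝ} {z : ℂ} (hz : z ∈ closedBall (0:ℂ) 1)
    (hm : ∀ w ∈ closedBall (0:ℂ) 1, ev P z ≤ ev P w) : 0 ≤ ev (Lop b P) z := by
  rw [Lop_ev]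
  rcases (mem_closedBall_zero_iff.1 hz).lt_or_eq with h | h
  · have hnear : ∀ᶠ w in 𝓝 z, ev P z ≤ ev P w := by
      filter_upwards [isOpen_ball.mem_nhds (mem_ball_zero_iff.2 h)] with w hw
      exact hm w (ball_subset_closedBall hw)
    have cx : Continuous fun t : ℝ => (⟨t, z.im⟩ : ℂ) := by
      have : (fun t : ℝ => (⟨t, z.im⟩ : ℂ)) = fun t : ℝ => (t:ℂ) + z.im * Complex.I := by
        ext t; simp [Complex.mk_eq_add_mul_I]
      rw [this]; fun_prop
    have cy : Continuous fun t : ℝ => (⟨z.re, t⟩ : ℂ) := by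
      have : (fun t : ℝ => (⟨z.re, t⟩ : ℂ)) = fun t : ℝ => (z.re:ℂ) + t * Complex.I := by
        ext t; simp [Complex.mk_eq_add_mul_I]
      rw [this]; fun_prop
    have mx : IsLocalMin (fun t : ℝ => ev P ⟨t, z.im⟩) z.re := (cx.tendsto z.re).eventually hnear
    have my : IsLocalMin (fun t : ℝ => ev P ⟨z.re, t⟩) z.im := (cy.tendsto z.im).eventually hnear
    have a0 : ev (d0 P) z = 0 := mx.hasDerivAt_eq_zero (ev_dx P univ z trivial)
    have a1 : ev (d1 P) z = 0 := my.hasDerivAt_eq_zero (ev_dy P univ z trivial)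
    have b0 : 0 ≤ ev (d0 (d0 P)) z := second_deriv_nonneg (fun y => ev_dx P univ ⟨y, z.im⟩ trivial)
      (ev_dx (d0 P) univ z trivial) mx
    have b1 : 0 ≤ ev (d1 (d1 P)) z := second_deriv_nonneg (fun y => ev_dy P univ ⟨z.re, y⟩ trivial)
      (ev_dy (d1 P) univ z trivial) my
    rw [a0, a1]
    have : 0 ≤ 1 - ‖z‖^2 := by nlinarith [norm_nonneg z]
    have := mul_nonneg this (add_nonneg b0 b1)
    linarith
  · have hd := ev_hasDeriv P ((hasDerivAt_id (1:ℝ)).mul_const z.re) ((hasDerivAt_id (1:ℝ)).mul_const z.im)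
    simp only [id, one_mul] at hd
    have hR : z.re * ev (d0 P) z + z.im * ev (d1 P) z ≤ 0 := by
      refine left_nonpos zero_lt_one hd fun y hy => ?_
      simp only [one_mul]
      refine hm _ ?_
      rw [← ofReal_mul_mk, mem_closedBall_zero_iff, norm_mul, Complex.norm_real, h, Real.norm_eq_abs,
        abs_of_pos hy.1]
      linarith [hy.2]
    rw [h]
    nlinarith

lemma flow_pos {b : ℝ} (hb : 0 ≤ b) {U} (hU : Flow b U) {ε : ℝ} (h0 : ∀ z ∈ closedBall (0:ℂ) 1, ε ≤ ev (U 0) z)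
    {T : ℝ} (hT : 0 ≤ T) : ∀ z ∈ closedBall (0:ℂ) 1, ε ≤ ev (U T) z := by
  have main : ∀ δ > 0, ∀ z ∈ closedBall (0:ℂ) 1, ε ≤ ev (U T) z + δ * T := by
    intro δ hδ z hz
    have hc : Continuous fun q : ℝ × ℂ => ev (U q.1) q.2 + δ * q.1 := (hU.cont LinearMap.id).add (by fun_prop)
    obtain ⟨⟨t, w⟩, ⟨ht, hw⟩, hmin⟩ := ((isCompact_Icc (a := (0:ℝ)) (b := T)).prod
      (isCompact_closedBall (0:ℂ) 1)).exists_isMinOn ⟨(0, 0), ⟨⟨le_rfl, hT⟩, by simp⟩⟩ hc.continuousOn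
    simp only at ht hw
    have hmin' : ∀ t' ∈ Icc 0 T, ∀ w' ∈ closedBall (0:ℂ) 1, ev (U t) w + δ * t ≤ ev (U t') w' + δ * t' :=
      fun t' h1 w' h2 => hmin (a := (t', w')) ⟨h1, h2⟩
    rcases ht.1.eq_or_lt with h | h
    · subst h
      have := hmin' T ⟨hT, le_rfl⟩ z hz
      have := h0 w hw
      linarith
    · exfalso
      have hL : 0 ≤ ev (Lop b (U t)) w := min_L hb hw (fun w' hw' => by
        have := hmin' t ht w' hw'; linarith)
      have hd := (hU.deriv LinearMap.id w t).add ((hasDerivAt_id t).const_mul δ)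
      simp only [LinearMap.id_apply, mul_one] at hd
      have := left_nonpos h hd (fun y hy => hmin' y ⟨hy.1.le, hy.2.le.trans ht.2⟩ w hw)
      linarith
  intro z hz
  have : Tendsto (fun δ => ev (U T) z + δ * T) (𝓝[>] (0:ℝ)) (𝓝 (ev (U T) z + 0 * T)) :=
    ((by fun_prop : Continuous fun δ : ℝ => ev (U T) z + δ * T).tendsto 0).mono_left nhdsWithin_le_nhds
  rw [zero_mul, add_zero] at this
  refine ge_of_tendsto this ?_
  filter_upwards [self_mem_nhdsWithin] with δ hδ using main δ hδ z hz

end HC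
namespace HC
open Set Filter Topology

lemma zero_of_int {α : ℝ} (hα : 1 < α) {w : ℂ → ℝ} (hw : Continuous w) (h0 : ∀ z, 0 ≤ w z)
    (hi : ∫ z, w z ∂(bergmanMeasure α) = 0) : ∀ z ∈ ball (0:ℂ) 1, w z = 0 := by
  have hint := (integrable_berg_iff hα w).1 (integrable_cont hα hw.continuousOn)
  rw [integral_berg hα, setIntegral_eq_zero_iff_of_nonneg_ae _ hint] at hi
  · have : w =ᵐ[volume.restrict (ball (0:ℂ) 1)] 0 := by
      filter_upwards [hi, ae_restrict_mem measurableSet_ball] with z hz hzb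
      simp only [Pi.zero_apply, mul_eq_zero] at hz ⊢
      refine hz.resolve_left ?_
      have : ‖z‖ < 1 := by simpa using hzb
      have h2 : 0 < 1 - ‖z‖^2 := by nlinarith [norm_nonneg z]
      have : 0 < α - 1 := by linarith
      have := Real.pi_pos
      unfold dens
      positivity
    exact Measure.eqOn_open_of_ae_eq this isOpen_ball hw.continuousOn continuousOn_const
  · filter_upwards [ae_restrict_mem measurableSet_ball] with z hzb
    exact mul_nonneg (dens_nonneg hα hzb) (h0 z)

lemma poly_zero {P : MvPolynomial (Fin 2) ℝ} (h : ∀ z ∈ ball (0:ℂ) 1, ev P z = 0) : P = 0 := by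
  refine MvPolynomial.funext_set (fun _ => Ioo (-1/2 : ℝ) (1/2)) (fun _ => Ioo_infinite (by norm_num)) ?_
  intro x hx
  have h0 := hx 0 trivial
  have h1 := hx 1 trivial
  have hz := h ⟨x 0, x 1⟩ (by
    rw [mem_ball_zero_iff, ← sq_lt_one_iff₀ (norm_nonneg _), ← Complex.normSq_eq_norm_sq, Complex.normSq_apply]
    simp only
    have := h0.1; have := h0.2; have := h1.1; have := h1.2
    nlinarith)
  have : x = ![x 0, x 1] := by ext i; fin_cases i <;> rfl
  rw [this, map_zero]
  exact hz

lemma poly_const {P : MvPolynomial (Fin 2) ℝ} (h0 : d0 P = 0) (h1 : d1 P = 0) : P = MvPolynomial.C (ev P 0) := by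
  rw [← sub_eq_zero]
  refine poly_zero fun z _ => ?_
  rw [ev_sub, ev_C, sub_eq_zero]
  have hd : ∀ t : ℝ, HasDerivAt (fun t : ℝ => ev P ⟨t * z.re, t * z.im⟩) 0 t := fun t => by
    have := ev_hasDeriv P ((hasDerivAt_id t).mul_const z.re) ((hasDerivAt_id t).mul_const z.im)
    simpa [h0, h1] using this
  have := is_const_of_deriv_eq_zero (fun t => (hd t).differentiableAt) (fun t => (hd t).deriv) 1 0
  simpa [show (⟨0, 0⟩ : ℂ) = 0 from rfl] using this

lemma quad {α : ℝ} (hα : 1 < α) {N : ℕ} {a : Fin N → ℂ → ℝ} (ha : ∀ i, Continuous (a i)) (e : Fin N → ℝ) :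
    ∫ z, (∑ i, e i * a i z)^2 ∂(bergmanMeasure α) =
      ∑ i, ∑ j, e i * e j * ∫ z, a i z * a j z ∂(bergmanMeasure α) := by
  have h1 : ∀ z, (∑ i, e i * a i z)^2 = ∑ i, ∑ j, e i * e j * (a i z * a j z) := fun z => by
    rw [sq, Finset.sum_mul_sum]
    exact Finset.sum_congr rfl fun i _ => Finset.sum_congr rfl fun j _ => by ring
  simp only [h1]
  rw [integral_finsetSum]
  · refine Finset.sum_congr rfl fun i _ => ?_
    rw [integral_finsetSum]
    · exact Finset.sum_congr rfl fun j _ => integral_const_mul _ _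
    · intro j _
      exact integrable_cont hα (Continuous.continuousOn (by fun_prop))
  · intro i _
    exact integrable_cont hα (Continuous.continuousOn (by fun_prop))

lemma homog {N : ℕ} {q w : (Fin N → ℝ) → ℝ} (hq : Continuous q) (hw : Continuous w)
    (h1 : ∀ (r : ℝ) e, q (r • e) = r^2 * q e) (h2 : ∀ (r : ℝ) e, w (r • e) = r^2 * w e)
    (hpos : ∀ e, e ≠ 0 → 0 < q e) : ∃ C, 0 ≤ C ∧ ∀ e, w e ≤ C * q e := by
  have hcomp := isCompact_sphere (0 : Fin N → ℝ) 1
  have hne : ∀ e ∈ sphere (0 : Fin N → ℝ) 1, q e ≠ 0 := fun e he => by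
    refine (hpos e ?_).ne'
    rintro rfl; simp at he
  obtain ⟨C, hC⟩ := hcomp.exists_bound_of_continuousOn (hw.continuousOn.div hq.continuousOn hne)
  refine ⟨max C 0, le_max_right _ _, fun e => ?_⟩
  by_cases he : e = 0
  · subst he
    have a := h1 0 0; have b := h2 0 0
    simp at a b
    rw [a, b]; simp
  · have hn : 0 < ‖e‖ := norm_pos_iff.2 he
    have hs : ‖e‖⁻¹ • e ∈ sphere (0 : Fin N → ℝ) 1 := by
      rw [mem_sphere_zero_iff_norm, norm_smul, norm_inv, norm_norm, inv_mul_cancel₀ hn.ne']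
    have h3 := (le_abs_self _).trans (hC _ hs)
    rw [Pi.div_apply, h1, h2, mul_div_mul_left _ _ (by positivity), div_le_iff₀ (hpos e he)] at h3
    exact h3.trans (mul_le_mul_of_nonneg_right (le_max_left _ _) (hpos e he).le)

lemma poincare {α : ℝ} (hα : 1 < α) {N : ℕ} {P : Fin N → MvPolynomial (Fin 2) ℝ} (hP : LinearIndependent ℝ P)
    (hone : ∀ a : ℝ, ∃ e : Fin N → ℝ, ∑ i, e i • P i = MvPolynomial.C a) :
    ∃ C, 0 ≤ C ∧ ∀ (e : Fin N → ℝ) (U : MvPolynomial (Fin 2) ℝ), U = ∑ i, e i • P i →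
      ∫ z, (ev U z)^2 ∂(bergmanMeasure α) - (∫ z, ev U z ∂(bergmanMeasure α))^2 ≤
       C * ∫ z, ((ev (d0 U) z)^2 + (ev (d1 U) z)^2) ∂(bergmanMeasure (α+1)) := by
  have hα' : 1 < α + 1 := by linarith
  have hpr := berg_prob hα
  let V : (Fin N → ℝ) → MvPolynomial (Fin 2) ℝ := fun e => ∑ i, e i • P i
  have evV : ∀ (D : MvPolynomial (Fin 2) ℝ →ₗ[ℝ] MvPolynomial (Fin 2) ℝ) e z, ev (D (V e)) z = ∑ i, e i * ev (D (P i)) z := by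
    intro D e z; simp only [V, map_sum, map_smul, ev_sum, ev_smul]
  let w : (Fin N → ℝ) → ℝ := fun e => ∫ z, (ev (V e) z)^2 ∂(bergmanMeasure α)
  let q1 : (Fin N → ℝ) → ℝ := fun e => ∫ z, (ev (d0 (V e)) z)^2 ∂(bergmanMeasure (α+1))
  let q2 : (Fin N → ℝ) → ℝ := fun e => ∫ z, (ev (d1 (V e)) z)^2 ∂(bergmanMeasure (α+1))
  have cw : Continuous w := by
    have : w = fun e => ∑ i, ∑ j, e i * e j * ∫ z, ev (P i) z * ev (P j) z ∂(bergmanMeasure α) := by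
      ext e; rw [← quad hα (fun i => by fun_prop)]
      exact integral_congr_ae (ae_of_all _ fun z => congrArg (fun x : ℝ => x^2) (evV LinearMap.id e z))
    rw [this]; fun_prop
  have c1 : Continuous q1 := by
    have : q1 = fun e => ∑ i, ∑ j, e i * e j * ∫ z, ev (d0 (P i)) z * ev (d0 (P j)) z ∂(bergmanMeasure (α+1)) := by
      ext e; rw [← quad hα' (fun i => by fun_prop)]
      exact integral_congr_ae (ae_of_all _ fun z => congrArg (fun x : ℝ => x^2) (evV (MvPolynomial.pderiv 0).toLinearMap e z))
    rw [this]; fun_prop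
  have c2 : Continuous q2 := by
    have : q2 = fun e => ∑ i, ∑ j, e i * e j * ∫ z, ev (d1 (P i)) z * ev (d1 (P j)) z ∂(bergmanMeasure (α+1)) := by
      ext e; rw [← quad hα' (fun i => by fun_prop)]
      exact integral_congr_ae (ae_of_all _ fun z => congrArg (fun x : ℝ => x^2) (evV (MvPolynomial.pderiv 1).toLinearMap e z))
    rw [this]; fun_prop
  have c3 : Continuous fun e => (ev (V e) 0)^2 := by
    have : (fun e => (ev (V e) 0)^2) = fun e => (∑ i, e i * ev (P i) 0)^2 := by
      ext e; congr 1; exact evV LinearMap.id e 0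
    rw [this]; fun_prop
  have Vs : ∀ (r : ℝ) e, V (r • e) = r • V e := fun r e => by
    simp only [V, Pi.smul_apply, smul_eq_mul, mul_smul, Finset.smul_sum]
  obtain ⟨C, hC0, hC⟩ := homog (q := fun e => q1 e + q2 e + (ev (V e) 0)^2) (w := w) (by fun_prop) cw
    (by
      intro r e
      simp only [q1, q2, Vs, Derivation.map_smul, ev_smul, mul_pow, integral_const_mul]; ring)
    (by
      intro r e
      simp only [w, Vs, ev_smul, mul_pow, integral_const_mul])
    (by
      intro e he
      have g1 : 0 ≤ q1 e := integral_nonneg fun z => sq_nonneg _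
      have g2 : 0 ≤ q2 e := integral_nonneg fun z => sq_nonneg _
      have g3 := sq_nonneg (ev (V e) 0)
      by_contra hc
      push Not at hc
      have z1 : q1 e = 0 := by linarith
      have z2 : q2 e = 0 := by linarith
      have z3 : (ev (V e) 0)^2 = 0 := by linarith
      have y1 : d0 (V e) = 0 := poly_zero fun z hz =>
        pow_eq_zero_iff (two_ne_zero) |>.1 (zero_of_int hα' (by fun_prop) (fun z => sq_nonneg _) z1 z hz)
      have y2 : d1 (V e) = 0 := poly_zero fun z hz =>
        pow_eq_zero_iff (two_ne_zero) |>.1 (zero_of_int hα' (by fun_prop) (fun z => sq_nonneg _) z2 z hz)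
      have y3 := poly_const y1 y2
      rw [pow_eq_zero_iff two_ne_zero] at z3
      rw [z3, map_zero] at y3
      exact he (funext fun i => Fintype.linearIndependent_iff.1 hP e y3 i))
  refine ⟨C, hC0, fun e U hU => ?_⟩
  obtain ⟨e1, he1⟩ := hone (ev U 0)
  have hV : V (e - e1) = U - MvPolynomial.C (ev U 0) := by
    rw [hU, ← hU, ← he1, hU]
    simp only [V, Pi.sub_apply, sub_smul, Finset.sum_sub_distrib]
  have := hC (e - e1)
  simp only [w, q1, q2, hV, map_sub, MvPolynomial.pderiv_C, sub_zero, ev_sub, ev_C, sub_self] at this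
  have i1 : Integrable (fun z => ev U z) (bergmanMeasure α) := integrable_cont hα (continuous_ev U).continuousOn
  have i2 : Integrable (fun z => (ev U z)^2) (bergmanMeasure α) := integrable_cont hα ((continuous_ev U).pow 2).continuousOn
  have e3 : ∫ z, (ev U z - ev U 0)^2 ∂(bergmanMeasure α) =
      ∫ z, (ev U z)^2 ∂(bergmanMeasure α) - 2 * ev U 0 * ∫ z, ev U z ∂(bergmanMeasure α) + (ev U 0)^2 := by
    have : ∀ z, (ev U z - ev U 0)^2 = ((ev U z)^2 - 2 * ev U 0 * ev U z) + (ev U 0)^2 := fun z => by ring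
    simp only [this]
    rw [integral_add (f := fun z => (ev U z)^2 - 2 * ev U 0 * ev U z) (i2.sub (i1.const_mul _)) (integrable_const _),
      integral_sub i2 (i1.const_mul _),
      integral_const_mul]
    simp
  rw [integral_add (integrable_cont hα' (Continuous.continuousOn (by fun_prop)))
    (integrable_cont hα' (Continuous.continuousOn (by fun_prop)))]
  rw [e3] at this
  nlinarith [sq_nonneg (ev U 0 - ∫ z, ev U z ∂(bergmanMeasure α))]

theorem exists_flow' {α : ℝ} (hα : 1 < α) (U0 : MvPolynomial (Fin 2) ℝ) : ∃ U : ℝ → MvPolynomial (Fin 2) ℝ,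
    U 0 = U0 ∧ Flow (α-1) U ∧ ∃ C, 0 ≤ C ∧ ∀ t,
      ∫ z, (ev (U t) z)^2 ∂(bergmanMeasure α) - (∫ z, ev (U t) z ∂(bergmanMeasure α))^2 ≤
       C * ∫ z, ((ev (d0 (U t)) z)^2 + (ev (d1 (U t)) z)^2) ∂(bergmanMeasure (α+1)) := by
  obtain ⟨N, P, c, c', hP, hone, hd, hc', h0, hL⟩ := exists_flow (α-1) U0
  obtain ⟨C, hC0, hC⟩ := poincare hα hP hone
  refine ⟨fun t => ∑ i, c t i • P i, h0, ⟨?_, ?_⟩, C, hC0, fun t => hC (c t) _ rfl⟩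
  · intro D z t
    rw [hL]
    simp only [map_sum, map_smul, ev_sum, ev_smul]
    exact HasDerivAt.fun_sum fun i _ => (hd i t).mul_const _
  · intro D
    simp only [map_sum, map_smul, ev_sum, ev_smul]
    have : ∀ i, Continuous fun t => c t i := fun i => continuous_iff_continuousAt.2 fun t => (hd i t).continuousAt
    refine continuous_finsetSum _ fun i _ => ?_
    exact ((this i).comp continuous_fst).mul ((continuous_ev _).comp continuous_snd)

end HC
namespace HC
open Set Filter Topology

lemma zero_div {α : ℝ} (hα : 1 < α) {X Y X1 Y2 : ℂ → ℝ}
    (hX : ContinuousOn X (closedBall (0:ℂ) 1)) (hX1 : ContinuousOn X1 (closedBall (0:ℂ) 1))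
    (hY : ContinuousOn Y (closedBall (0:ℂ) 1)) (hY2 : ContinuousOn Y2 (closedBall (0:ℂ) 1))
    (hdx : HasDx (ball (0:ℂ) 1) X X1) (hdy : HasDy (ball (0:ℂ) 1) Y Y2) :
    ∫ z, ((1 - ‖z‖^2) * (X1 z + Y2 z) - 2*α*(z.re * X z + z.im * Y z)) ∂(bergmanMeasure (α+1)) = 0 := by
  have hα' : 1 < α + 1 := by linarith
  have h1 := div_thm hα' hX hX1 hY hY2 hdx hdy
  rw [integral_succ hα'] at h1
  have cs : ContinuousOn (fun z : ℂ => 1 - ‖z‖^2) (closedBall (0:ℂ) 1) := Continuous.continuousOn (by fun_prop)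
  have cr := Complex.continuous_re.continuousOn (s := closedBall (0:ℂ) 1)
  have ci := Complex.continuous_im.continuousOn (s := closedBall (0:ℂ) 1)
  rw [integral_sub (f := fun z : ℂ => (1 - ‖z‖^2) * (X1 z + Y2 z))
    (g := fun z : ℂ => 2*α*(z.re * X z + z.im * Y z))
    (integrable_cont hα' (cs.mul (hX1.add hY2)))
    ((integrable_cont hα' ((cr.mul hX).add (ci.mul hY))).const_mul _), integral_const_mul]
  set I1 := ∫ z, (1 - ‖z‖^2) * (X1 z + Y2 z) ∂(bergmanMeasure (α+1))
  set I2 := ∫ z : ℂ, (z.re * X z + z.im * Y z) ∂(bergmanMeasure (α+1))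
  have ha : α ≠ 0 := by linarith
  have : (α + 1) / (α + 1 - 1) * I1 = (α+1) * (I1 / α) := by
    rw [add_sub_cancel_right]; ring
  rw [this] at h1
  have h2 : I1 / α = 2 * I2 := by
    have : (α+1) * (I1/α) = (α+1) * (2 * I2) := by linarith
    exact mul_left_cancel₀ (by linarith) this
  rw [div_eq_iff ha] at h2
  linarith

lemma quot_dx {M U : MvPolynomial (Fin 2) ℝ} {S : Set ℂ} (hU : ∀ z ∈ S, 0 < ev U z) :
    HasDx S (fun z => ev M z / (ev U z)^2)
      (fun z => (ev (d0 M) z * ev U z - 2 * ev M z * ev (d0 U) z) / (ev U z)^3) := by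
  intro z hz
  have hu := (hU z hz).ne'
  have h := (ev_dx M S z hz).div ((ev_dx U S z hz).pow 2) (by simpa using pow_ne_zero 2 hu)
  refine h.congr_deriv ?_
  simp only [Complex.eta]
  simp
  field_simp

lemma quot_dy {M U : MvPolynomial (Fin 2) ℝ} {S : Set ℂ} (hU : ∀ z ∈ S, 0 < ev U z) :
    HasDy S (fun z => ev M z / (ev U z)^2)
      (fun z => (ev (d1 M) z * ev U z - 2 * ev M z * ev (d1 U) z) / (ev U z)^3) := by
  intro z hz
  have hu := (hU z hz).ne'
  have h := (ev_dy M S z hz).div ((ev_dy U S z hz).pow 2) (by simpa using pow_ne_zero 2 hu)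
  refine h.congr_deriv ?_
  simp only [Complex.eta]
  simp
  field_simp

lemma ident_alg (x y σ b u a c A B D A1 A2 B2 D2 : ℝ) (hσ : σ = 1 - (x^2+y^2)) (hu : 0 < u) (hb : 0 < b + 1) :
    2*(a * (-(2*x)*(A+D) + σ*(A1+B2) - 2*b*(a + x*A + y*B))
      + c * (-(2*y)*(A+D) + σ*(A2+D2) - 2*b*(c + x*B + y*D)))/u
     - (a^2+c^2)*(σ*(A+D) - 2*b*(x*a+y*c))/u^2 + 4*b*((a^2+c^2)/u)
     + 1/(b+1) * σ * (u * ((b+2)*((A+D)/u-(a^2+c^2)/u^2)^2 + 3*((a^2+c^2)/u^2)*((A+D)/u-(a^2+c^2)/u^2)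
        + ((a^2+c^2)/u^2)^2 + b*(((A-D)/u-(a^2-c^2)/u^2)^2 + 4*(B/u-a*c/u^2)^2)))
     = 1/(b+1) * (σ * (
        (((2*(A+D)+2*b*A)*A + 2*b*B*B + (2*(A1+B2)+2*b*A1)*a + 2*b*A2*c)*u
          + ((2*(A+D)+2*b*A)*a+2*b*B*c)*a - b*((2*a*A+2*c*B)*a+(a^2+c^2)*A)) * u
          - 2*(((2*(A+D)+2*b*A)*a+2*b*B*c)*u - b*(a^2+c^2)*a)*a)/u^3
       + σ * (
        (((2*(A+D)+2*b*D)*D + 2*b*B*B + (2*(A2+D2)+2*b*D2)*c + 2*b*B2*a)*u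
          + ((2*(A+D)+2*b*D)*c+2*b*B*a)*c - b*((2*a*B+2*c*D)*c+(a^2+c^2)*D)) * u
          - 2*(((2*(A+D)+2*b*D)*c+2*b*B*a)*u - b*(a^2+c^2)*c)*c)/u^3
       - 2*(b+1)*(x*((((2*(A+D)+2*b*A)*a+2*b*B*c)*u - b*(a^2+c^2)*a)/u^2)
           + y*((((2*(A+D)+2*b*D)*c+2*b*B*a)*u - b*(a^2+c^2)*c)/u^2))) := by
  subst hσ
  field_simp
  ring

end HC
namespace HC
open Set Filter Topology

lemma d0_Lop (b U) (z : ℂ) : ev (d0 (Lop b U)) z = -(2*z.re)*(ev (d0 (d0 U)) z + ev (d1 (d1 U)) z)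
   + (1 - ‖z‖^2) * (ev (d0 (d0 (d0 U))) z + ev (d0 (d1 (d1 U))) z)
   - 2*b*(ev (d0 U) z + z.re * ev (d0 (d0 U)) z + z.im * ev (d0 (d1 U)) z) := by
  rw [Lop_apply, ← Complex.normSq_eq_norm_sq, Complex.normSq_apply]
  simp only [map_sub, map_add, Derivation.leibniz, Derivation.leibniz_pow, Derivation.map_smul, MvPolynomial.pderiv_X_self, smul_eq_mul,
    MvPolynomial.pderiv_X_of_ne (show (1:Fin 2) ≠ 0 by decide), ev_sub, ev_mul, ev_add, ev_smul, ev_one, ev_pow,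
    ev_X0, ev_X1, ev_zero, MvPolynomial.pderiv_one, nsmul_eq_mul, Nat.cast_ofNat, ev_two, pow_one, Nat.add_one_sub_one]
  ring

lemma d1_Lop (b U) (z : ℂ) : ev (d1 (Lop b U)) z = -(2*z.im)*(ev (d0 (d0 U)) z + ev (d1 (d1 U)) z)
   + (1 - ‖z‖^2) * (ev (d0 (d0 (d1 U))) z + ev (d1 (d1 (d1 U))) z)
   - 2*b*(ev (d1 U) z + z.re * ev (d0 (d1 U)) z + z.im * ev (d1 (d1 U)) z) := by
  have e1 : d1 (d0 U) = d0 (d1 U) := d_comm U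
  have e2 : d1 (d0 (d0 U)) = d0 (d0 (d1 U)) := by rw [d_comm, d_comm]
  simp only [d0, d1] at e1 e2
  rw [Lop_apply, ← Complex.normSq_eq_norm_sq, Complex.normSq_apply]
  simp only [map_sub, map_add, Derivation.leibniz, Derivation.leibniz_pow, Derivation.map_smul, MvPolynomial.pderiv_X_self, smul_eq_mul,
    MvPolynomial.pderiv_X_of_ne (show (0:Fin 2) ≠ 1 by decide), ev_sub, ev_mul, ev_add, ev_smul, ev_one, ev_pow,
    ev_X0, ev_X1, ev_zero, MvPolynomial.pderiv_one, nsmul_eq_mul, Nat.cast_ofNat, ev_two, pow_one, Nat.add_one_sub_one, e1, e2]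
  ring

lemma fisher_decay {α : ℝ} (hα : 5/4 ≤ α) {U : MvPolynomial (Fin 2) ℝ}
    (hU : ∀ z ∈ closedBall (0:ℂ) 1, 0 < ev U z) :
    ∫ z, (2*(ev (d0 U) z * ev (d0 (Lop (α-1) U)) z + ev (d1 U) z * ev (d1 (Lop (α-1) U)) z)/ev U z
      - ((ev (d0 U) z)^2 + (ev (d1 U) z)^2) * ev (Lop (α-1) U) z / (ev U z)^2) ∂(bergmanMeasure (α+1)) ≤
    - (4*(α-1)) * ∫ z, ((ev (d0 U) z)^2 + (ev (d1 U) z)^2)/ev U z ∂(bergmanMeasure (α+1)) := by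
  set b := α - 1 with hb
  have hα1 : 1 < α := by linarith
  have hα' : 1 < α + 1 := by linarith
  have e1 : d1 (d0 U) = d0 (d1 U) := d_comm U
  have e2 : d1 (d0 (d0 U)) = d0 (d0 (d1 U)) := by rw [d_comm, d_comm]
  have e3 : d1 (d0 (d1 U)) = d0 (d1 (d1 U)) := d_comm _
  let C := (MvPolynomial.C : ℝ → MvPolynomial (Fin 2) ℝ)
  let M1 := ((2*(d0 (d0 U) + d1 (d1 U)) + C (2*b) * d0 (d0 U)) * d0 U + C (2*b) * d0 (d1 U) * d1 U) * U
    - C b * (d0 U^2 + d1 U^2) * d0 U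
  let M2 := ((2*(d0 (d0 U) + d1 (d1 U)) + C (2*b) * d1 (d1 U)) * d1 U + C (2*b) * d0 (d1 U) * d0 U) * U
    - C b * (d0 U^2 + d1 U^2) * d1 U
  have cU := (continuous_ev U).continuousOn (s := closedBall (0:ℂ) 1)
  have cont : ∀ (P : MvPolynomial (Fin 2) ℝ) (n : ℕ), ContinuousOn (fun z => ev P z / (ev U z)^n) (closedBall (0:ℂ) 1) :=
    fun P n => (continuous_ev P).continuousOn.div (cU.pow n) (fun z hz => pow_ne_zero n (hU z hz).ne')
  have hUb : ∀ z ∈ ball (0:ℂ) 1, 0 < ev U z := fun z hz => hU z (ball_subset_closedBall hz)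
  have hz := zero_div hα1 (X := fun z => ev M1 z / (ev U z)^2) (Y := fun z => ev M2 z / (ev U z)^2)
    (cont M1 2) ((cont (d0 M1 * U - 2 * M1 * d0 U) 3).congr fun z _ => by simp)
    (cont M2 2) ((cont (d1 M2 * U - 2 * M2 * d1 U) 3).congr fun z _ => by simp)
    (quot_dx hUb) (quot_dy hUb)
  have cs : ContinuousOn (fun z : ℂ => 1 - ‖z‖^2) (closedBall (0:ℂ) 1) := Continuous.continuousOn (by fun_prop)
  have cr := Complex.continuous_re.continuousOn (s := closedBall (0:ℂ) 1)
  have ci := Complex.continuous_im.continuousOn (s := closedBall (0:ℂ) 1)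
  rw [← integral_const_mul]
  have key : ∀ z ∈ closedBall (0:ℂ) 1,
      (2*(ev (d0 U) z * ev (d0 (Lop b U)) z + ev (d1 U) z * ev (d1 (Lop b U)) z)/ev U z
      - ((ev (d0 U) z)^2 + (ev (d1 U) z)^2) * ev (Lop b U) z / (ev U z)^2) ≤
      - (4*b) * (((ev (d0 U) z)^2 + (ev (d1 U) z)^2)/ev U z) + 1/α *
       ((1 - ‖z‖^2) * ((ev (d0 M1) z * ev U z - 2 * ev M1 z * ev (d0 U) z) / (ev U z)^3 +
         (ev (d1 M2) z * ev U z - 2 * ev M2 z * ev (d1 U) z) / (ev U z)^3) -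
          2*α*(z.re * (ev M1 z / (ev U z)^2) + z.im * (ev M2 z / (ev U z)^2))) := by
    intro z hz
    have hu := hU z hz
    have hσ : 0 ≤ 1 - ‖z‖^2 := by
      have := mem_closedBall_zero_iff.1 hz
      nlinarith [norm_nonneg z]
    have hσ' : 1 - ‖z‖^2 = 1 - (z.re^2 + z.im^2) := by
      rw [← Complex.normSq_eq_norm_sq, Complex.normSq_apply]; ring
    have id := ident_alg z.re z.im (1 - ‖z‖^2) b (ev U z) (ev (d0 U) z) (ev (d1 U) z) (ev (d0 (d0 U)) z)
      (ev (d0 (d1 U)) z) (ev (d1 (d1 U)) z) (ev (d0 (d0 (d0 U))) z) (ev (d0 (d0 (d1 U))) z) (ev (d0 (d1 (d1 U))) z)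
      (ev (d1 (d1 (d1 U))) z) hσ' hu (by linarith)
    have hQ : ∀ p n r s : ℝ, 0 ≤ ((b+2)*p^2 + 3*n*p + n^2 + b*(r^2+4*s^2)) := by
      intro p n r s
      have : 0 ≤ b*(r^2+4*s^2) := mul_nonneg (by linarith) (by positivity)
      nlinarith [sq_nonneg (n + 3/2*p), mul_nonneg (show 0 ≤ b - 1/4 by linarith) (sq_nonneg p)]
    have hQ' := hQ ((ev (d0 (d0 U)) z+ev (d1 (d1 U)) z)/ev U z-((ev (d0 U) z)^2+(ev (d1 U) z)^2)/(ev U z)^2)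
      (((ev (d0 U) z)^2+(ev (d1 U) z)^2)/(ev U z)^2)
      ((ev (d0 (d0 U)) z-ev (d1 (d1 U)) z)/ev U z-((ev (d0 U) z)^2-(ev (d1 U) z)^2)/(ev U z)^2)
      (ev (d0 (d1 U)) z/ev U z-ev (d0 U) z*ev (d1 U) z/(ev U z)^2)
    have hQ2 := mul_nonneg (mul_nonneg (show 0 ≤ 1/(b+1) by rw [hb]; ring_nf; positivity) hσ) (mul_nonneg hu.le hQ')
    rw [d0_Lop, d1_Lop, Lop_ev]
    have f1 : ev M1 z = ((2*(ev (d0 (d0 U)) z+ev (d1 (d1 U)) z)+2*b*ev (d0 (d0 U)) z)*ev (d0 U) z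
        +2*b*ev (d0 (d1 U)) z*ev (d1 U) z)*ev U z - b*((ev (d0 U) z)^2+(ev (d1 U) z)^2)*ev (d0 U) z := by
      simp only [M1, C, ev_sub, ev_mul, ev_add, ev_C, ev_two, ev_pow]
    have f2 : ev M2 z = ((2*(ev (d0 (d0 U)) z+ev (d1 (d1 U)) z)+2*b*ev (d1 (d1 U)) z)*ev (d1 U) z
        +2*b*ev (d0 (d1 U)) z*ev (d0 U) z)*ev U z - b*((ev (d0 U) z)^2+(ev (d1 U) z)^2)*ev (d1 U) z := by
      simp only [M2, C, ev_sub, ev_mul, ev_add, ev_C, ev_two, ev_pow]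
    have two' : (2 : MvPolynomial (Fin 2) ℝ) = MvPolynomial.C 2 := (map_ofNat MvPolynomial.C 2).symm
    simp only [d0, d1] at e1 e2 e3 id f1 f2 hQ2 ⊢
    have g1 : ev (MvPolynomial.pderiv 0 M1) z = ((2*(ev (MvPolynomial.pderiv 0 (MvPolynomial.pderiv 0 U)) z+ev (MvPolynomial.pderiv 1 (MvPolynomial.pderiv 1 U)) z)+2*b*ev (MvPolynomial.pderiv 0 (MvPolynomial.pderiv 0 U)) z)*ev (MvPolynomial.pderiv 0 (MvPolynomial.pderiv 0 U)) z + 2*b*ev (MvPolynomial.pderiv 0 (MvPolynomial.pderiv 1 U)) z*ev (MvPolynomial.pderiv 0 (MvPolynomial.pderiv 1 U)) z + (2*(ev (MvPolynomial.pderiv 0 (MvPolynomial.pderiv 0 (MvPolynomial.pderiv 0 U))) z+ev (MvPolynomial.pderiv 0 (MvPolynomial.pderiv 1 (MvPolynomial.pderiv 1 U))) z)+2*b*ev (MvPolynomial.pderiv 0 (MvPolynomial.pderiv 0 (MvPolynomial.pderiv 0 U))) z)*ev (MvPolynomial.pderiv 0 U) z + 2*b*ev (MvPolynomial.pderiv 0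 (MvPolynomial.pderiv 0 (MvPolynomial.pderiv 1 U))) z*ev (MvPolynomial.pderiv 1 U) z)*ev U z
          + ((2*(ev (MvPolynomial.pderiv 0 (MvPolynomial.pderiv 0 U)) z+ev (MvPolynomial.pderiv 1 (MvPolynomial.pderiv 1 U)) z)+2*b*ev (MvPolynomial.pderiv 0 (MvPolynomial.pderiv 0 U)) z)*ev (MvPolynomial.pderiv 0 U) z+2*b*ev (MvPolynomial.pderiv 0 (MvPolynomial.pderiv 1 U)) z*ev (MvPolynomial.pderiv 1 U) z)*ev (MvPolynomial.pderiv 0 U) z - b*((2*ev (MvPolynomial.pderiv 0 U) z*ev (MvPolynomial.pderiv 0 (MvPolynomial.pderiv 0 U)) z+2*ev (MvPolynomial.pderiv 1 U) z*ev (MvPolynomial.pderiv 0 (MvPolynomial.pderiv 1 U)) z)*ev (MvPolynomial.pderiv 0 U) z+(ev (MvPolynomial.pderiv 0 U) z^2+ev (MvPolynomial.pderiv 1 U) z^2)*ev (MvPolynomial.pderiv 0 (MvPolynomial.pderiv 0 U)) z) := by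
      simp only [M1, C, two', Derivation.leibniz, Derivation.leibniz_pow, map_sub, map_add, MvPolynomial.pderiv_C,
        smul_eq_mul, ev_sub, ev_mul, ev_add, ev_C, ev_zero, nsmul_eq_mul, Nat.cast_ofNat, ev_two, pow_one, Nat.add_one_sub_one,
        ev_pow, e1, e2, e3]
      ring
    have g2 : ev (MvPolynomial.pderiv 1 M2) z = ((2*(ev (MvPolynomial.pderiv 0 (MvPolynomial.pderiv 0 U)) z+ev (MvPolynomial.pderiv 1 (MvPolynomial.pderiv 1 U)) z)+2*b*ev (MvPolynomial.pderiv 1 (MvPolynomial.pderiv 1 U)) z)*ev (MvPolynomial.pderiv 1 (MvPolynomial.pderiv 1 U)) z + 2*b*ev (MvPolynomial.pderiv 0 (MvPolynomial.pderiv 1 U)) z*ev (MvPolynomial.pderiv 0 (MvPolynomial.pderiv 1 U)) z + (2*(ev (MvPolynomial.pderiv 0 (MvPolynomial.pderiv 0 (MvPolynomial.pderiv 1 U))) z+ev (MvPolynomial.pderiv 1 (MvPolynomial.pderiv 1 (MvPolynomial.pderiv 1 U))) z)+2*b*ev (MvPolynomial.pderiv 1 (MvPolynomial.pderiv 1 (MvPolynomial.pderiv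 1 U))) z)*ev (MvPolynomial.pderiv 1 U) z + 2*b*ev (MvPolynomial.pderiv 0 (MvPolynomial.pderiv 1 (MvPolynomial.pderiv 1 U))) z*ev (MvPolynomial.pderiv 0 U) z)*ev U z
          + ((2*(ev (MvPolynomial.pderiv 0 (MvPolynomial.pderiv 0 U)) z+ev (MvPolynomial.pderiv 1 (MvPolynomial.pderiv 1 U)) z)+2*b*ev (MvPolynomial.pderiv 1 (MvPolynomial.pderiv 1 U)) z)*ev (MvPolynomial.pderiv 1 U) z+2*b*ev (MvPolynomial.pderiv 0 (MvPolynomial.pderiv 1 U)) z*ev (MvPolynomial.pderiv 0 U) z)*ev (MvPolynomial.pderiv 1 U) z - b*((2*ev (MvPolynomial.pderiv 0 U) z*ev (MvPolynomial.pderiv 0 (MvPolynomial.pderiv 1 U)) z+2*ev (MvPolynomial.pderiv 1 U) z*ev (MvPolynomial.pderiv 1 (MvPolynomial.pderiv 1 U)) z)*ev (MvPolynomial.pderiv 1 U) z+(ev (MvPolynomial.pderiv 0 U) z^2+ev (MvPolynomial.pderiv 1 U) z^2)*ev (MvPolynomial.pderiv 1 (MvPolynomial.pderiv 1 U)) z)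 := by
      simp only [M2, C, two', Derivation.leibniz, Derivation.leibniz_pow, map_sub, map_add, MvPolynomial.pderiv_C,
        smul_eq_mul, ev_sub, ev_mul, ev_add, ev_C, ev_zero, nsmul_eq_mul, Nat.cast_ofNat, ev_two, pow_one, Nat.add_one_sub_one,
        ev_pow, e1, e2, e3]
      ring
    rw [g1, g2, f1, f2, show α = b + 1 by rw [hb]; ring]
    refine (le_of_eq ?_ : _ ≤ _ ).trans (add_le_of_nonpos_right (neg_nonpos.2 hQ2))
    linear_combination id
  have iz : Integrable (fun z : ℂ => (1 - ‖z‖^2) * ((ev (d0 M1) z * ev U z - 2 * ev M1 z * ev (d0 U) z) / (ev U z)^3 +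
         (ev (d1 M2) z * ev U z - 2 * ev M2 z * ev (d1 U) z) / (ev U z)^3) -
          2*α*(z.re * (ev M1 z / (ev U z)^2) + z.im * (ev M2 z / (ev U z)^2))) (bergmanMeasure (α+1)) := by
    refine integrable_cont hα' ?_
    exact ((cs.mul (((cont (d0 M1 * U - 2 * M1 * d0 U) 3)).add
      (cont (d1 M2 * U - 2 * M2 * d1 U) 3))).sub (continuousOn_const.mul
      ((cr.mul (cont M1 2)).add (ci.mul (cont M2 2))) (f := fun _ => 2*α))).congr fun z _ => by simp
  have ig : Integrable (fun z => -(4*b) * (((ev (d0 U) z)^2 + (ev (d1 U) z)^2)/ev U z)) (bergmanMeasure (α+1)) := by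
    refine (integrable_cont hα' ?_).const_mul _
    exact (cont (d0 U^2 + d1 U^2) 1).congr fun z _ => by simp
  have il : Integrable (fun z => (2*(ev (d0 U) z * ev (d0 (Lop b U)) z + ev (d1 U) z * ev (d1 (Lop b U)) z)/ev U z
      - ((ev (d0 U) z)^2 + (ev (d1 U) z)^2) * ev (Lop b U) z / (ev U z)^2)) (bergmanMeasure (α+1)) := by
    refine integrable_cont hα' ?_
    exact ((cont (2 * (d0 U * d0 (Lop b U) + d1 U * d1 (Lop b U))) 1).sub
      (cont ((d0 U^2 + d1 U^2) * Lop b U) 2)).congr fun z _ => by simp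
  have := integral_mono_ae il (ig.add (iz.const_mul (1/α))) (by
    filter_upwards [berg_ae_ball (α+1)] with z hz
    exact key z (ball_subset_closedBall hz))
  rw [integral_add' ig (iz.const_mul (1/α)), integral_const_mul (1/α)] at this
  rw [hz, mul_zero, add_zero] at this
  exact this

end HC
namespace HC
open Set Filter Topology

lemma parts {α : ℝ} (hα : 1 < α) (U : MvPolynomial (Fin 2) ℝ) {φ φ1 φ2 : ℂ → ℝ}
    (hφ : ContinuousOn φ (closedBall (0:ℂ) 1)) (hφ1 : ContinuousOn φ1 (closedBall (0:ℂ) 1))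
    (hφ2 : ContinuousOn φ2 (closedBall (0:ℂ) 1))
    (hdx : HasDx (ball (0:ℂ) 1) φ φ1) (hdy : HasDy (ball (0:ℂ) 1) φ φ2) :
    ∫ z, φ z * ev (Lop (α-1) U) z ∂(bergmanMeasure α) =
      -((α-1)/α) * ∫ z, (φ1 z * ev (d0 U) z + φ2 z * ev (d1 U) z) ∂(bergmanMeasure (α+1)) := by
  have hα' : 1 < α + 1 := by linarith
  have cP : ∀ P, ContinuousOn (ev P) (closedBall (0:ℂ) 1) := fun P => (continuous_ev P).continuousOn
  have cr := Complex.continuous_re.continuousOn (s := closedBall (0:ℂ) 1)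
  have ci := Complex.continuous_im.continuousOn (s := closedBall (0:ℂ) 1)
  have cs : ContinuousOn (fun z : ℂ => 1 - ‖z‖^2) (closedBall (0:ℂ) 1) := Continuous.continuousOn (by fun_prop)
  have h1 := div_thm hα (hφ.mul (cP (d0 U))) ((hφ1.mul (cP (d0 U))).add (hφ.mul (cP (d0 (d0 U)))))
    (hφ.mul (cP (d1 U))) ((hφ2.mul (cP (d1 U))).add (hφ.mul (cP (d1 (d1 U)))))
    (fun z hz => ((hdx z hz).mul (ev_dx (d0 U) _ z hz)))
    (fun z hz => ((hdy z hz).mul (ev_dy (d1 U) _ z hz)))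
  have h2 := integral_succ hα (fun z => φ z * (ev (d0 (d0 U)) z + ev (d1 (d1 U)) z))
  have e1 : ∫ z, (φ1 z * ev (d0 U) z + φ z * ev (d0 (d0 U)) z + (φ2 z * ev (d1 U) z + φ z * ev (d1 (d1 U)) z))
      ∂(bergmanMeasure (α+1)) = ∫ z, (φ1 z * ev (d0 U) z + φ2 z * ev (d1 U) z) ∂(bergmanMeasure (α+1))
        + ∫ z, φ z * (ev (d0 (d0 U)) z + ev (d1 (d1 U)) z) ∂(bergmanMeasure (α+1)) := by
    rw [← integral_add]
    · congr 1; ext z; ring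
    · exact integrable_cont hα' ((hφ1.mul (cP (d0 U))).add (hφ2.mul (cP (d1 U))))
    · exact integrable_cont hα' (hφ.mul ((cP (d0 (d0 U))).add (cP (d1 (d1 U)))))
  have e2 : ∫ z, φ z * ev (Lop (α-1) U) z ∂(bergmanMeasure α) =
      ∫ z, (1-‖z‖^2) * (φ z * (ev (d0 (d0 U)) z + ev (d1 (d1 U)) z)) ∂(bergmanMeasure α)
      - 2*(α-1) * ∫ z, (z.re * (φ z * ev (d0 U) z) + z.im * (φ z * ev (d1 U) z)) ∂(bergmanMeasure α) := by
    rw [← integral_const_mul, ← integral_sub]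
    · congr 1; ext z; rw [Lop_ev]; ring
    · exact integrable_cont hα (cs.mul (hφ.mul ((cP (d0 (d0 U))).add (cP (d1 (d1 U))))))
    · exact (integrable_cont hα ((cr.mul (hφ.mul (cP (d0 U)))).add (ci.mul (hφ.mul (cP (d1 U)))))).const_mul _
  change ∫ z, (φ1 z * ev (d0 U) z + φ z * ev (d0 (d0 U)) z + (φ2 z * ev (d1 U) z + φ z * ev (d1 (d1 U)) z))
      ∂(bergmanMeasure (α+1)) = 2*α * ∫ z, (z.re * (φ z * ev (d0 U) z) + z.im * (φ z * ev (d1 U) z)) ∂(bergmanMeasure α) at h1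
  rw [e1] at h1
  rw [e2]
  generalize ∫ z, (z.re * (φ z * ev (d0 U) z) + z.im * (φ z * ev (d1 U) z)) ∂(bergmanMeasure α) = a1 at *
  generalize ∫ z, (1-‖z‖^2) * (φ z * (ev (d0 (d0 U)) z + ev (d1 (d1 U)) z)) ∂(bergmanMeasure α) = a2 at *
  generalize ∫ z, φ z * (ev (d0 (d0 U)) z + ev (d1 (d1 U)) z) ∂(bergmanMeasure (α+1)) = a3 at *
  generalize ∫ z, (φ1 z * ev (d0 U) z + φ2 z * ev (d1 U) z) ∂(bergmanMeasure (α+1)) = a4 at *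
  have hα0 : α ≠ 0 := by linarith
  have hb : α - 1 ≠ 0 := by linarith
  subst h2
  field_simp at h1 ⊢
  linear_combination h1

set_option maxHeartbeats 3200000 in
theorem lsi_poly {α : ℝ} (hα : 5/4 ≤ α) {U0 : MvPolynomial (Fin 2) ℝ} 
    (hU0 : ∀ z ∈ closedBall (0:ℂ) 1, 0 < ev U0 z) :
    ∫ z, ev U0 z * Real.log (ev U0 z) ∂(bergmanMeasure α) -
      (∫ z, ev U0 z ∂(bergmanMeasure α)) * Real.log (∫ z, ev U0 z ∂(bergmanMeasure α)) ≤
     1/(4*α) * ∫ z, ((ev (d0 U0) z)^2 + (ev (d1 U0) z)^2) / ev U0 z ∂(bergmanMeasure (α+1)) := by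
  have hα1 : 1 < α := by linarith
  have hα' : 1 < α + 1 := by linarith
  have hpr := berg_prob hα1
  have hb : 0 < α - 1 := by linarith
  obtain ⟨z0, hz0, hmin⟩ := (isCompact_closedBall (0:ℂ) 1).exists_isMinOn ⟨0, by simp⟩ (continuous_ev U0).continuousOn
  obtain ⟨U, hU00, hU, C, hC0, hC⟩ := exists_flow' hα1 U0
  set ε := ev U0 z0 with hε
  have hεp : 0 < ε := hU0 z0 hz0
  have hpos : ∀ t, 0 ≤ t → ∀ z ∈ closedBall (0:ℂ) 1, ε ≤ ev (U t) z := fun t ht =>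
    flow_pos hb.le hU (by rw [hU00]; exact fun z hz => hmin hz) ht
  have hpos' : ∀ t, 0 ≤ t → ∀ z ∈ closedBall (0:ℂ) 1, 0 < ev (U t) z := fun t ht z hz => hεp.trans_le (hpos t ht z hz)
  let D0 : MvPolynomial (Fin 2) ℝ →ₗ[ℝ] MvPolynomial (Fin 2) ℝ := (MvPolynomial.pderiv (0 : Fin 2)).toLinearMap
  let D1 : MvPolynomial (Fin 2) ℝ →ₗ[ℝ] MvPolynomial (Fin 2) ℝ := (MvPolynomial.pderiv (1 : Fin 2)).toLinearMap
  have cu : Continuous fun q : ℝ × ℂ => ev (U q.1) q.2 := hU.cont LinearMap.id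
  have cL : Continuous fun q : ℝ × ℂ => ev (Lop (α-1) (U q.1)) q.2 := hU.cont (Lop (α-1))
  have c0 : Continuous fun q : ℝ × ℂ => ev (d0 (U q.1)) q.2 := hU.cont D0
  have c1 : Continuous fun q : ℝ × ℂ => ev (d1 (U q.1)) q.2 := hU.cont D1
  have c0L : Continuous fun q : ℝ × ℂ => ev (d0 (Lop (α-1) (U q.1))) q.2 := by
    have := hU.cont (D0 ∘ₗ Lop (α-1))
    simp only [LinearMap.comp_apply] at this
    exact this
  have c1L : Continuous fun q : ℝ × ℂ => ev (d1 (Lop (α-1) (U q.1))) q.2 := by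
    have := hU.cont (D1 ∘ₗ Lop (α-1))
    simp only [LinearMap.comp_apply] at this
    exact this
  have du : ∀ z t, HasDerivAt (fun t => ev (U t) z) (ev (Lop (α-1) (U t)) z) t := hU.deriv LinearMap.id
  have dd0 : ∀ z t, HasDerivAt (fun t => ev (d0 (U t)) z) (ev (d0 (Lop (α-1) (U t))) z) t := hU.deriv D0
  have dd1 : ∀ z t, HasDerivAt (fun t => ev (d1 (U t)) z) (ev (d1 (Lop (α-1) (U t))) z) t := hU.deriv D1
  have hne : ∀ T : ℝ, ∀ q ∈ Icc 0 T ×ˢ closedBall (0:ℂ) 1, ev (U q.1) q.2 ≠ 0 := fun T q hq => (hpos' q.1 hq.1.1 q.2 hq.2).ne'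
  -- continuity of pieces
  have cE : ∀ T, ContinuousOn (fun q : ℝ × ℂ => ev (U q.1) q.2 * Real.log (ev (U q.1) q.2)) (Icc 0 T ×ˢ closedBall (0:ℂ) 1) :=
    fun T => cu.continuousOn.mul (cu.continuousOn.log (hne T))
  have cE' : ∀ T, ContinuousOn (fun q : ℝ × ℂ => (Real.log (ev (U q.1) q.2) + 1) * ev (Lop (α-1) (U q.1)) q.2) (Icc 0 T ×ˢ closedBall (0:ℂ) 1) :=
    fun T => ((cu.continuousOn.log (hne T)).add continuousOn_const).mul cL.continuousOn
  have cJ : ∀ T, ContinuousOn (fun q : ℝ × ℂ => ((ev (d0 (U q.1)) q.2)^2 + (ev (d1 (U q.1)) q.2)^2) / ev (U q.1) q.2) (Icc 0 T ×ˢ closedBall (0:ℂ) 1) :=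
    fun T => ((c0.pow 2).add (c1.pow 2)).continuousOn.div cu.continuousOn (hne T)
  have cJ' : ∀ T, ContinuousOn (fun q : ℝ × ℂ => (2*(ev (d0 (U q.1)) q.2 * ev (d0 (Lop (α-1) (U q.1))) q.2 + ev (d1 (U q.1)) q.2 * ev (d1 (Lop (α-1) (U q.1))) q.2)/ev (U q.1) q.2
      - ((ev (d0 (U q.1)) q.2)^2 + (ev (d1 (U q.1)) q.2)^2) * ev (Lop (α-1) (U q.1)) q.2 / (ev (U q.1) q.2)^2)) (Icc 0 T ×ˢ closedBall (0:ℂ) 1) :=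
    fun T => ((continuous_const.mul ((c0.mul c0L).add (c1.mul c1L))).continuousOn.div cu.continuousOn (hne T)).sub
      ((((c0.pow 2).add (c1.pow 2)).mul cL).continuousOn.div (cu.pow 2).continuousOn (fun q hq => pow_ne_zero 2 (hne T q hq)))
  have slice : ∀ {H : ℝ × ℂ → ℝ}, (∀ T, ContinuousOn H (Icc 0 T ×ˢ closedBall (0:ℂ) 1)) → ∀ t, 0 ≤ t →
      ContinuousOn (fun z => H (t, z)) (closedBall (0:ℂ) 1) := fun hH t ht =>
    (hH t).comp (Continuous.continuousOn (by fun_prop : Continuous fun z : ℂ => (t, z))) (fun z hz => ⟨⟨ht, le_rfl⟩, hz⟩)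
  -- integrals
  let E : ℝ → ℝ := fun t => ∫ z, ev (U t) z * Real.log (ev (U t) z) ∂(bergmanMeasure α)
  let J : ℝ → ℝ := fun t => ∫ z, ((ev (d0 (U t)) z)^2 + (ev (d1 (U t)) z)^2) / ev (U t) z ∂(bergmanMeasure (α+1))
  let M : ℝ → ℝ := fun t => ∫ z, ev (U t) z ∂(bergmanMeasure α)
  let G : ℝ → ℝ := fun t => ∫ z, (ev (U t) z)^2 ∂(bergmanMeasure α)
  let K : ℝ → ℝ := fun t => ∫ z, ((ev (d0 (U t)) z)^2 + (ev (d1 (U t)) z)^2) ∂(bergmanMeasure (α+1))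
  have dE : ∀ t, 0 < t → HasDerivAt E (-((α-1)/α) * J t) t := by
    intro t ht
    have h1 := hasDerivAt_int hα1 (F := fun t z => ev (U t) z * Real.log (ev (U t) z))
      (F' := fun t z => (Real.log (ev (U t) z) + 1) * ev (Lop (α-1) (U t)) z) (a := 0) (b := t + 1) ⟨ht, by linarith⟩
      (fun t ht => slice cE t ht.1) (cE' _) (fun t ht z hz => by
        have hu := hpos' t ht.1.le z (ball_subset_closedBall hz)
        refine ((du z t).fun_mul ((du z t).log hu.ne')).congr_deriv ?_
        field_simp)
    refine h1.congr_deriv ?_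
    have hp := hpos' t ht.le
    have cU : ContinuousOn (ev (U t)) (closedBall (0:ℂ) 1) := (continuous_ev (U t)).continuousOn
    rw [parts hα1 (U t) (φ1 := fun z => ev (d0 (U t)) z / ev (U t) z) (φ2 := fun z => ev (d1 (U t)) z / ev (U t) z)]
    · congr 1
      refine integral_congr_ae (ae_of_all _ fun z => ?_)
      simp only; ring
    · exact (cU.log fun z hz => (hp z hz).ne').add continuousOn_const
    · exact (continuous_ev _).continuousOn.div cU fun z hz => (hp z hz).ne'
    · exact (continuous_ev _).continuousOn.div cU fun z hz => (hp z hz).ne'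
    · intro z hz
      exact ((ev_dx (U t) _ z hz).log (hp z (ball_subset_closedBall hz)).ne').add_const 1
    · intro z hz
      exact ((ev_dy (U t) _ z hz).log (hp z (ball_subset_closedBall hz)).ne').add_const 1
  have dJ : ∀ t, 0 < t → ∃ d, HasDerivAt J d t ∧ d ≤ -(4*(α-1)) * J t := by
    intro t ht
    have h1 := hasDerivAt_int hα' (F := fun t z => ((ev (d0 (U t)) z)^2 + (ev (d1 (U t)) z)^2) / ev (U t) z)
      (F' := fun t z => (2*(ev (d0 (U t)) z * ev (d0 (Lop (α-1) (U t))) z + ev (d1 (U t)) z * ev (d1 (Lop (α-1) (U t))) z)/ev (U t) z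
      - ((ev (d0 (U t)) z)^2 + (ev (d1 (U t)) z)^2) * ev (Lop (α-1) (U t)) z / (ev (U t) z)^2))
       (a := 0) (b := t + 1) (t := t) ⟨ht, by linarith⟩ (fun t ht => slice cJ t ht.1) (cJ' _) (fun t ht z hz => by
        have hu := hpos' t ht.1.le z (ball_subset_closedBall hz)
        have h3 := (((dd0 z t).fun_pow 2).fun_add ((dd1 z t).fun_pow 2)).fun_div (du z t) hu.ne'
        clear_value D0 D1
        refine h3.congr_deriv ?_
        generalize ev (d0 (U t)) z = a1 at *
        generalize ev (d1 (U t)) z = a2 at *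
        generalize ev (d0 (Lop (α-1) (U t))) z = a3 at *
        generalize ev (d1 (Lop (α-1) (U t))) z = a4 at *
        generalize ev (Lop (α-1) (U t)) z = a5 at *
        generalize ev (U t) z = a6 at *
        simp
        field_simp)
    exact ⟨_, h1, fisher_decay hα (hpos' t ht.le)⟩
  have dM : ∀ t, 0 < t → HasDerivAt M 0 t := by
    intro t ht
    have h1 := hasDerivAt_int hα1 (F := fun t z => ev (U t) z)
      (F' := fun t z => ev (Lop (α-1) (U t)) z) (a := 0) (b := t + 1) ⟨ht, by linarith⟩
      (fun t ht => (continuous_ev _).continuousOn) cL.continuousOn (fun t ht z hz => du z t)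
    refine h1.congr_deriv ?_
    have := parts hα1 (U t) (φ := fun _ => 1) (φ1 := fun _ => 0) (φ2 := fun _ => 0) continuousOn_const continuousOn_const
      continuousOn_const (fun z _ => hasDerivAt_const _ _) (fun z _ => hasDerivAt_const _ _)
    simpa using this
  have dG : ∀ t, 0 < t → HasDerivAt G (-((α-1)/α) * (2 * K t)) t := by
    intro t ht
    have h1 := hasDerivAt_int hα1 (F := fun t z => (ev (U t) z)^2)
      (F' := fun t z => (2 * ev (U t) z) * ev (Lop (α-1) (U t)) z) (a := 0) (b := t + 1) ⟨ht, by linarith⟩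
      (fun t ht => ((continuous_ev _).pow 2).continuousOn) ((continuous_const.mul cu).mul cL).continuousOn (fun t ht z hz => by
        refine ((du z t).fun_pow 2).congr_deriv ?_
        simp)
    refine h1.congr_deriv ?_
    rw [parts hα1 (U t) (φ1 := fun z => 2 * ev (d0 (U t)) z) (φ2 := fun z => 2 * ev (d1 (U t)) z) (Continuous.continuousOn (by fun_prop))
      (Continuous.continuousOn (by fun_prop)) (Continuous.continuousOn (by fun_prop)) (fun z hz => (ev_dx (U t) _ z hz).const_mul 2) (fun z hz => (ev_dy (U t) _ z hz).const_mul 2)]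
    congr 1
    rw [← integral_const_mul]
    refine integral_congr_ae (ae_of_all _ fun z => ?_)
    simp only; ring
  have cME : ∀ T, ContinuousOn M (Icc 0 T) := fun T => continuousOn_int hα1 cu.continuousOn
  have cGE : ∀ T, ContinuousOn G (Icc 0 T) := fun T => continuousOn_int hα1 (F := fun t z => (ev (U t) z)^2) (cu.pow 2).continuousOn
  have cEE : ∀ T, ContinuousOn E (Icc 0 T) := fun T => continuousOn_int hα1 (cE T)
  have cJE : ∀ T, ContinuousOn J (Icc 0 T) := fun T => continuousOn_int hα' (F := fun t z => ((ev (d0 (U t)) z)^2 + (ev (d1 (U t)) z)^2) / ev (U t) z) (cJ T)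
  have hJ0 : ∀ t, 0 ≤ t → 0 ≤ J t := fun t ht => integral_nonneg_of_ae (by
    filter_upwards [berg_ae_ball (α+1)] with z hz
    have := hpos' t ht z (ball_subset_closedBall hz)
    exact div_nonneg (add_nonneg (sq_nonneg _) (sq_nonneg _)) this.le)
  have hG0 : ∀ T, 0 ≤ G T := fun T => integral_nonneg fun z => sq_nonneg _
  have hK0 : ∀ T, 0 ≤ K T := fun T => integral_nonneg fun z => add_nonneg (sq_nonneg _) (sq_nonneg _)
  have hC' : ∀ t, G t - (M t)^2 ≤ C * K t := hC
  have fE : E 0 = ∫ z, ev U0 z * Real.log (ev U0 z) ∂(bergmanMeasure α) := by simp only [E, hU00]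
  have fM : M 0 = ∫ z, ev U0 z ∂(bergmanMeasure α) := by simp only [M, hU00]
  have fJ : J 0 = ∫ z, ((ev (d0 U0) z)^2 + (ev (d1 U0) z)^2) / ev U0 z ∂(bergmanMeasure (α+1)) := by simp only [J, hU00]
  have step2' : ∀ T, 0 ≤ T → ∀ m > 0, E T ≤ (Real.log m - 1) * M T + 1/m * G T := by
    intro T hT m hmp
    have i1 : Integrable (fun z => ev (U T) z) (bergmanMeasure α) := integrable_cont hα1 (continuous_ev _).continuousOn
    have i2 : Integrable (fun z => (ev (U T) z)^2) (bergmanMeasure α) := integrable_cont hα1 ((continuous_ev _).pow 2).continuousOn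
    have : E T ≤ ∫ z, ((Real.log m - 1) * ev (U T) z + 1/m * (ev (U T) z)^2) ∂(bergmanMeasure α) := by
      refine integral_mono_ae (integrable_cont hα1 (slice cE T hT)) ((i1.const_mul _).add (i2.const_mul _)) ?_
      filter_upwards [berg_ae_ball α] with z hz
      have hu := hpos' T hT z (ball_subset_closedBall hz)
      have h1 := Real.log_le_sub_one_of_pos (div_pos hu hmp)
      rw [Real.log_div hu.ne' hmp.ne'] at h1
      have h2 := mul_le_mul_of_nonneg_left h1 hu.le
      have : ev (U T) z * (ev (U T) z / m - 1) = 1/m * (ev (U T) z)^2 - ev (U T) z := by ring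
      linarith
    rw [integral_add (i1.const_mul _) (i2.const_mul _), integral_const_mul, integral_const_mul] at this
    exact this
  have hmp0 : 0 < M 0 := by
    have : ∫ z, ε ∂(bergmanMeasure α) ≤ M 0 := by
      refine integral_mono_ae (integrable_const _) (integrable_cont hα1 (continuous_ev _).continuousOn) ?_
      filter_upwards [berg_ae_ball α] with z hz
      exact hpos 0 le_rfl z (ball_subset_closedBall hz)
    simp at this
    linarith
  clear_value E J M G K
  clear cE cE' cJ cJ' hpos hpos' slice dd0 dd1 du c0 c1 c0L c1L cu cL hne hC
  have hM : ∀ T, 0 ≤ T → M T = M 0 := by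
    intro T hT
    have hd : ∀ t ∈ interior (Icc 0 T), HasDerivAt M 0 t := fun t ht => by
      rw [interior_Icc] at ht
      exact dM t ht.1
    have h1 := monotoneOn_of_deriv_nonneg (convex_Icc 0 T) (cME T)
      (fun t ht => (hd t ht).differentiableAt.differentiableWithinAt) (fun t ht => (hd t ht).deriv.ge)
    have h2 := antitoneOn_of_deriv_nonpos (convex_Icc 0 T) (cME T)
      (fun t ht => (hd t ht).differentiableAt.differentiableWithinAt) (fun t ht => (hd t ht).deriv.le)
    exact le_antisymm (h2 (left_mem_Icc.2 hT) (right_mem_Icc.2 hT) hT) (h1 (left_mem_Icc.2 hT) (right_mem_Icc.2 hT) hT)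
  set m := M 0 with hm
  have hmp : 0 < m := hmp0
  -- monotonicity
  have step1 : ∀ T, 0 ≤ T → E 0 - 1/(4*α) * J 0 ≤ E T := by
    intro T hT
    have hmono : MonotoneOn (fun t => E t - 1/(4*α) * J t) (Icc 0 T) := by
      refine monotoneOn_of_deriv_nonneg (convex_Icc 0 T) ((cEE T).sub (continuousOn_const.mul (cJE T))) ?_ ?_
      · intro t ht
        rw [interior_Icc] at ht
        obtain ⟨d, hd, _⟩ := dJ t ht.1
        exact ((dE t ht.1).sub (hd.const_mul _)).differentiableAt.differentiableWithinAt
      · intro t ht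
        rw [interior_Icc] at ht
        obtain ⟨d, hd, hd2⟩ := dJ t ht.1
        rw [((dE t ht.1).fun_sub (hd.const_mul _)).deriv]
        have : 1/(4*α) * d ≤ 1/(4*α) * (-(4*(α-1)) * J t) := mul_le_mul_of_nonneg_left hd2 (by positivity)
        have e : 1/(4*α) * (-(4*(α-1)) * J t) = -((α-1)/α) * J t := by field_simp
        linarith
    have := hmono (left_mem_Icc.2 hT) (right_mem_Icc.2 hT) hT
    simp only at this
    have h2 : 0 ≤ 1/(4*α) * J T := mul_nonneg (by positivity) (hJ0 T hT)
    linarith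
  have step2 : ∀ T, 0 ≤ T → E T ≤ m * Real.log m + (G T - m^2) / m := by
    intro T hT
    have := step2' T hT m hmp
    rw [hM T hT] at this
    refine this.trans (le_of_eq ?_)
    field_simp
    ring
  have step3 : ∀ η > 0, ∃ T, 0 ≤ T ∧ G T - m^2 ≤ η := by
    intro η hη
    by_contra hc
    push Not at hc
    set κ := η / (C + 1) with hκ
    have hκp : 0 < κ := by positivity
    have hK : ∀ t, 0 ≤ t → κ ≤ K t := by
      intro t ht
      have h1 := hc t ht
      have h2 := hC' t
      rw [hM t ht] at h2
      have hK0 := hK0 t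
      rw [hκ, div_le_iff₀ (by positivity)]
      nlinarith
    set lam := (α-1)/α * (2 * κ) with hlam
    have hlp : 0 < lam := by positivity
    have hbd : ∀ T, 0 ≤ T → G T + lam * T ≤ G 0 := by
      intro T hT
      have hanti : AntitoneOn (fun t => G t + lam * t) (Icc 0 T) := by
        refine antitoneOn_of_deriv_nonpos (convex_Icc 0 T) ((cGE T).add (Continuous.continuousOn (by fun_prop))) ?_ ?_
        · intro t ht
          rw [interior_Icc] at ht
          exact ((dG t ht.1).add ((hasDerivAt_id t).const_mul lam)).differentiableAt.differentiableWithinAt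
        · intro t ht
          rw [interior_Icc] at ht
          have hd : HasDerivAt (fun t => G t + lam * t) (-((α-1)/α) * (2 * K t) + lam * 1) t :=
            (dG t ht.1).fun_add ((hasDerivAt_id t).const_mul lam)
          rw [hd.deriv]
          have := mul_le_mul_of_nonneg_left (hK t ht.1.le) (show 0 ≤ (α-1)/α * 2 by positivity)
          rw [hlam]; linarith
      have := hanti (left_mem_Icc.2 hT) (right_mem_Icc.2 hT) hT
      simpa using this
    have h1 := hbd ((G 0 + 1)/lam) (div_nonneg (by linarith [hG0 0]) hlp.le)
    rw [mul_div_cancel₀ _ hlp.ne'] at h1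
    linarith [hG0 ((G 0 + 1)/lam)]
  have fin : E 0 - 1/(4*α) * J 0 ≤ m * Real.log m := by
    refine le_of_forall_pos_le_add fun η hη => ?_
    obtain ⟨T, hT, hG⟩ := step3 (η * m) (by positivity)
    have h1 := step1 T hT
    have h2 := step2 T hT
    have : (G T - m^2)/m ≤ η := by rwa [div_le_iff₀ hmp]
    linarith
  rw [← fE, ← fJ, ← fM]
  linarith

end HC
namespace HC
open Set Filter Topology

lemma dct {α : ℝ} (hα : 1 < α) {F : ℕ → ℂ → ℝ} {G : ℂ → ℝ} (K : ℝ)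
    (hF : ∀ᶠ n in atTop, ContinuousOn (F n) (closedBall (0:ℂ) 1))
    (hb : ∀ᶠ n in atTop, ∀ z ∈ closedBall (0:ℂ) 1, |F n z| ≤ K)
    (hl : ∀ z ∈ closedBall (0:ℂ) 1, Tendsto (fun n => F n z) atTop (𝓝 (G z))) :
    Tendsto (fun n => ∫ z, F n z ∂(bergmanMeasure α)) atTop (𝓝 (∫ z, G z ∂(bergmanMeasure α))) := by
  have := berg_prob hα
  refine tendsto_integral_filter_of_dominated_convergence (fun _ => K) ?_ ?_ (integrable_const K) ?_
  · filter_upwards [hF] with n hn using (integrable_cont hα hn).aestronglyMeasurable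
  · filter_upwards [hb] with n hn
    filter_upwards [berg_ae_ball α] with z hz using hn z (ball_subset_closedBall hz)
  · filter_upwards [berg_ae_ball α] with z hz using hl z (ball_subset_closedBall hz)

lemma antider (P : Polynomial ℝ) : ∃ Q : Polynomial ℝ, Q.derivative = P := by
  induction P using Polynomial.induction_on' with
  | add p q hp hq =>
    obtain ⟨a, rfl⟩ := hp
    obtain ⟨b, rfl⟩ := hq
    exact ⟨a + b, by simp⟩
  | monomial n c =>
    refine ⟨Polynomial.monomial (n+1) (c / (n+1)), ?_⟩
    rw [Polynomial.derivative_monomial]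
    have : (n:ℝ) + 1 ≠ 0 := by positivity
    congr 1
    push_cast
    field_simp

lemma c1_approx {a b : ℝ} (hab : a ≤ b) {g g' : ℝ → ℝ} (hg : ∀ y ∈ Icc a b, HasDerivAt g (g' y) y)
    (hg' : ContinuousOn g' (Icc a b)) {δ : ℝ} (hδ : 0 < δ) :
    ∃ Q : Polynomial ℝ, ∀ y ∈ Icc a b, |Q.eval y - g y| ≤ δ * (b - a) ∧ |Q.derivative.eval y - g' y| ≤ δ := by
  obtain ⟨P, hP⟩ := exists_polynomial_near_of_continuousOn a b g' hg' δ hδ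
  obtain ⟨Q, rfl⟩ := antider P
  refine ⟨Q + Polynomial.C (g a - Q.eval a), fun y hy => ⟨?_, ?_⟩⟩
  · have ha : a ∈ Icc a b := left_mem_Icc.2 hab
    have := Convex.norm_image_sub_le_of_norm_hasDerivWithin_le (s := Icc a b) (f := fun y => Q.eval y - g y)
      (f' := fun y => Q.derivative.eval y - g' y) (C := δ) (x := a) (y := y)
      (fun x hx => ((Q.hasDerivAt x).sub (hg x hx)).hasDerivWithinAt) (fun x hx => (hP x hx).le) (convex_Icc a b) ha hy
    simp only [Real.norm_eq_abs] at this
    rw [abs_of_nonneg (by linarith [hy.1] : 0 ≤ y - a)] at this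
    have e : (Q + Polynomial.C (g a - Q.eval a)).eval y - g y = (Q.eval y - g y - (Q.eval a - g a)) := by simp; ring
    rw [e]
    exact this.trans (mul_le_mul_of_nonneg_left (by linarith [hy.2]) hδ.le)
  · simpa using (hP y hy).le

lemma aeval_ev (Q : Polynomial ℝ) (V : MvPolynomial (Fin 2) ℝ) (z : ℂ) :
    ev (Polynomial.aeval V Q) z = Q.eval (ev V z) := by
  unfold ev
  rw [Polynomial.aeval_def, Polynomial.hom_eval₂]
  have : (MvPolynomial.eval ![z.re, z.im]).comp (algebraMap ℝ (MvPolynomial (Fin 2) ℝ)) = RingHom.id ℝ := by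
    ext x; simp [MvPolynomial.algebraMap_eq]
  rw [this, Polynomial.eval₂_id]

lemma aeval_d0 (Q : Polynomial ℝ) (V : MvPolynomial (Fin 2) ℝ) (z : ℂ) :
    ev (d0 (Polynomial.aeval V Q)) z = Q.derivative.eval (ev V z) * ev (d0 V) z := by
  rw [d0, Derivation.map_aeval, smul_eq_mul, ev_mul, aeval_ev]

lemma aeval_d1 (Q : Polynomial ℝ) (V : MvPolynomial (Fin 2) ℝ) (z : ℂ) :
    ev (d1 (Polynomial.aeval V Q)) z = Q.derivative.eval (ev V z) * ev (d1 V) z := by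
  rw [d1, Derivation.map_aeval, smul_eq_mul, ev_mul, aeval_ev]

theorem lsi_comp {α : ℝ} (hα : 5/4 ≤ α) {V : MvPolynomial (Fin 2) ℝ} (hV : ∀ z, 0 < ev V z)
    {g g' : ℝ → ℝ} (hg : ∀ y, 0 < y → HasDerivAt g (g' y) y) (hg' : ContinuousOn g' (Ioi 0))
    (hpos : ∀ y, 0 < y → 0 < g y) :
    ∫ z, g (ev V z) * Real.log (g (ev V z)) ∂(bergmanMeasure α) -
      (∫ z, g (ev V z) ∂(bergmanMeasure α)) * Real.log (∫ z, g (ev V z) ∂(bergmanMeasure α)) ≤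
     1/(4*α) * ∫ z, (g' (ev V z))^2 * ((ev (d0 V) z)^2 + (ev (d1 V) z)^2) / g (ev V z) ∂(bergmanMeasure (α+1)) := by
  have hα1 : 1 < α := by linarith
  have hα' : 1 < α + 1 := by linarith
  have hpr := berg_prob hα1
  have hcb := isCompact_closedBall (0:ℂ) 1
  obtain ⟨z0, hz0, hmin⟩ := hcb.exists_isMinOn ⟨0, by simp⟩ (continuous_ev V).continuousOn
  obtain ⟨z1, hz1, hmax⟩ := hcb.exists_isMaxOn ⟨0, by simp⟩ (continuous_ev V).continuousOn
  set a := ev V z0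
  set b := ev V z1
  have ha : 0 < a := hV z0
  have hab : a ≤ b := hmin hz1
  have hm : ∀ z ∈ closedBall (0:ℂ) 1, ev V z ∈ Icc a b := fun z hz => ⟨hmin hz, hmax hz⟩
  have hIcc : Icc a b ⊆ Ioi 0 := fun y hy => ha.trans_le hy.1
  have gc : ContinuousOn g (Icc a b) := fun y hy => (hg y (hIcc hy)).continuousAt.continuousWithinAt
  have gc' : ContinuousOn g' (Icc a b) := hg'.mono hIcc
  obtain ⟨y0, hy0, hgm⟩ := isCompact_Icc.exists_isMinOn ⟨a, left_mem_Icc.2 hab⟩ gc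
  set c := g y0
  have hc : 0 < c := hpos y0 (hIcc hy0)
  obtain ⟨K1, hK1⟩ := isCompact_Icc.exists_bound_of_continuousOn gc
  obtain ⟨K2, hK2⟩ := isCompact_Icc.exists_bound_of_continuousOn gc'
  have hK10 : 0 ≤ K1 := (norm_nonneg _).trans (hK1 y0 hy0)
  choose Q hQ using fun n : ℕ => c1_approx hab (fun y hy => hg y (hIcc hy)) gc' (δ := 1/((n:ℝ)+1)) (by positivity)
  have hlim0 : Tendsto (fun n : ℕ => 1/((n:ℝ)+1)) atTop (𝓝 0) := tendsto_one_div_add_atTop_nhds_zero_nat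
  have hlim1 : Tendsto (fun n : ℕ => 1/((n:ℝ)+1) * (b-a)) atTop (𝓝 0) := by simpa using hlim0.mul_const (b-a)
  have l0 : ∀ y ∈ Icc a b, Tendsto (fun n => (Q n).eval y) atTop (𝓝 (g y)) := fun y hy => by
    rw [tendsto_iff_norm_sub_tendsto_zero]
    exact squeeze_zero (fun n => norm_nonneg _) (fun n => (hQ n y hy).1) hlim1
  have l1 : ∀ y ∈ Icc a b, Tendsto (fun n => (Q n).derivative.eval y) atTop (𝓝 (g' y)) := fun y hy => by
    rw [tendsto_iff_norm_sub_tendsto_zero]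
    exact squeeze_zero (fun n => norm_nonneg _) (fun n => (hQ n y hy).2) hlim0
  have hev : ∀ᶠ n : ℕ in atTop, ∀ y ∈ Icc a b, (Q n).eval y ∈ Icc (c/2) (K1 + c) ∧ |(Q n).derivative.eval y| ≤ K2 + 1 := by
    filter_upwards [hlim1.eventually (gt_mem_nhds (half_pos hc)), hlim0.eventually (gt_mem_nhds one_pos)] with n h1 h2 y hy
    obtain ⟨h3, h4⟩ := hQ n y hy
    have h5 : c ≤ g y := hgm hy
    have h6 := hK1 y hy
    have h7 := hK2 y hy
    rw [Real.norm_eq_abs] at h6 h7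
    rw [abs_le] at h3 h4 h6 h7
    refine ⟨⟨by linarith, by linarith⟩, abs_le.2 ⟨by linarith, by linarith⟩⟩
  -- sequences
  set u : ℕ → MvPolynomial (Fin 2) ℝ := fun n => Polynomial.aeval V (Q n)
  have eu : ∀ n z, ev (u n) z = (Q n).eval (ev V z) := fun n z => aeval_ev _ _ _
  have eu0 : ∀ n z, ev (d0 (u n)) z = (Q n).derivative.eval (ev V z) * ev (d0 V) z := fun n z => aeval_d0 _ _ _
  have eu1 : ∀ n z, ev (d1 (u n)) z = (Q n).derivative.eval (ev V z) * ev (d1 V) z := fun n z => aeval_d1 _ _ _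
  have hup : ∀ᶠ n in atTop, ∀ z ∈ closedBall (0:ℂ) 1, ev (u n) z ∈ Icc (c/2) (K1+c) := by
    filter_upwards [hev] with n hn z hz
    rw [eu]; exact (hn _ (hm z hz)).1
  have lu : ∀ z ∈ closedBall (0:ℂ) 1, Tendsto (fun n => ev (u n) z) atTop (𝓝 (g (ev V z))) := fun z hz => by
    simp only [eu]; exact l0 _ (hm z hz)
  have t1 : Tendsto (fun n => ∫ z, ev (u n) z ∂(bergmanMeasure α)) atTop (𝓝 (∫ z, g (ev V z) ∂(bergmanMeasure α))) := by
    refine dct hα1 (K1 + c) (Eventually.of_forall fun n => (continuous_ev _).continuousOn) ?_ lu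
    filter_upwards [hup] with n hn z hz
    have := hn z hz
    exact abs_le.2 ⟨by linarith [this.1], this.2⟩
  obtain ⟨K3, hK3⟩ := (isCompact_Icc (a := c/2) (b := K1 + c)).exists_bound_of_continuousOn Real.continuous_mul_log.continuousOn
  have t2 : Tendsto (fun n => ∫ z, ev (u n) z * Real.log (ev (u n) z) ∂(bergmanMeasure α)) atTop
      (𝓝 (∫ z, g (ev V z) * Real.log (g (ev V z)) ∂(bergmanMeasure α))) := by
    refine dct hα1 K3 (Eventually.of_forall fun n => (Real.continuous_mul_log.comp (continuous_ev _)).continuousOn) ?_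
      (fun z hz => (Real.continuous_mul_log.tendsto _).comp (lu z hz))
    filter_upwards [hup] with n hn z hz using hK3 _ (hn z hz)
  obtain ⟨K4, hK4⟩ := hcb.exists_bound_of_continuousOn (f := fun z => (ev (d0 V) z)^2 + (ev (d1 V) z)^2)
    (Continuous.continuousOn (by fun_prop))
  have t3 : Tendsto (fun n => ∫ z, ((ev (d0 (u n)) z)^2 + (ev (d1 (u n)) z)^2) / ev (u n) z ∂(bergmanMeasure (α+1))) atTop
      (𝓝 (∫ z, (g' (ev V z))^2 * ((ev (d0 V) z)^2 + (ev (d1 V) z)^2) / g (ev V z) ∂(bergmanMeasure (α+1)))) := by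
    refine dct hα' ((K2+1)^2 * K4 / (c/2)) ?_ ?_ ?_
    · filter_upwards [hup] with n hn
      exact (Continuous.continuousOn (by fun_prop)).div (continuous_ev _).continuousOn
        (fun z hz => (lt_of_lt_of_le (half_pos hc) (hn z hz).1).ne')
    · filter_upwards [hev] with n hn z hz
      obtain ⟨h1, h2⟩ := hn _ (hm z hz)
      have h3 := hK4 z hz
      rw [Real.norm_eq_abs, abs_of_nonneg (by positivity)] at h3
      rw [eu, eu0, eu1]
      have h4 : 0 < c/2 := half_pos hc
      rw [abs_of_nonneg (div_nonneg (by positivity) (h4.le.trans h1.1))]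
      have h5 : ((Q n).derivative.eval (ev V z))^2 ≤ (K2+1)^2 := sq_le_sq.2 (h2.trans (le_abs_self _))
      refine div_le_div₀ (mul_nonneg (sq_nonneg _) (le_trans (by positivity) h3)) ?_ h4 h1.1
      calc _ = ((Q n).derivative.eval (ev V z))^2 * ((ev (d0 V) z)^2 + (ev (d1 V) z)^2) := by ring
        _ ≤ _ := mul_le_mul h5 h3 (by positivity) (sq_nonneg _)
    · intro z hz
      have h0 := hm z hz
      have := ((((l1 _ h0).pow 2).mul_const ((ev (d0 V) z)^2 + (ev (d1 V) z)^2)).div (lu z hz) (hpos _ (hIcc h0)).ne')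
      refine this.congr fun n => ?_
      rw [eu0, eu1]; simp only [Pi.div_apply]; ring
  refine le_of_tendsto_of_tendsto (t2.sub (((Real.continuous_mul_log.tendsto _).comp t1))) (t3.const_mul (1/(4*α))) ?_
  filter_upwards [hup] with n hn
  exact lsi_poly hα (fun z hz => lt_of_lt_of_le (half_pos hc) (hn z hz).1)

end HC
namespace HC
open Set Filter Topology

lemma lsi_dil {f ε V} (h : Jet f ε V) (hε : 0 < ε) {α : ℝ} (hα : 5/4 ≤ α) {σ : ℝ} (hσ : 0 < σ) (ρ : ℝ) :
    ∫ z : ℂ, (ev V (ρ*z))^σ * Real.log ((ev V (ρ*z))^σ) ∂(bergmanMeasure α) -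
      (∫ z : ℂ, (ev V (ρ*z))^σ ∂(bergmanMeasure α)) * Real.log (∫ z : ℂ, (ev V (ρ*z))^σ ∂(bergmanMeasure α)) ≤
    1/(4*α) * (ρ^2 * ∫ z, lapP f ε V σ (ρ*z) ∂(bergmanMeasure (α+1))) := by
  have hα' : 1 < α + 1 := by linarith
  obtain ⟨W, hW⟩ := exists_jet (f.comp (Polynomial.C (ρ:ℂ) * Polynomial.X)) ε
  have e0 : ∀ z, (f.comp (Polynomial.C (ρ:ℂ) * Polynomial.X)).eval z = f.eval (ρ*z) := fun z => by simp
  have e1 : ∀ z, (f.comp (Polynomial.C (ρ:ℂ) * Polynomial.X)).derivative.eval z = ρ * f.derivative.eval (ρ*z) := fun z => by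
    simp [Polynomial.derivative_comp]
  have eW : ∀ z, ev W z = ev V (ρ*z) := fun z => by rw [hW.val, h.val, e0]
  have key := lsi_comp hα (hW.pos hε) (g := fun y => y^σ) (g' := fun y => σ * y^(σ-1))
    (fun y hy => Real.hasDerivAt_rpow_const (Or.inl hy.ne'))
    (continuousOn_const.mul (continuousOn_id.rpow_const fun y hy => Or.inl (ne_of_gt hy)))
    (fun y hy => Real.rpow_pos_of_pos hy σ)
  simp only [eW] at key
  refine key.trans (mul_le_mul_of_nonneg_left ?_ (by positivity))
  rw [← integral_const_mul]
  have hV := h.pos hε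
  have cl : Continuous fun z : ℂ => lapP f ε V σ (ρ*z) := (continuous_lapP h hε σ).comp (by fun_prop)
  refine integral_mono_of_nonneg (ae_of_all _ fun z => ?_) ((integrable_cont hα' cl.continuousOn).const_mul _) (ae_of_all _ fun z => ?_)
  · have := hV (ρ*z)
    simp only [Pi.zero_apply]
    positivity
  · have hv := hV (ρ*z)
    simp only [hW.grad, e0, e1, lapP]
    have e2 : (σ * ev V (ρ*z)^(σ-1))^2 = σ^2 * (ev V (ρ*z)^(σ-2) * ev V (ρ*z)^σ) := by
      rw [mul_pow, ← Real.rpow_natCast (_ ^ (σ-1)), ← Real.rpow_mul hv.le, ← Real.rpow_add hv]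
      congr 2; push_cast; ring
    rw [e2]
    have hp1 : 0 < ev V (ρ*z)^σ := Real.rpow_pos_of_pos hv _
    have hp2 : 0 < ev V (ρ*z)^(σ-2) := Real.rpow_pos_of_pos hv _
    generalize ev V (ρ*z)^σ = A at *
    generalize ev V (ρ*z)^(σ-2) = B at *
    rw [norm_mul, Complex.norm_real, Real.norm_eq_abs, mul_pow, sq_abs]
    generalize ‖f.eval (ρ*z)‖ = c
    generalize ‖f.derivative.eval (ρ*z)‖ = d
    have : σ^2 * (B*A) * (4 * c^2 * (ρ^2 * d^2)) / A = ρ^2 * (4 * σ * B * d^2 * (σ * c^2)) := by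
      field_simp
    rw [this]
    refine mul_le_mul_of_nonneg_left (mul_le_mul_of_nonneg_left (by linarith) (by positivity)) (by positivity)

theorem hyperE_eps {f ε V} (h : Jet f ε V) (hε : 0 < ε) {α : ℝ} (hα : 5/4 ≤ α) {p q : ℝ} (hp : 0 < p) (hpq : p ≤ q) :
    1/q * Real.log (∫ z : ℂ, (ev V ((Real.sqrt (p/q) : ℝ) * z))^(q/2) ∂(bergmanMeasure α)) ≤
    1/p * Real.log (∫ z : ℂ, (ev V z)^(p/2) ∂(bergmanMeasure α)) := by
  have hα1 : 1 < α := by linarith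
  have hpr := berg_prob hα1
  have hV := h.pos hε
  let r : ℝ → ℝ := fun s => Real.sqrt (p/s)
  have hr : ∀ s, 0 < s → HasDerivAt r (-(r s)/(2*s)) s := by
    intro s hs
    have h1 : HasDerivAt (fun s => p/s) (-(p/s^2)) s := by
      have := (hasDerivAt_inv hs.ne').const_mul p
      simpa [div_eq_mul_inv] using this
    refine (h1.sqrt (by positivity)).congr_deriv ?_
    have : Real.sqrt (p/s) ≠ 0 := (Real.sqrt_pos.2 (by positivity)).ne'
    have h2 : Real.sqrt (p/s)^2 = p/s := Real.sq_sqrt (by positivity)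
    simp only [r]
    field_simp
    rw [h2]; field_simp
  let m : ℝ → ℝ := fun s => ∫ z : ℂ, (ev V (r s * z))^(s/2) ∂(bergmanMeasure α)
  have hrc : ∀ a b, 0 < a → ContinuousOn r (Icc a b) := fun a b ha s hs => (hr s (ha.trans_le hs.1)).continuousAt.continuousWithinAt
  have cV : ∀ a b, 0 < a → ContinuousOn (fun x : ℝ × ℂ => (r x.1 : ℂ) * x.2) (Icc a b ×ˢ closedBall (0:ℂ) 1) := fun a b ha =>
    (Complex.continuous_ofReal.comp_continuousOn ((hrc a b ha).comp continuous_fst.continuousOn fun x hx => hx.1)).mul continuous_snd.continuousOn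
  have cP : ∀ a b, 0 < a → ∀ P, ContinuousOn (fun x : ℝ × ℂ => ev P ((r x.1 : ℂ) * x.2)) (Icc a b ×ˢ closedBall (0:ℂ) 1) :=
    fun a b ha P => (continuous_ev P).comp_continuousOn (cV a b ha)
  have cpw : ∀ a b, 0 < a → ∀ c : ℝ, ContinuousOn (fun x : ℝ × ℂ => (ev V ((r x.1 : ℂ) * x.2))^(x.1/2 - c)) (Icc a b ×ˢ closedBall (0:ℂ) 1) :=
    fun a b ha c => (cP a b ha V).rpow (Continuous.continuousOn (by fun_prop)) (fun x _ => Or.inl (hV _).ne')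
  have cm : ContinuousOn m (Icc p q) := by
    refine continuousOn_int hα1 (F := fun s z => (ev V (r s * z))^(s/2)) ?_
    simpa using cpw p q hp 0
  have mpos : ∀ s, 0 < m s := by
    intro s
    have ci : Continuous fun z : ℂ => (ev V (r s * z))^(s/2) := (continuous_pw hV (s/2)).comp (by fun_prop)
    have := (integral_pos_iff_support_of_nonneg (μ := bergmanMeasure α) (f := fun z : ℂ => (ev V (r s * z))^(s/2))
      (fun z => (Real.rpow_pos_of_pos (hV _) _).le) (integrable_cont hα1 ci.continuousOn)).2 (by
        have : Function.support (fun z : ℂ => (ev V (r s * z))^(s/2)) = univ := by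
          ext z; simpa using (Real.rpow_pos_of_pos (hV _) _).ne'
        rw [this]; simp)
    exact this
  have dm : ∀ s, 0 < s → ∃ d, HasDerivAt m d s ∧ s * d - m s * Real.log (m s) ≤ 0 := by
    intro s hs
    have key := hasDerivAt_int hα1 (F := fun s z => (ev V (r s * z))^(s/2))
      (F' := fun s z => 1/2 * ((ev V (r s * z))^(s/2 - 0) * Real.log (ev V (r s * z))) - 1/(2*s) *
        (z.re * (r s * (s/2 * (ev V (r s *z))^(s/2-1) * ev (d0 V) (r s *z))) +
        z.im * (r s * (s/2 * (ev V (r s *z))^(s/2-1) * ev (d1 V) (r s *z))))) (a := s/2) (b := s+1) (t := s)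
      ⟨by linarith, by linarith⟩ ?_ ?_ ?_
    · refine ⟨_, key, ?_⟩
      have c1 : Continuous fun z : ℂ => (r s : ℂ) * z := by fun_prop
      have c2 : Continuous fun z : ℂ => (ev V (r s * z))^(s/2) := (continuous_pw hV (s/2)).comp c1
      have c3 : Continuous fun z : ℂ => (ev V (r s * z))^(s/2-1) := (continuous_pw hV (s/2-1)).comp c1
      have c4 : Continuous fun z : ℂ => Real.log (ev V (r s * z)) := ((continuous_ev V).comp c1).log fun z => (hV _).ne'
      have h1 := intR_pow h hε hα1 (s/2) (r s)
      have h2 := lsi_dil h hε hα (σ := s/2) (by positivity) (r s)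
      have h3 : ∀ z : ℂ, Real.log ((ev V (r s*z))^(s/2)) = s/2 * Real.log (ev V (r s * z)) := fun z =>
        Real.log_rpow (hV _) _
      simp only [h3] at h2
      rw [integral_sub, integral_const_mul, integral_const_mul, h1]
      · have e : ∫ z : ℂ, (ev V (r s*z))^(s/2) * (s/2 * Real.log (ev V (r s * z))) ∂(bergmanMeasure α)
          = s/2 * ∫ z : ℂ, (ev V (r s*z))^(s/2 - 0) * (Real.log (ev V (r s * z))) ∂(bergmanMeasure α) := by
          rw [← integral_const_mul]
          congr 1; ext z; rw [sub_zero]; ring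
        rw [e] at h2
        change _ - m s * Real.log (m s) ≤ _ at h2
        generalize ∫ z : ℂ, (ev V (r s*z))^(s/2 - 0) * (Real.log (ev V (r s * z))) ∂(bergmanMeasure α) = A at *
        generalize (r s)^2 * ∫ z : ℂ, lapP f ε V (s/2) (r s * z) ∂(bergmanMeasure (α+1)) = B at *
        have hα0 : α ≠ 0 := by linarith
        have : s * (1/2 * A - 1/(2*s) * (1/(2*α) * B)) = s/2 * A - 1/(4*α) * B := by field_simp; ring
        rw [this]; linarith
      · simp only [sub_zero]
        exact integrable_cont hα1 (Continuous.continuousOn (by fun_prop))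
      · exact integrable_cont hα1 (Continuous.continuousOn (by fun_prop))
    · intro t ht
      exact ((continuous_pw hV (t/2)).comp (by fun_prop : Continuous fun z : ℂ => (r t : ℂ) * z)).continuousOn
    · have h0 : 0 < s/2 := by positivity
      have c1 := cpw (s/2) (s+1) h0 1
      have c0 := cpw (s/2) (s+1) h0 0
      have cr : ContinuousOn (fun x : ℝ × ℂ => r x.1) (Icc (s/2) (s+1) ×ˢ closedBall (0:ℂ) 1) :=
        (hrc (s/2) (s+1) h0).comp continuous_fst.continuousOn fun x hx => hx.1
      have cl := (cP (s/2) (s+1) h0 V).log fun x _ => (hV _).ne'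
      have a0 := cP (s/2) (s+1) h0 (d0 V)
      have a1 := cP (s/2) (s+1) h0 (d1 V)
      have cs : ContinuousOn (fun x : ℝ × ℂ => 1/(2*x.1)) (Icc (s/2) (s+1) ×ˢ closedBall (0:ℂ) 1) :=
        continuousOn_const.div (Continuous.continuousOn (by fun_prop)) fun x hx => by
          have := hx.1.1; have : 0 < x.1 := by linarith
          positivity
      have ch : ContinuousOn (fun x : ℝ × ℂ => x.1/2) (Icc (s/2) (s+1) ×ˢ closedBall (0:ℂ) 1) := Continuous.continuousOn (by fun_prop)
      have cre : ContinuousOn (fun x : ℝ × ℂ => x.2.re) (Icc (s/2) (s+1) ×ˢ closedBall (0:ℂ) 1) := Continuous.continuousOn (by fun_prop)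
      have cim : ContinuousOn (fun x : ℝ × ℂ => x.2.im) (Icc (s/2) (s+1) ×ˢ closedBall (0:ℂ) 1) := Continuous.continuousOn (by fun_prop)
      exact (continuousOn_const.mul (c0.mul cl)).sub (cs.mul ((cre.mul (cr.mul ((ch.mul c1).mul a0))).add (cim.mul (cr.mul ((ch.mul c1).mul a1)))))
    · intro t ht z hz
      have ht0 : 0 < t := by linarith [ht.1]
      have ez : ∀ ρ : ℝ, (ρ:ℂ) * z = ⟨ρ*z.re, ρ*z.im⟩ := fun ρ => ofReal_mul_mk ρ z.re z.im
      have h1 := ev_hasDeriv V ((hr t ht0).mul_const z.re) ((hr t ht0).mul_const z.im)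
      have h2 := h1.rpow ((hasDerivAt_id t).div_const 2) (hV _)
      simp only [ez]
      refine h2.congr_deriv ?_
      simp only [id, sub_zero]
      field_simp
      ring
  have anti : AntitoneOn (fun s => 1/s * Real.log (m s)) (Icc p q) := by
    have hd : ∀ s, 0 < s → ∃ d ≤ 0, HasDerivAt (fun s => 1/s * Real.log (m s)) d s := by
      intro s hs
      obtain ⟨d, h1, h2⟩ := dm s hs
      have h3 := ((hasDerivAt_inv hs.ne').fun_mul (h1.log (mpos s).ne'))
      simp only [one_div]
      refine ⟨_, ?_, h3⟩
      have hm := mpos s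
      have : -(s^2)⁻¹ * Real.log (m s) + s⁻¹ * (d / m s) = (s * d - m s * Real.log (m s)) / (s^2 * m s) := by
        field_simp
        ring
      rw [this]
      exact div_nonpos_of_nonpos_of_nonneg h2 (by positivity)
    refine antitoneOn_of_deriv_nonpos (convex_Icc p q) ?_ ?_ ?_
    · exact fun s hs => (hd s (hp.trans_le hs.1)).choose_spec.2.continuousAt.continuousWithinAt
    · intro s hs
      rw [interior_Icc] at hs
      exact (hd s (hp.trans hs.1)).choose_spec.2.differentiableAt.differentiableWithinAt
    · intro s hs
      rw [interior_Icc] at hs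
      obtain ⟨d, h1, h2⟩ := hd s (hp.trans hs.1)
      rwa [h2.deriv]
  have := anti (left_mem_Icc.2 hpq) (right_mem_Icc.2 hpq) hpq
  simpa [m, r, div_self hp.ne'] using this

end HC
namespace HC
open Set Filter Topology

def Good (α p q r : ℝ) : Prop := ∀ f : Polynomial ℂ,
  ∫ z : ℂ, ‖f.eval ((r:ℂ)*z)‖^q ∂(bergmanMeasure α) ≤ (∫ z : ℂ, ‖f.eval z‖^p ∂(bergmanMeasure α))^(q/p)

lemma cont_npow (f : Polynomial ℂ) {q : ℝ} (hq : 0 < q) (r : ℂ) : Continuous fun z : ℂ => ‖f.eval (r*z)‖^q :=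
  (by fun_prop : Continuous fun z : ℂ => ‖f.eval (r*z)‖).rpow_const (fun z => Or.inr hq.le)

lemma cont_npow1 (f : Polynomial ℂ) {q : ℝ} (hq : 0 < q) : Continuous fun z : ℂ => ‖f.eval z‖^q := by
  simpa using cont_npow f hq 1

theorem goodE {α p q r : ℝ} (hα : 5/4 ≤ α) (hp : 0 < p) (hpq : p < q) (hp2 : p ≤ 2) (hr : 0 ≤ r)
    (hr2 : r ≤ Real.sqrt (p/q)) : Good α p q r := by
  intro f
  have hα1 : 1 < α := by linarith
  have hq : 0 < q := hp.trans hpq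
  refine eps_lim (s := p/2) (by positivity) (q/p) (by positivity) (integral_nonneg fun z => by positivity) ?_
  intro ε hε
  obtain ⟨V, h⟩ := exists_jet f ε
  have hV := h.pos hε
  have h1 := hyperE_eps h hε hα hp hpq.le
  have h2 := eps_le h hε hα1 (s := p/2) (by positivity) (by linarith)
  have hs1 : Real.sqrt (p/q) ≤ 1 := Real.sqrt_le_one.2 ((div_le_one hq).2 hpq.le)
  have h3 := dil_mono h hε hα1 (s := q/2) (by positivity) ⟨hr, hr2.trans hs1⟩ ⟨Real.sqrt_nonneg _, hs1⟩ hr2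
  simp only at h3
  have h4 : ∫ z : ℂ, ‖f.eval ((r:ℂ)*z)‖^q ∂(bergmanMeasure α) ≤ ∫ z : ℂ, (ev V (r*z))^(q/2) ∂(bergmanMeasure α) := by
    refine integral_mono (integrable_cont hα1 (cont_npow f hq r).continuousOn)
      (integrable_cont hα1 ((continuous_pw hV (q/2)).comp (by fun_prop : Continuous fun z : ℂ => (r:ℂ)*z)).continuousOn) fun z => ?_
    simp only [Function.comp, h.val]
    have : ‖f.eval ((r:ℂ)*z)‖^q = (‖f.eval ((r:ℂ)*z)‖^2)^(q/2) := by
      rw [← Real.rpow_natCast, ← Real.rpow_mul (norm_nonneg _)]; congr 1; push_cast; ring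
    rw [this]
    exact Real.rpow_le_rpow (by positivity) (by linarith) (by positivity)
  refine (h4.trans h3).trans ?_
  have e : 2 * (p/2) = p := by ring
  rw [e] at h2
  set A := ∫ z : ℂ, (ev V ((Real.sqrt (p/q) : ℝ) * z))^(q/2) ∂(bergmanMeasure α)
  set B := ∫ z : ℂ, (ev V z)^(p/2) ∂(bergmanMeasure α) with hB
  have hA0 : 0 ≤ A := integral_nonneg fun z => (Real.rpow_pos_of_pos (hV _) _).le
  have hB0 : 0 ≤ B := integral_nonneg fun z => (Real.rpow_pos_of_pos (hV _) _).le
  refine le_trans ?_ (Real.rpow_le_rpow hB0 h2 (by positivity))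
  rcases hA0.eq_or_lt with hA | hA
  · rw [← hA]; positivity
  have hBp : 0 < B := by
    have hpr := berg_prob hα1
    refine (integral_pos_iff_support_of_nonneg (μ := bergmanMeasure α) (f := fun z : ℂ => (ev V z)^(p/2))
      (fun z => (Real.rpow_pos_of_pos (hV _) _).le) (integrable_cont hα1 (continuous_pw hV _).continuousOn)).2 ?_
    have : Function.support (fun z : ℂ => (ev V z)^(p/2)) = univ := by
      ext z; simpa using (Real.rpow_pos_of_pos (hV _) _).ne'
    rw [this]; simp
  rw [← Real.log_le_log_iff hA (by positivity), Real.log_rpow hBp]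
  have := mul_le_mul_of_nonneg_left h1 hq.le
  calc Real.log A = q * (1/q * Real.log A) := by field_simp
    _ ≤ _ := this
    _ = _ := by ring

lemma jensen {α : ℝ} (hα : 1 < α) {A : ℂ → ℝ} (hA : ContinuousOn A (closedBall (0:ℂ) 1)) (h0 : ∀ z, 0 ≤ A z)
    {k : ℝ} (hk : 1 ≤ k) : (∫ z, A z ∂(bergmanMeasure α))^k ≤ ∫ z, (A z)^k ∂(bergmanMeasure α) := by
  have := berg_prob hα
  exact (convexOn_rpow hk).map_integral_le (continuousOn_id.rpow_const fun x _ => Or.inr (by linarith)) isClosed_Ici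
    (ae_of_all _ h0) (integrable_cont hα hA) (integrable_cont hα (hA.rpow_const fun x _ => Or.inr (by linarith)))

theorem goodB {α p q : ℝ} (hα : 1 < α) (hp : 0 < p) (hpq : p < q) (hq2 : q < 2) : Good α p q (Real.sqrt (p/2)) := by
  intro f
  have hq : 0 < q := hp.trans hpq
  have h1 := thmB (s := p/2) (by positivity) (by linarith) f.natDegree f le_rfl α hα
  have h2 := jensen hα (cont_npow f hq (Real.sqrt (p/2) : ℝ)).continuousOn (fun z => by positivity) (k := 2/q)
    (by rw [le_div_iff₀ hq]; linarith)
  have e : ∀ z : ℂ, (‖f.eval ((Real.sqrt (p/2) : ℝ)*z)‖^q)^(2/q) = ‖f.eval ((Real.sqrt (p/2) : ℝ)*z)‖^2 := fun z => by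
    rw [← Real.rpow_mul (norm_nonneg _), mul_div_cancel₀ _ hq.ne']; norm_num
  simp only [e] at h2
  have h3 := h2.trans h1
  have e2 : 2 * (p/2) = p := by ring
  rw [e2] at h3
  have h4 := Real.rpow_le_rpow (by positivity) h3 (by positivity : 0 ≤ q/2)
  rw [← Real.rpow_mul (by positivity), ← Real.rpow_mul (by positivity)] at h4
  have e3 : 2/q * (q/2) = 1 := by field_simp
  have e4 : 1/(p/2) * (q/2) = q/p := by field_simp
  rwa [e3, e4, Real.rpow_one] at h4

end HC
namespace HC
open Set Filter Topology

lemma cca {w : ℂ → ℝ} (hw : Continuous w) : Continuous (Real.circleAverage w 0) :=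
  Real.Continuous.circleAverage hw

lemma polar_avg {α : ℝ} (hα : 1 < α) {w : ℂ → ℝ} (hw : Continuous w) :
    IntegrableOn (fun y : ℝ => 2 * (α-1) * y * (1 - y^2) ^ (α - 1 - 1) * Real.circleAverage w 0 y) (Ioc 0 1) ∧
    ∫ z, w z ∂(bergmanMeasure α) =
      ∫ y in (0:ℝ)..1, 2 * (α-1) * y * (1 - y^2) ^ (α - 1 - 1) * Real.circleAverage w 0 y := by
  have hb : 0 < α - 1 := by linarith
  obtain ⟨h1, h2⟩ := radial_int hb
  have hint : IntegrableOn (fun y : ℝ => 2 * (α-1) * y * (1 - y^2) ^ (α - 1 - 1) * Real.circleAverage w 0 y) (Ioc 0 1) := by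
    have hc : Continuous (Real.circleAverage w 0) := (cca hw)
    obtain ⟨K, hK⟩ := (isCompact_Icc (a := (0:ℝ)) (b := 1)).exists_bound_of_continuousOn hc.continuousOn
    refine Integrable.mul_bdd (c := K) h1 hc.aestronglyMeasurable ?_
    filter_upwards [ae_restrict_mem measurableSet_Ioc] with y hy
    exact hK y ⟨hy.1.le, hy.2⟩
  refine ⟨hint, ?_⟩
  rw [integral_berg hα, ← integral_indicator measurableSet_ball, ← Complex.integral_comp_polarCoord_symm,
    polarCoord_target]
  have hF : ∀ x : ℝ × ℝ, x ∈ Ioi (0:ℝ) ×ˢ Ioo (-Real.pi) Real.pi →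
      x.1 • (ball (0:ℂ) 1).indicator (fun z => dens α z * w z) (Complex.polarCoord.symm x)
      = (Iio (1:ℝ)).indicator (fun y => (2 * Real.pi)⁻¹ * (2 * (α-1) * y * (1 - y^2) ^ (α - 1 - 1))) x.1 * w (circleMap 0 x.1 x.2) := by
    rintro ⟨y, t⟩ ⟨hy, -⟩
    have hy : 0 < y := hy
    have e : Complex.polarCoord.symm (y, t) = circleMap 0 y t := by
      rw [Complex.polarCoord_symm_apply]; simp [circleMap, Complex.exp_mul_I]
    rw [e]
    have en : ‖circleMap 0 y t‖ = y := by simp [abs_of_pos hy]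
    by_cases h : y < 1
    · rw [indicator_of_mem (by simpa [en] using h), indicator_of_mem (by simpa using h)]
      simp only [dens, en, smul_eq_mul]
      rw [show α - 1 - 1 = α - 2 by ring]
      have := Real.pi_pos
      field_simp
    · rw [indicator_of_notMem (by simpa [abs_of_pos hy] using h), indicator_of_notMem (by simpa using h)]
      simp
  rw [setIntegral_congr_fun (measurableSet_Ioi.prod measurableSet_Ioo) hF]
  set φ : ℝ → ℝ := (Iio (1:ℝ)).indicator (fun y => (2 * Real.pi)⁻¹ * (2 * (α-1) * y * (1 - y^2) ^ (α - 1 - 1))) with hφ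
  have hφi : IntegrableOn φ (Ioi 0) := by
    rw [hφ, integrableOn_indicator_iff measurableSet_Iio]
    refine (h1.mono_set ?_).const_mul _
    intro y hy; exact ⟨hy.2, (show y < 1 from hy.1).le⟩
  have hFi : IntegrableOn (fun x : ℝ × ℝ => φ x.1 * w (circleMap 0 x.1 x.2)) (Ioi (0:ℝ) ×ˢ Ioo (-Real.pi) Real.pi) (volume.prod volume) := by
    obtain ⟨K, hK⟩ := (isCompact_closedBall (0:ℂ) 1).exists_bound_of_continuousOn hw.continuousOn
    have hK0 : 0 ≤ K := (norm_nonneg _).trans (hK 0 (by simp))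
    rw [IntegrableOn, ← Measure.prod_restrict]
    have hm : Integrable (fun x : ℝ × ℝ => φ x.1 * K) ((volume.restrict (Ioi (0:ℝ))).prod (volume.restrict (Ioo (-Real.pi) Real.pi))) :=
      Integrable.mul_prod (f := φ) (g := fun _ : ℝ => K) hφi (integrable_const K)
    refine hm.mono ?_ ?_
    · refine AEStronglyMeasurable.mul ?_ ?_
      · exact hφi.aestronglyMeasurable.comp_fst
      · exact (hw.comp (by fun_prop)).aestronglyMeasurable
    · have hh : ∀ᵐ x : ℝ × ℝ ∂((volume.restrict (Ioi (0:ℝ))).prod (volume.restrict (Ioo (-Real.pi) Real.pi))), x ∈ Ioi (0:ℝ) ×ˢ Ioo (-Real.pi) Real.pi := by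
        rw [Measure.prod_restrict]; exact ae_restrict_mem (measurableSet_Ioi.prod measurableSet_Ioo)
      filter_upwards [hh] with x hx
      have hx0 : 0 < x.1 := hx.1
      rw [norm_mul, norm_mul]
      by_cases h : x.1 < 1
      · rw [Real.norm_of_nonneg hK0]
        gcongr
        exact hK _ (by simpa [abs_of_pos hx0] using h.le)
      · have : φ x.1 = 0 := by rw [hφ, indicator_of_notMem (by simpa using h)]
        simp [this]
  rw [Measure.volume_eq_prod, setIntegral_prod _ hFi]
  rw [intervalIntegral.integral_of_le zero_le_one]
  have hs : Ioi (0:ℝ) ∩ Iio 1 = Ioo 0 1 := Ioi_inter_Iio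
  have key : ∀ y : ℝ, ∫ t in Ioo (-Real.pi) Real.pi, φ y * w (circleMap 0 y t)
      = (Iio (1:ℝ)).indicator (fun y => 2 * (α-1) * y * (1 - y^2) ^ (α - 1 - 1) * Real.circleAverage w 0 y) y := by
    intro y
    rw [integral_const_mul, ← integral_Ioc_eq_integral_Ioo, ← intervalIntegral.integral_of_le (by linarith [Real.pi_pos])]
    have hca : Real.circleAverage w 0 y = (2*Real.pi)⁻¹ * ∫ t in (-Real.pi)..Real.pi, w (circleMap 0 y t) := by
      rw [Real.circleAverage_eq_integral_add (-Real.pi), intervalIntegral.integral_comp_add_right (fun θ => w (circleMap 0 y θ))]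
      rw [smul_eq_mul]; congr 2 <;> ring
    by_cases h : y ∈ Iio (1:ℝ)
    · rw [hφ, indicator_of_mem h, indicator_of_mem h, hca]; ring
    · rw [hφ, indicator_of_notMem h, indicator_of_notMem h]; simp
  simp only [key]
  rw [setIntegral_indicator measurableSet_Iio, hs, integral_Ioc_eq_integral_Ioo]

/-- polar coordinates with uniform parameter -/
lemma polar_P {α : ℝ} (hα : 1 < α) {w : ℂ → ℝ} (hw : Continuous w) :
    ∫ z, w z ∂(bergmanMeasure α) =
      ∫ P in (0:ℝ)..1, Real.circleAverage w 0 (√(1 - P ^ (1/(α-1)))) := by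
  have hb : 0 < α - 1 := by linarith
  obtain ⟨h1, h2⟩ := polar_avg hα hw
  rw [h2]
  have hg : Continuous (fun P : ℝ => Real.circleAverage w 0 (√(1 - P ^ (1/(α-1))))) := by
    refine (cca hw).comp (Real.continuous_sqrt.comp (continuous_const.sub ?_))
    exact Real.continuous_rpow_const (by positivity)
  have hfy : ∀ y ∈ Icc (0:ℝ) 1, √(1 - ((1 - y^2)^(α-1)) ^ (1/(α-1))) = y := by
    intro y hy
    have : 0 ≤ 1 - y^2 := by nlinarith [hy.1, hy.2]
    rw [← Real.rpow_mul this, mul_one_div_cancel hb.ne', Real.rpow_one, sub_sub_cancel, Real.sqrt_sq hy.1]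
  have := intervalIntegral.integral_comp_mul_deriv''' (a := 0) (b := 1)
    (f := fun y : ℝ => (1 - y^2)^(α-1)) (f' := fun y => -(2 * (α-1) * y * (1 - y^2) ^ (α - 1 - 1)))
    (g := fun P : ℝ => Real.circleAverage w 0 (√(1 - P ^ (1/(α-1))))) ?_ ?_ hg.continuousOn ?_ ?_
  · have e0 : ((1:ℝ) - 0^2)^(α-1) = 1 := by simp
    have e1 : ((1:ℝ) - 1^2)^(α-1) = 0 := by simp [Real.zero_rpow hb.ne']
    rw [e0, e1, intervalIntegral.integral_symm 0 1] at this
    rw [← neg_inj, ← this, ← intervalIntegral.integral_neg]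
    refine intervalIntegral.integral_congr ?_
    intro y hy
    rw [uIcc_of_le zero_le_one] at hy
    simp only [Function.comp, hfy y hy]
    ring
  · exact ContinuousOn.rpow_const (by fun_prop) fun x hx => Or.inr hb.le
  · intro x hx
    simp only [zero_le_one, min_eq_left, max_eq_right] at hx
    have hp : 0 < 1 - x^2 := by nlinarith [hx.1, hx.2]
    have h0 : HasDerivAt (fun y : ℝ => 1 - y^2) (-(2*x)) x := by
      have := (hasDerivAt_pow 2 x).const_sub 1; simpa using this
    have := h0.rpow_const (p := α - 1) (Or.inl hp.ne')
    exact (this.congr_deriv (by ring)).hasDerivWithinAt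
  · refine (hg.continuousOn.integrableOn_compact ?_)
    apply isCompact_uIcc.image_of_continuousOn
    exact ContinuousOn.rpow_const (by fun_prop) fun x hx => Or.inr hb.le
  · rw [uIcc_of_le zero_le_one, integrableOn_Icc_iff_integrableOn_Ioc]
    refine h1.neg.congr_fun ?_ measurableSet_Ioc
    intro y hy
    simp only [Function.comp, hfy y ⟨hy.1.le, hy.2⟩, Pi.neg_apply]
    ring

/-- circle means as limits -/
lemma lim_one {w : ℂ → ℝ} (hw : Continuous w) :
    Tendsto (fun a : ℝ => ∫ z, w z ∂(bergmanMeasure a)) (𝓝[>] 1) (𝓝 (Real.circleAverage w 0 1)) := by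
  have hc : Continuous (Real.circleAverage w 0) := (cca hw)
  obtain ⟨K, hK⟩ := (isCompact_Icc (a := (0:ℝ)) (b := 1)).exists_bound_of_continuousOn hc.continuousOn
  have h : Tendsto (fun a : ℝ => ∫ P in (0:ℝ)..1, Real.circleAverage w 0 (√(1 - P ^ (1/(a-1))))) (𝓝[>] 1)
      (𝓝 (∫ P in (0:ℝ)..1, Real.circleAverage w 0 1)) := by
    refine intervalIntegral.tendsto_integral_filter_of_dominated_convergence (fun _ => K) ?_ ?_ ?_ ?_
    · filter_upwards [self_mem_nhdsWithin] with a ha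
      have ha : 1 < a := ha
      have hb : 0 < a - 1 := by linarith
      refine Continuous.aestronglyMeasurable ?_
      refine (cca hw).comp (Real.continuous_sqrt.comp (continuous_const.sub ?_))
      exact Real.continuous_rpow_const (by positivity)
    · filter_upwards [self_mem_nhdsWithin] with a ha
      refine ae_of_all _ fun P hP => ?_
      rw [uIoc_of_le zero_le_one] at hP
      apply hK
      refine ⟨Real.sqrt_nonneg _, Real.sqrt_le_one.mpr ?_⟩
      linarith [Real.rpow_nonneg hP.1.le (1/(a-1))]
    · exact intervalIntegrable_const
    · have : ∀ᵐ P : ℝ, P ≠ 1 := by simp [ae_iff, measure_singleton]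
      filter_upwards [this] with P hP1 hP
      rw [uIoc_of_le zero_le_one] at hP
      have hP' : P < 1 := lt_of_le_of_ne hP.2 hP1
      have h1 : Tendsto (fun a : ℝ => P ^ (1/(a-1))) (𝓝[>] 1) (𝓝 0) := by
        refine (tendsto_rpow_atTop_of_base_lt_one P (by linarith [hP.1]) hP').comp ?_
        simp only [one_div]
        refine tendsto_inv_nhdsGT_zero.comp ?_
        refine tendsto_nhdsWithin_iff.mpr ⟨?_, ?_⟩
        · have : Tendsto (fun a : ℝ => a - 1) (𝓝 1) (𝓝 (1-1)) := (continuous_id.sub continuous_const).tendsto 1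
          rw [sub_self] at this
          exact this.mono_left nhdsWithin_le_nhds
        · filter_upwards [self_mem_nhdsWithin] with a ha
          exact sub_pos.mpr (show (1:ℝ) < a from ha)
      have h2 := ((hc.comp Real.continuous_sqrt).tendsto (1-0)).comp (h1.const_sub 1)
      simpa [Function.comp_def] using h2
  simp only [intervalIntegral.integral_const, sub_zero, one_smul] at h
  refine h.congr' ?_
  filter_upwards [self_mem_nhdsWithin] with a ha
  exact (polar_P ha hw).symm

end HC
namespace HC
open Set Filter Topology

lemma ci_cont {w : ℂ → ℝ} (hw : Continuous w) (R : ℝ) : CircleIntegrable w 0 R :=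
  hw.continuousOn.circleIntegrable'

lemma cA_mono {w v : ℂ → ℝ} (hw : Continuous w) (hv : Continuous v) (h : ∀ z, w z ≤ v z) (R : ℝ) :
    Real.circleAverage w 0 R ≤ Real.circleAverage v 0 R :=
  Real.circleAverage_mono (ci_cont hw R) (ci_cont hv R) fun z _ => h z

lemma cA_scale (w : ℂ → ℝ) (c R : ℝ) :
    Real.circleAverage (fun z => w ((c:ℂ)*z)) 0 R = Real.circleAverage w 0 (c*R) := by
  rw [Real.circleAverage_eq_circleAverage_zero_one, Real.circleAverage_eq_circleAverage_zero_one (f := w)]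
  congr 1; ext z; congr 1; push_cast; ring

lemma cmono_eps {f : Polynomial ℂ} {ε : ℝ} {V} (h : Jet f ε V) (hε : 0 < ε) {s : ℝ} (hs : 0 ≤ s) :
    MonotoneOn (Real.circleAverage (fun z => (ev V z)^s) 0) (Icc 0 1) := by
  intro x hx y hy hxy
  have c := continuous_pw (h.pos hε) s
  have key : ∀ ρ : ℝ, Tendsto (fun a : ℝ => ∫ z : ℂ, (ev V (ρ*z))^s ∂(bergmanMeasure a)) (𝓝[>] 1)
      (𝓝 (Real.circleAverage (fun z => (ev V z)^s) 0 ρ)) := by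
    intro ρ
    have := lim_one (w := fun z : ℂ => (ev V (ρ*z))^s) (c.comp (by fun_prop : Continuous fun z : ℂ => (ρ:ℂ)*z))
    rwa [cA_scale (fun z => (ev V z)^s), mul_one] at this
  refine le_of_tendsto_of_tendsto (key x) (key y) ?_
  filter_upwards [self_mem_nhdsWithin] with a ha
  exact dil_mono h hε ha hs hx hy hxy

lemma V_ge {f : Polynomial ℂ} {ε : ℝ} {V} (h : Jet f ε V) (hε : 0 < ε) {s : ℝ} (hs : 0 ≤ s) (z : ℂ) :
    ‖f.eval z‖^(2*s) ≤ (ev V z)^s := by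
  rw [h.val, Real.rpow_mul (norm_nonneg _)]
  refine Real.rpow_le_rpow (by positivity) ?_ hs
  rw [Real.rpow_two]
  linarith

lemma V_le {f : Polynomial ℂ} {ε : ℝ} {V} (h : Jet f ε V) (hε : 0 < ε) {s : ℝ} (hs : 0 ≤ s) (hs1 : s ≤ 1) (z : ℂ) :
    (ev V z)^s ≤ ‖f.eval z‖^(2*s) + ε^s := by
  rw [h.val, Real.rpow_mul (norm_nonneg _)]
  rw [Real.rpow_two]
  exact Real.rpow_add_le_add_rpow (by positivity) hε.le hs hs1

/-- monotonicity of circle means -/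
lemma cmono (f : Polynomial ℂ) {s : ℝ} (hs : 0 < s) (hs2 : s ≤ 2) :
    MonotoneOn (Real.circleAverage (fun z => ‖f.eval z‖^s) 0) (Icc 0 1) := by
  intro x hx y hy hxy
  have c := cont_npow1 f hs
  have := eps_lim (X := Real.circleAverage (fun z => ‖f.eval z‖^s) 0 x)
    (c := Real.circleAverage (fun z => ‖f.eval z‖^s) 0 y) (s := s/2) (by positivity) 1 zero_le_one
    (Real.circleAverage_nonneg_of_nonneg fun z _ => by positivity) ?_
  · rwa [Real.rpow_one] at this
  intro ε hε
  obtain ⟨V, h⟩ := exists_jet f ε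
  have cV := continuous_pw (h.pos hε) (s/2)
  rw [Real.rpow_one]
  have e : 2*(s/2) = s := by ring
  calc _ ≤ Real.circleAverage (fun z => (ev V z)^(s/2)) 0 x := cA_mono c cV (fun z => by
          have := V_ge h hε (s := s/2) (by positivity) z; rwa [e] at this) x
    _ ≤ Real.circleAverage (fun z => (ev V z)^(s/2)) 0 y := cmono_eps h hε (by positivity) hx hy hxy
    _ ≤ Real.circleAverage (fun z => ‖f.eval z‖^s + ε^(s/2)) 0 y := cA_mono cV (by fun_prop) (fun z => by
          have := V_le h hε (s := s/2) (by positivity) (by linarith) z; rwa [e] at this) y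
    _ = _ := by
      rw [Real.circleAverage_fun_add (ci_cont c y) (ci_cont continuous_const y), Real.circleAverage_const]

/-- circle version of thmB -/
lemma circ_B {s : ℝ} (hs : 0 < s) (hs1 : s < 1) (f : Polynomial ℂ) :
    Real.circleAverage (fun z => ‖f.eval z‖^(2:ℝ)) 0 √s ≤
      (Real.circleAverage (fun z => ‖f.eval z‖^(2*s)) 0 1)^(1/s) := by
  have h1 := lim_one (w := fun z : ℂ => ‖f.eval ((√s:ℝ)*z)‖^(2:ℝ)) (cont_npow f two_pos _)
  rw [cA_scale (fun z => ‖f.eval z‖^(2:ℝ)), mul_one] at h1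
  have h2 := (lim_one (w := fun z : ℂ => ‖f.eval z‖^(2*s)) (cont_npow1 f (by positivity))).rpow_const
    (p := 1/s) (Or.inr (by positivity))
  refine le_of_tendsto_of_tendsto h1 h2 ?_
  filter_upwards [self_mem_nhdsWithin] with a ha
  have := thmB hs hs1 f.natDegree f le_rfl a ha
  simpa using this

lemma poly_approx {h : ℂ → ℂ} {R : ℝ} (hR : 1 < R) (hh : DifferentiableOn ℂ h (ball 0 R)) :
    ∃ P : ℕ → Polynomial ℂ, TendstoUniformlyOn (fun n z => (P n).eval z) h atTop (closedBall 0 1) := by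
  obtain ⟨R', h1, h2⟩ := exists_between hR
  lift R' to NNReal using by linarith
  have hd : DifferentiableOn ℂ h (closedBall 0 R') := hh.mono (closedBall_subset_ball h2)
  have hps := hd.hasFPowerSeriesOnBall (by exact_mod_cast (by linarith : (0:ℝ) < R'))
  obtain ⟨R'', h3, h4⟩ := exists_between h1
  lift R'' to NNReal using by linarith
  have hu := hps.tendstoUniformlyOn' (r' := R'') (by exact_mod_cast h4)
  refine ⟨fun n => ∑ k ∈ Finset.range n, Polynomial.C ((cauchyPowerSeries h 0 R').coeff k) * Polynomial.X^k, ?_⟩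
  refine (hu.mono (closedBall_subset_ball h3)).congr ?_
  refine Eventually.of_forall fun n z hz => ?_
  simp only [FormalMultilinearSeries.partialSum, Polynomial.eval_finsetSum, Polynomial.eval_mul,
    Polynomial.eval_C, Polynomial.eval_pow, Polynomial.eval_X, FormalMultilinearSeries.apply_eq_pow_smul_coeff,
    smul_eq_mul]
  exact Finset.sum_congr rfl fun k _ => by rw [sub_zero, mul_comm]

lemma avg_lim {F : ℕ → ℂ → ℂ} {G : ℂ → ℂ} (hF : ∀ n, Continuous (F n)) (hG : ContinuousOn G (closedBall 0 1))
    (hu : TendstoUniformlyOn F G atTop (closedBall 0 1)) {s ρ : ℝ} (hs : 0 < s) (h0 : 0 ≤ ρ) (h1 : ρ ≤ 1) :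
    Tendsto (fun n => Real.circleAverage (fun z => ‖F n z‖^s) 0 ρ) atTop
      (𝓝 (Real.circleAverage (fun z => ‖G z‖^s) 0 ρ)) := by
  obtain ⟨K, hK⟩ := (isCompact_closedBall (0:ℂ) 1).exists_bound_of_continuousOn hG
  have hm : ∀ θ, circleMap 0 ρ θ ∈ closedBall (0:ℂ) 1 := fun θ => by simp [abs_of_nonneg h0, h1]
  unfold Real.circleAverage
  refine Tendsto.const_smul ?_ _
  refine intervalIntegral.tendsto_integral_filter_of_dominated_convergence (fun _ => (K+1)^s) ?_ ?_ ?_ ?_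
  · refine Eventually.of_forall fun n => Continuous.aestronglyMeasurable ?_
    exact ((hF n).comp (by fun_prop)).norm.rpow_const fun _ => Or.inr hs.le
  · filter_upwards [Metric.tendstoUniformlyOn_iff.mp hu 1 one_pos] with n hn
    refine ae_of_all _ fun θ _ => ?_
    rw [Real.norm_of_nonneg (by positivity)]
    refine Real.rpow_le_rpow (norm_nonneg _) ?_ hs.le
    have a := hn _ (hm θ)
    have b := hK _ (hm θ)
    rw [dist_comm, dist_eq_norm] at a
    have := norm_le_norm_add_norm_sub' (F n (circleMap 0 ρ θ)) (G (circleMap 0 ρ θ))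
    linarith
  · exact intervalIntegrable_const
  · refine ae_of_all _ fun θ _ => ?_
    exact (hu.tendsto_at (hm θ)).norm.rpow_const (Or.inr hs.le)

lemma circ_B_hol {s : ℝ} (hs : 0 < s) (hs1 : s < 1) {h : ℂ → ℂ} {R : ℝ} (hR : 1 < R)
    (hh : DifferentiableOn ℂ h (ball 0 R)) :
    Real.circleAverage (fun z => ‖h z‖^(2:ℝ)) 0 √s ≤
      (Real.circleAverage (fun z => ‖h z‖^(2*s)) 0 1)^(1/s) := by
  obtain ⟨P, hP⟩ := poly_approx hR hh
  have hc : ContinuousOn h (closedBall 0 1) := hh.continuousOn.mono (closedBall_subset_ball hR)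
  have hF : ∀ n, Continuous fun z => (P n).eval z := fun n => by fun_prop
  have l1 := avg_lim hF hc hP (s := 2) two_pos (Real.sqrt_nonneg s) (Real.sqrt_le_one.2 hs1.le)
  have l2 := (avg_lim hF hc hP (s := 2*s) (by positivity) zero_le_one le_rfl).rpow_const (p := 1/s) (Or.inr (by positivity))
  exact le_of_tendsto_of_tendsto' l1 l2 fun n => circ_B hs hs1 (P n)

def Out (F : ℂ → ℂ) (τ : ℝ) : Prop := ∃ R : ℝ, 1 < R ∧ ∃ h : ℂ → ℂ, DifferentiableOn ℂ h (ball 0 R) ∧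
  (∀ z, ‖z‖ = 1 → ‖h z‖ = ‖F z‖^τ) ∧ (∀ z, ‖z‖ ≤ 1 → ‖F z‖^τ ≤ ‖h z‖)

lemma out_fac {τ : ℝ} (hτ : 0 < τ) (F : ℂ → ℂ) (b : ℂ) (hb : ‖b‖ < 1) (c : ℝ) (hc : 0 ≤ c)
    (h1 : ∀ z, ‖z‖ = 1 → c * ‖1 - b*z‖ = ‖F z‖) (h2 : ∀ z, ‖z‖ ≤ 1 → ‖F z‖ ≤ c * ‖1 - b*z‖) : Out F τ := by
  have hn : ∀ z, ‖((c^τ : ℝ):ℂ) * (1 - b*z)^(τ:ℂ)‖ = (c * ‖1 - b*z‖)^τ := fun z => by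
    rw [norm_mul, Complex.norm_cpow_real, Complex.norm_real, Real.norm_of_nonneg (by positivity),
      Real.mul_rpow hc (norm_nonneg _)]
  refine ⟨2/(1+‖b‖), ?_, fun z => ((c^τ : ℝ):ℂ) * (1 - b*z)^(τ:ℂ), ?_, ?_, ?_⟩
  · rw [lt_div_iff₀ (by positivity)]; linarith
  · intro z hz
    have hz : ‖z‖ < 2/(1+‖b‖) := by simpa using hz
    have hbz : ‖b*z‖ < 1 := by
      rw [norm_mul]
      rw [lt_div_iff₀ (by positivity)] at hz
      nlinarith [norm_nonneg z, norm_nonneg b, mul_nonneg (norm_nonneg z) (norm_nonneg b)]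
    have : (1 - b*z) ∈ Complex.slitPlane := by
      left
      have := (Complex.abs_re_le_norm (b*z)).trans_lt hbz
      rw [abs_lt] at this
      simp only [Complex.sub_re, Complex.one_re]; linarith [this.2]
    refine DifferentiableAt.differentiableWithinAt ?_
    refine DifferentiableAt.const_mul ?_ _
    exact DifferentiableAt.cpow_const (by fun_prop) this
  · intro z hz; rw [hn, h1 z hz]
  · intro z hz; rw [hn]; exact Real.rpow_le_rpow (norm_nonneg _) (h2 z hz) hτ.le

lemma out_lin {τ : ℝ} (hτ : 0 < τ) (a : ℂ) (ha : ‖a‖ ≠ 1) : Out (fun z => z - a) τ := by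
  rcases lt_or_gt_of_ne ha with h | h
  · have key : ∀ z : ℂ, ‖1 - (starRingEnd ℂ) a * z‖^2 - ‖z - a‖^2 = (1 - ‖z‖^2)*(1-‖a‖^2) := fun z => by
      simp only [← Complex.normSq_eq_norm_sq, Complex.normSq_apply]
      simp; ring
    refine out_fac hτ _ ((starRingEnd ℂ) a) (by simpa using h) 1 zero_le_one ?_ ?_
    · intro z hz
      have := key z
      rw [hz] at this
      rw [one_mul, ← sq_eq_sq₀ (norm_nonneg _) (norm_nonneg _)]
      linarith
    · intro z hz
      have := key z
      rw [one_mul, ← sq_le_sq₀ (norm_nonneg _) (norm_nonneg _)]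
      have : 0 ≤ (1 - ‖z‖^2)*(1-‖a‖^2) := mul_nonneg (by nlinarith [norm_nonneg z]) (by nlinarith [norm_nonneg a])
      linarith
  · have ha0 : a ≠ 0 := by rintro rfl; simp at h; linarith
    have e : ∀ z, ‖a‖ * ‖1 - a⁻¹*z‖ = ‖z - a‖ := fun z => by
      rw [← norm_mul, norm_sub_rev z a]; congr 1; field_simp
    exact out_fac hτ _ a⁻¹ (by rw [norm_inv]; exact inv_lt_one_of_one_lt₀ h) ‖a‖ (norm_nonneg _)
      (fun z _ => e z) (fun z _ => (e z).ge)

lemma Out.mul {F G : ℂ → ℂ} {τ : ℝ} (hF : Out F τ) (hG : Out G τ) : Out (fun z => F z * G z) τ := by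
  obtain ⟨R, hR, h, a1, a2, a3⟩ := hF
  obtain ⟨S, hS, g, b1, b2, b3⟩ := hG
  refine ⟨min R S, lt_min hR hS, fun z => h z * g z, ?_, ?_, ?_⟩
  · exact (a1.mono (ball_subset_ball (min_le_left _ _))).mul (b1.mono (ball_subset_ball (min_le_right _ _)))
  · intro z hz; rw [norm_mul, norm_mul, a2 z hz, b2 z hz, Real.mul_rpow (norm_nonneg _) (norm_nonneg _)]
  · intro z hz; rw [norm_mul, norm_mul, Real.mul_rpow (norm_nonneg _) (norm_nonneg _)]
    exact mul_le_mul (a3 z hz) (b3 z hz) (by positivity) (norm_nonneg _)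

lemma out_poly {τ : ℝ} (hτ : 0 < τ) (f : Polynomial ℂ) (hf : ∀ a ∈ f.roots, ‖a‖ ≠ 1) : Out (fun z => f.eval z) τ := by
  have hs := (IsAlgClosed.splits f).eq_prod_roots
  have key : ∀ m : Multiset ℂ, (∀ a ∈ m, ‖a‖ ≠ 1) →
      Out (fun z => ((m.map fun a => Polynomial.X - Polynomial.C a).prod).eval z) τ := by
    intro m
    induction m using Multiset.induction_on with
    | empty => intro _; exact ⟨2, one_lt_two, fun _ => 1, differentiableOn_const _, by simp, by simp⟩
    | cons a m ih =>
      intro h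
      have := (out_lin hτ a (h a (by simp))).mul (ih fun b hb => h b (by simp [hb]))
      simpa using this
  have h0 : Out (fun _ => f.leadingCoeff) τ := by
    refine ⟨2, one_lt_two, fun _ => ((‖f.leadingCoeff‖^τ : ℝ):ℂ), differentiableOn_const _, ?_, ?_⟩
    · intro z _; rw [Complex.norm_real, Real.norm_of_nonneg (by positivity)]
    · intro z _; rw [Complex.norm_real, Real.norm_of_nonneg (by positivity)]
  have := h0.mul (key f.roots hf)
  rw [hs]
  simpa using this

lemma circ_nz {p q : ℝ} (hp : 0 < p) (hpq : p < q) (f : Polynomial ℂ) (hf : ∀ a ∈ f.roots, ‖a‖ ≠ 1) :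
    Real.circleAverage (fun z => ‖f.eval z‖^q) 0 √(p/q) ≤
      (Real.circleAverage (fun z => ‖f.eval z‖^p) 0 1)^(q/p) := by
  have hq : 0 < q := hp.trans hpq
  have hs1 : p/q < 1 := (div_lt_one hq).2 hpq
  have hsq : √(p/q) ≤ 1 := Real.sqrt_le_one.2 hs1.le
  obtain ⟨R, hR, h, a1, a2, a3⟩ := out_poly (τ := q/2) (by positivity) f hf
  have key := circ_B_hol (s := p/q) (by positivity) hs1 hR a1
  have e1 : Real.circleAverage (fun z => ‖h z‖^(2*(p/q))) 0 1 = Real.circleAverage (fun z => ‖f.eval z‖^p) 0 1 := by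
    refine Real.circleAverage_congr_sphere fun z hz => ?_
    have hz : ‖z‖ = 1 := by simpa using hz
    simp only [a2 z hz]
    rw [← Real.rpow_mul (norm_nonneg _)]; congr 1; field_simp
  rw [e1, one_div_div] at key
  refine le_trans ?_ key
  have hmem : ∀ z ∈ sphere (0:ℂ) |√(p/q)|, ‖z‖ ≤ 1 := fun z hz => by
    have : ‖z‖ = √(p/q) := by simpa [abs_of_nonneg (Real.sqrt_nonneg _)] using hz
    rw [this]; exact hsq
  refine Real.circleAverage_mono (ci_cont (cont_npow1 f hq) _) ?_ ?_
  · refine ContinuousOn.circleIntegrable' ?_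
    refine ContinuousOn.rpow_const ?_ fun _ _ => Or.inr zero_le_two
    refine (a1.continuousOn.mono ?_).norm
    intro z hz
    have := hmem z hz
    simp; linarith
  · intro z hz
    have := a3 z (hmem z hz)
    have h2 : (‖f.eval z‖^(q/2))^(2:ℝ) ≤ ‖h z‖^(2:ℝ) := Real.rpow_le_rpow (by positivity) this zero_le_two
    rw [← Real.rpow_mul (norm_nonneg _)] at h2
    convert h2 using 2; ring

theorem circ_hyper {p q : ℝ} (hp : 0 < p) (hpq : p < q) (f : Polynomial ℂ) {t : ℝ} (ht : 0 ≤ t) :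
    Real.circleAverage (fun z => ‖f.eval z‖^q) 0 √(t*(p/q)) ≤
      (Real.circleAverage (fun z => ‖f.eval z‖^p) 0 √t)^(q/p) := by
  have hq : 0 < q := hp.trans hpq
  have main : ∀ g : Polynomial ℂ, Real.circleAverage (fun z => ‖g.eval z‖^q) 0 √(p/q) ≤
      (Real.circleAverage (fun z => ‖g.eval z‖^p) 0 1)^(q/p) := by
    intro g
    by_cases hg : g = 0
    · exact circ_nz hp hpq g (by simp [hg])
    have hev : ∀ᶠ ρ : ℝ in 𝓝[<] 1, (0 < ρ) ∧ ∀ a ∈ g.roots.toFinset, ‖a‖ ≠ ρ := by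
      have h0 : ∀ᶠ ρ : ℝ in 𝓝[<] 1, 0 < ρ := nhdsWithin_le_nhds (lt_mem_nhds one_pos)
      have h1 : ∀ᶠ ρ : ℝ in 𝓝[<] 1, ∀ a ∈ g.roots.toFinset, ‖a‖ ≠ ρ := by
        rw [Filter.eventually_all_finset]
        intro a _
        by_cases h : ‖a‖ = 1
        · filter_upwards [self_mem_nhdsWithin] with ρ hρ
          rw [h]; exact (show ρ < 1 from hρ).ne'
        · exact nhdsWithin_le_nhds ((isOpen_ne (x := ‖a‖)).eventually_mem (fun h' : (1:ℝ) = ‖a‖ => h h'.symm) |>.mono fun ρ h => Ne.symm h)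
      exact h0.and h1
    have c1 : Tendsto (fun ρ : ℝ => Real.circleAverage (fun z => ‖g.eval z‖^q) 0 (ρ*√(p/q))) (𝓝[<] 1)
        (𝓝 (Real.circleAverage (fun z => ‖g.eval z‖^q) 0 √(p/q))) := by
      have : Continuous (fun ρ : ℝ => Real.circleAverage (fun z => ‖g.eval z‖^q) 0 (ρ*√(p/q))) :=
        (cca (cont_npow1 g hq)).comp (by fun_prop)
      have := this.tendsto 1
      simp only [one_mul] at this
      exact this.mono_left nhdsWithin_le_nhds
    have c2 : Tendsto (fun ρ : ℝ => (Real.circleAverage (fun z => ‖g.eval z‖^p) 0 ρ)^(q/p)) (𝓝[<] 1)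
        (𝓝 ((Real.circleAverage (fun z => ‖g.eval z‖^p) 0 1)^(q/p))) :=
      (((cca (cont_npow1 g hp)).tendsto 1).mono_left nhdsWithin_le_nhds).rpow_const (Or.inr (by positivity))
    refine le_of_tendsto_of_tendsto c1 c2 ?_
    filter_upwards [hev] with ρ ⟨hρ, hr⟩
    have := circ_nz hp hpq (g.comp (Polynomial.C (ρ:ℂ) * Polynomial.X)) ?_
    · simp only [Polynomial.eval_comp, Polynomial.eval_mul, Polynomial.eval_C, Polynomial.eval_X] at this
      rw [cA_scale (fun z => ‖g.eval z‖^q), cA_scale (fun z => ‖g.eval z‖^p), mul_one] at this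
      exact this
    · intro a ha h1
      have hroot := Polynomial.isRoot_of_mem_roots ha
      rw [Polynomial.IsRoot.def] at hroot
      simp only [Polynomial.eval_comp, Polynomial.eval_mul, Polynomial.eval_C, Polynomial.eval_X] at hroot
      refine hr ((ρ:ℂ)*a) ?_ ?_
      · rw [Multiset.mem_toFinset, Polynomial.mem_roots hg]; exact hroot
      · rw [norm_mul, h1, mul_one, Complex.norm_real, Real.norm_of_nonneg hρ.le]
  have := main (f.comp (Polynomial.C ((√t:ℝ):ℂ) * Polynomial.X))
  simp only [Polynomial.eval_comp, Polynomial.eval_mul, Polynomial.eval_C, Polynomial.eval_X] at this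
  rw [cA_scale (fun z => ‖f.eval z‖^q), cA_scale (fun z => ‖f.eval z‖^p), mul_one, ← Real.sqrt_mul ht] at this
  exact this

end HC
namespace HC
open Set Filter Topology

lemma anti_pow {n : ℝ → ℝ} (hn : Continuous n) (h0 : ∀ w, 0 ≤ n w) (ha : AntitoneOn n (Icc 0 1)) {k : ℝ} (hk : 1 < k) :
    ∫ P in (0:ℝ)..1, (n (P^(1/k)))^k ≤ (∫ w in (0:ℝ)..1, n w)^k := by
  have hk0 : 0 < k := by linarith
  have hm : Continuous fun P : ℝ => (n (P^(1/k)))^k :=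
    (hn.comp (Real.continuous_rpow_const (by positivity))).rpow_const fun _ => Or.inr hk0.le
  have dI : ∀ w, HasDerivAt (fun x => ∫ w in (0:ℝ)..x, n w) (n w) w := fun w =>
    intervalIntegral.integral_hasDerivAt_right (hn.intervalIntegrable _ _) (hn.stronglyMeasurableAtFilter _ _) hn.continuousAt
  have dJ : ∀ w, HasDerivAt (fun x => ∫ P in (0:ℝ)..x, (n (P^(1/k)))^k) ((n (w^(1/k)))^k) w := fun w =>
    intervalIntegral.integral_hasDerivAt_right (hm.intervalIntegrable _ _) (hm.stronglyMeasurableAtFilter _ _) hm.continuousAt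
  have hIge : ∀ w ∈ Icc (0:ℝ) 1, w * n w ≤ ∫ x in (0:ℝ)..w, n x := by
    intro w hw
    have : ∫ x in (0:ℝ)..w, n w ≤ ∫ x in (0:ℝ)..w, n x := by
      refine intervalIntegral.integral_mono_on hw.1 intervalIntegrable_const (hn.intervalIntegrable _ _) ?_
      intro x hx
      exact ha ⟨hx.1, hx.2.trans hw.2⟩ hw hx.2
    simpa using this
  set I : ℝ → ℝ := fun x => ∫ w in (0:ℝ)..x, n w with hI
  set J : ℝ → ℝ := fun x => ∫ P in (0:ℝ)..x, (n (P^(1/k)))^k with hJ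
  have hd : ∀ w, 0 < w → HasDerivAt (fun w => (I w)^k - J (w^k))
      (n w * k * (I w)^(k-1) - (n ((w^k)^(1/k)))^k * (k * w^(k-1))) w := by
    intro w hw
    refine HasDerivAt.fun_sub ((dI w).rpow_const (Or.inr hk.le)) ?_
    exact HasDerivAt.comp w (dJ (w^k)) (Real.hasDerivAt_rpow_const (Or.inl hw.ne'))
  have hc : Continuous (fun w => (I w)^k - J (w^k)) := by
    have cI : Continuous I := continuous_iff_continuousAt.2 fun w => (dI w).continuousAt
    have cJ : Continuous J := continuous_iff_continuousAt.2 fun w => (dJ w).continuousAt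
    exact (cI.rpow_const fun _ => Or.inr hk0.le).sub (cJ.comp (Real.continuous_rpow_const hk0.le))
  have mono : MonotoneOn (fun w => (I w)^k - J (w^k)) (Icc 0 1) := by
    refine monotoneOn_of_deriv_nonneg (convex_Icc 0 1) hc.continuousOn ?_ ?_
    · intro x hx
      rw [interior_Icc] at hx
      exact (hd x hx.1).differentiableAt.differentiableWithinAt
    · intro w hw
      rw [interior_Icc] at hw
      rw [(hd w hw.1).deriv, ← Real.rpow_mul hw.1.le, mul_one_div_cancel hk0.ne', Real.rpow_one]
      have h1 := hIge w ⟨hw.1.le, hw.2.le⟩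
      have h2 : (w * n w)^(k-1) ≤ (I w)^(k-1) := Real.rpow_le_rpow (mul_nonneg hw.1.le (h0 w)) h1 (by linarith)
      rw [Real.mul_rpow hw.1.le (h0 w)] at h2
      have h3 : (n w)^k = n w * (n w)^(k-1) := by
        rcases (h0 w).eq_or_lt with h | h
        · rw [← h, Real.zero_rpow hk0.ne', zero_mul]
        · rw [mul_comm, ← Real.rpow_add_one h.ne', sub_add_cancel]
      rw [h3]
      have := mul_le_mul_of_nonneg_left h2 (mul_nonneg (h0 w) hk0.le)
      linarith
  have := mono (by simp : (0:ℝ) ∈ Icc (0:ℝ) 1) (by simp : (1:ℝ) ∈ Icc (0:ℝ) 1) zero_le_one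
  simp only [hI, hJ, Real.zero_rpow hk0.ne', intervalIntegral.integral_same, Real.one_rpow, sub_zero] at this
  linarith

lemma nn_cont (w : ℂ → ℝ) (hw : Continuous w) {b : ℝ} (hb : 0 < b) :
    Continuous fun P : ℝ => Real.circleAverage w 0 √(1 - P^(1/b)) := by
  refine (cca hw).comp (Real.continuous_sqrt.comp (continuous_const.sub ?_))
  exact Real.continuous_rpow_const (by positivity)

lemma tP_mem {b P : ℝ} (hb : 0 < b) (hP : P ∈ Icc (0:ℝ) 1) : 0 ≤ 1 - P^(1/b) ∧ 1 - P^(1/b) ≤ 1 := by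
  have h1 := Real.rpow_le_one hP.1 hP.2 (by positivity : 0 ≤ 1/b)
  have h2 := Real.rpow_nonneg hP.1 (1/b)
  constructor <;> linarith

lemma sq_mem {x : ℝ} (h1 : x ≤ 1) : √x ∈ Icc (0:ℝ) 1 := ⟨Real.sqrt_nonneg _, Real.sqrt_le_one.2 h1⟩

lemma goodD1 {α p q : ℝ} (hα : 1 < α) (hp : 0 < p) (hpq : p < q) (hq2 : q < 2) (hk : q/p*(α-1) ≤ 1) :
    Good α p q √((α-1)/(q/p*α-1)) := by
  intro f
  have hq : 0 < q := hp.trans hpq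
  set b := α - 1 with hb'
  set k := q/p with hk'
  have hb : 0 < b := by linarith
  have hk1 : 1 < k := (one_lt_div hp).2 hpq
  have hk0 : 0 < k := by linarith
  have hpk : p/q = 1/k := by rw [hk', one_div_div]
  have hden : 0 < k*α-1 := by nlinarith
  have hr : b/(k*α-1) ≤ 1/k*(1/k) := by
    rw [div_le_iff₀ hden]
    have : α = b + 1 := by rw [hb']; ring
    rw [this]
    have e : 1/k*(1/k)*(k*(b+1)-1) - b = (k-1)*(1-k*b)/(k*k) := by field_simp; ring
    have : 0 ≤ (k-1)*(1-k*b)/(k*k) := div_nonneg (mul_nonneg (by linarith) (by linarith)) (by positivity)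
    linarith
  rw [polar_P hα (cont_npow f hq _), polar_P hα (cont_npow1 f hp)]
  simp only [cA_scale (fun z => ‖f.eval z‖^q)]
  rw [← hb']
  have hcq := cont_npow1 f hq
  have hcp := cont_npow1 f hp
  have hn := nn_cont _ hcp hb
  have h0 : ∀ ρ, 0 ≤ Real.circleAverage (fun z => ‖f.eval z‖^p) 0 ρ := fun ρ =>
    Real.circleAverage_nonneg_of_nonneg fun z _ => by positivity
  have mp := cmono f hp (by linarith)
  have mq := cmono f hq hq2.le
  have key := anti_pow hn (fun w => h0 _) ?_ hk1
  · refine le_trans ?_ key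
    refine intervalIntegral.integral_mono_on zero_le_one ?_ ?_ ?_
    · refine Continuous.intervalIntegrable ?_ _ _
      refine (cca hcq).comp (continuous_const.mul (Real.continuous_sqrt.comp (continuous_const.sub ?_)))
      exact Real.continuous_rpow_const (by positivity)
    · refine Continuous.intervalIntegrable ?_ _ _
      exact (hn.comp (Real.continuous_rpow_const (by positivity : 0 ≤ 1/k))).rpow_const fun _ => Or.inr hk0.le
    intro P hP
    obtain ⟨t0, t1⟩ := tP_mem hb hP
    set t := 1 - P^(1/b) with ht
    have hk11 : 1/k ≤ 1 := (div_le_one hk0).2 hk1.le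
    have htk : t*(1/k) ≤ 1 := by nlinarith [mul_nonneg t0 (by positivity : 0 ≤ 1/k)]
    have htk0 : 0 ≤ t*(1/k) := by positivity
    have hP' : P^(1/k) ∈ Icc (0:ℝ) 1 := ⟨Real.rpow_nonneg hP.1 _, Real.rpow_le_one hP.1 hP.2 (by positivity)⟩
    have hB : t*(1/k) ≤ 1 - (P^(1/k))^(1/b) := by
      have := rpow_one_add_le_one_add_mul_self (s := -t) (by linarith) (p := 1/k) (by positivity) hk11
      rw [show 1 + -t = P^(1/b) by rw [ht]; ring, ← Real.rpow_mul hP.1] at this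
      rw [← Real.rpow_mul hP.1, mul_comm (1/k) (1/b)]
      linarith
    rw [← Real.sqrt_mul (by positivity)]
    calc Real.circleAverage (fun z => ‖f.eval z‖^q) 0 √(b/(k*α-1)*t)
        ≤ Real.circleAverage (fun z => ‖f.eval z‖^q) 0 √(t*(1/k)*(p/q)) := by
          have hle : b/(k*α-1)*t ≤ t*(1/k)*(p/q) := by
            rw [hpk]; nlinarith [mul_le_mul_of_nonneg_right hr t0]
          have h1 : t*(1/k)*(p/q) ≤ 1 := by rw [hpk]; nlinarith [mul_nonneg t0 (by positivity : 0 ≤ 1/k)]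
          exact mq (sq_mem (hle.trans h1)) (sq_mem h1) (Real.sqrt_le_sqrt hle)
      _ ≤ (Real.circleAverage (fun z => ‖f.eval z‖^p) 0 √(t*(1/k)))^(q/p) := circ_hyper hp hpq f htk0
      _ ≤ _ := by
        refine Real.rpow_le_rpow (h0 _) ?_ hk0.le
        exact mp (sq_mem htk) (sq_mem (tP_mem hb hP').2) (Real.sqrt_le_sqrt hB)
  · intro x hx y hy hxy
    refine mp (sq_mem (tP_mem hb hy).2) (sq_mem (tP_mem hb hx).2) (Real.sqrt_le_sqrt ?_)
    have := Real.rpow_le_rpow hx.1 hxy (by positivity : 0 ≤ 1/b)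
    linarith

lemma K_mono {A : ℝ} (hA : 2 < A) {L : ℂ → ℝ} (hL : Continuous L) (h0 : ∀ z, 0 ≤ L z) {x y : ℝ} (hx : 0 < x) (hxy : x ≤ y) :
    x^2 * ∫ z : ℂ, L ((x:ℂ)*z) ∂(bergmanMeasure A) ≤ y^2 * ∫ z : ℂ, L ((y:ℂ)*z) ∂(bergmanMeasure A) := by
  set C : ℝ → ℝ := Real.circleAverage L 0 with hC
  have cC : Continuous C := cca hL
  have C0 : ∀ u, 0 ≤ C u := fun u => Real.circleAverage_nonneg_of_nonneg fun z _ => h0 z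
  set F : ℝ → ℝ → ℝ := fun ρ u => 2*(A-1)*u*(1-(u/ρ)^2)^(A-1-1) * C u with hF
  have cF : ∀ ρ, Continuous (F ρ) := by
    intro ρ
    refine Continuous.mul (Continuous.mul (by fun_prop) ?_) cC
    exact Continuous.rpow_const (by fun_prop) fun _ => Or.inr (by linarith)
  have key : ∀ ρ : ℝ, 0 < ρ → ρ^2 * ∫ z : ℂ, L ((ρ:ℂ)*z) ∂(bergmanMeasure A) = ∫ u in (0:ℝ)..ρ, F ρ u := by
    intro ρ hρ
    rw [(polar_avg (α := A) (w := fun z : ℂ => L ((ρ:ℂ)*z)) (by linarith) (hL.comp (by fun_prop : Continuous fun z : ℂ => (ρ:ℂ)*z))).2]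
    have := intervalIntegral.integral_comp_mul_left (a := 0) (b := 1) (F ρ) hρ.ne'
    rw [mul_zero, mul_one, smul_eq_mul, eq_inv_mul_iff_mul_eq₀ hρ.ne'] at this
    rw [← this, pow_two, mul_assoc]
    congr 1
    rw [← intervalIntegral.integral_const_mul]
    refine intervalIntegral.integral_congr fun u _ => ?_
    have e := cA_scale L ρ u
    simp only [hF, e, hC, mul_div_cancel_left₀ u hρ.ne']
    ring
  rw [key x hx, key y (hx.trans_le hxy)]
  have hy : 0 < y := hx.trans_le hxy
  have Fn : ∀ ρ, 0 < ρ → ∀ u ∈ Icc (0:ℝ) ρ, 0 ≤ F ρ u := by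
    intro ρ hρ u hu
    have : 0 ≤ 1 - (u/ρ)^2 := by
      have h1 : u/ρ ≤ 1 := (div_le_one hρ).2 hu.2
      have h2 : 0 ≤ u/ρ := div_nonneg hu.1 hρ.le
      nlinarith
    have : 0 ≤ 2*(A-1)*u := mul_nonneg (by linarith) hu.1
    exact mul_nonneg (mul_nonneg this (by positivity)) (C0 u)
  calc ∫ u in (0:ℝ)..x, F x u ≤ ∫ u in (0:ℝ)..x, F y u := by
        refine intervalIntegral.integral_mono_on hx.le ((cF x).intervalIntegrable _ _) ((cF y).intervalIntegrable _ _) ?_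
        intro u hu
        have h1 : u/x ≤ 1 := (div_le_one hx).2 hu.2
        have h2 : 0 ≤ u/y := div_nonneg hu.1 hy.le
        have h3 : u/y ≤ u/x := div_le_div_of_nonneg_left hu.1 hx hxy
        have h4 : (1-(u/x)^2)^(A-1-1) ≤ (1-(u/y)^2)^(A-1-1) :=
          Real.rpow_le_rpow (by nlinarith) (by nlinarith) (by linarith)
        have : 0 ≤ 2*(A-1)*u := mul_nonneg (by linarith) hu.1
        exact mul_le_mul_of_nonneg_right (mul_le_mul_of_nonneg_left h4 this) (C0 u)
    _ ≤ _ := by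
      rw [← intervalIntegral.integral_add_adjacent_intervals ((cF y).intervalIntegrable 0 x) ((cF y).intervalIntegrable x y)]
      have : 0 ≤ ∫ u in x..y, F y u := intervalIntegral.integral_nonneg hxy fun u hu => Fn y hy u ⟨hx.le.trans hu.1, hu.2⟩
      linarith

lemma cconv {f : Polynomial ℂ} {ε : ℝ} {V} (h : Jet f ε V) (hε : 0 < ε) {s : ℝ} (hs : 0 ≤ s) :
    ConvexOn ℝ univ (fun x => Real.circleAverage (fun z => (ev V z)^s) 0 (Real.exp x)) := by
  have c := continuous_pw (h.pos hε) s
  have key : ∀ ρ : ℝ, Tendsto (fun a : ℝ => ∫ z : ℂ, (ev V (ρ*z))^s ∂(bergmanMeasure a)) (𝓝[>] 1)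
      (𝓝 (Real.circleAverage (fun z => (ev V z)^s) 0 ρ)) := by
    intro ρ
    have := lim_one (w := fun z : ℂ => (ev V (ρ*z))^s) (c.comp (by fun_prop : Continuous fun z : ℂ => (ρ:ℂ)*z))
    rwa [cA_scale (fun z => (ev V z)^s), mul_one] at this
  have cv : ∀ a : ℝ, 1 < a → ConvexOn ℝ univ (fun x => ∫ z : ℂ, (ev V ((Real.exp x : ℝ)*z))^s ∂(bergmanMeasure a)) := by
    intro a ha
    have hd : ∀ x, HasDerivAt (fun x => ∫ z : ℂ, (ev V ((Real.exp x : ℝ)*z))^s ∂(bergmanMeasure a))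
        ((Real.exp x/(2*a) * ∫ z, lapP f ε V s ((Real.exp x : ℝ)*z) ∂(bergmanMeasure (a+1))) * Real.exp x) x := by
      intro x
      exact HasDerivAt.comp x (dil_deriv h hε ha s (Real.exp_pos x)) (Real.hasDerivAt_exp x)
    refine Monotone.convexOn_univ_of_deriv (fun x => (hd x).differentiableAt) ?_
    intro x y hxy
    rw [(hd x).deriv, (hd y).deriv]
    have := K_mono (A := a+1) (by linarith) (continuous_lapP h hε s) (lapP_nonneg h hε hs) (Real.exp_pos x) (Real.exp_le_exp.2 hxy)
    have h2 := mul_le_mul_of_nonneg_left this (by positivity : 0 ≤ 1/(2*a))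
    convert h2 using 1 <;> ring
  refine ⟨convex_univ, ?_⟩
  intro x _ y _ A B hA hB hAB
  refine le_of_tendsto_of_tendsto (key _) (((key (Real.exp x)).const_smul A).add ((key (Real.exp y)).const_smul B)) ?_
  filter_upwards [self_mem_nhdsWithin] with a ha
  exact (cv a ha).2 (mem_univ x) (mem_univ y) hA hB hAB

lemma logint {b : ℝ} (hb : 0 < b) (hb1 : b ≤ 1) :
    Integrable (fun P : ℝ => Real.log (1 - P^(1/b))) (volume.restrict (Ioc 0 1)) ∧
    -1 ≤ ∫ P in Ioc (0:ℝ) 1, Real.log (1 - P^(1/b)) ∧ ∫ P in Ioc (0:ℝ) 1, Real.log (1 - P^(1/b)) ≤ 0 := by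
  have i0 : IntervalIntegrable (fun P : ℝ => Real.log (1 - P)) volume 0 1 := by
    have := (intervalIntegral.intervalIntegrable_log' (a := 1) (b := 0)).comp_sub_left 1
    simpa using this
  have i1 : Integrable (fun P : ℝ => Real.log (1 - P)) (volume.restrict (Ioc 0 1)) := by
    rwa [intervalIntegrable_iff_integrableOn_Ioc_of_le zero_le_one] at i0
  have v : ∫ P in Ioc (0:ℝ) 1, Real.log (1 - P) = -1 := by
    rw [← intervalIntegral.integral_of_le zero_le_one, intervalIntegral.integral_comp_sub_left (fun x => Real.log x)]
    simp
  have hne : ∀ᵐ P ∂(volume.restrict (Ioc (0:ℝ) 1)), P ∈ Ioo (0:ℝ) 1 := by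
    rw [← restrict_Ioo_eq_restrict_Ioc]; exact ae_restrict_mem measurableSet_Ioo
  have h1b : 1 ≤ 1/b := (one_le_div hb).2 hb1
  have hlo : ∀ᵐ P ∂(volume.restrict (Ioc (0:ℝ) 1)), Real.log (1 - P) ≤ Real.log (1 - P^(1/b)) := by
    filter_upwards [hne] with P hP
    refine Real.log_le_log (by linarith [hP.2]) ?_
    have := Real.rpow_le_rpow_of_exponent_ge hP.1 hP.2.le h1b
    rw [Real.rpow_one] at this
    linarith
  have hhi : ∀ᵐ P ∂(volume.restrict (Ioc (0:ℝ) 1)), Real.log (1 - P^(1/b)) ≤ 0 := by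
    filter_upwards [hne] with P hP
    have := tP_mem hb ⟨hP.1.le, hP.2.le⟩
    exact Real.log_nonpos this.1 this.2
  have i2 : Integrable (fun P : ℝ => Real.log (1 - P^(1/b))) (volume.restrict (Ioc 0 1)) := by
    refine i1.mono ?_ ?_
    · refine (Measurable.log ?_).aestronglyMeasurable
      exact measurable_const.sub (Real.continuous_rpow_const (by positivity)).measurable
    · filter_upwards [hlo, hhi] with P h1 h2
      rw [Real.norm_eq_abs, Real.norm_eq_abs, abs_of_nonpos h2, abs_of_nonpos (h1.trans h2)]
      linarith
  refine ⟨i2, ?_, ?_⟩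
  · rw [← v]; exact integral_mono_ae i1 i2 hlo
  · exact integral_nonpos_of_ae hhi

lemma small_circle {α p κ : ℝ} (hα : 1 < α) (hα2 : α ≤ 2) (hp : 0 < p) (hp2 : p ≤ 2) (hκ : 0 < κ) (hκ4 : κ ≤ 1/4)
    (f : Polynomial ℂ) :
    Real.circleAverage (fun z => ‖f.eval z‖^p) 0 √κ ≤ ∫ z, ‖f.eval z‖^p ∂(bergmanMeasure α) := by
  have := eps_lim (X := Real.circleAverage (fun z => ‖f.eval z‖^p) 0 √κ)
    (c := ∫ z, ‖f.eval z‖^p ∂(bergmanMeasure α)) (s := p/2) (by positivity) 1 zero_le_one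
    (integral_nonneg fun z => by positivity) ?_
  · rwa [Real.rpow_one] at this
  intro ε hε
  rw [Real.rpow_one]
  obtain ⟨V, h⟩ := exists_jet f ε
  have cV := continuous_pw (h.pos hε) (p/2)
  have e : 2*(p/2) = p := by ring
  have hb : 0 < α - 1 := by linarith
  set b := α - 1 with hb'
  set c := Real.circleAverage (fun z => (ev V z)^(p/2)) 0 with hc
  obtain ⟨l1, l2, l3⟩ := logint hb (by linarith)
  have hlt := eps_le h hε hα (s := p/2) (by positivity) (by linarith)
  rw [e] at hlt
  refine le_trans ?_ hlt
  have s1 : Real.circleAverage (fun z => ‖f.eval z‖^p) 0 √κ ≤ c √κ :=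
    cA_mono (cont_npow1 f hp) cV (fun z => by
          have := V_ge h hε (s := p/2) (by positivity) z; rwa [e] at this) _
  refine s1.trans ?_
  have ccont : Continuous c := cca cV
  have hJ := (cconv h hε (s := p/2) (by positivity))
  rw [← hc] at hJ
  have hprob : IsProbabilityMeasure (volume.restrict (Ioc (0:ℝ) 1)) := ⟨by simp⟩
  have hne : ∀ᵐ P ∂(volume.restrict (Ioc (0:ℝ) 1)), P ∈ Ioo (0:ℝ) 1 := by
    rw [← restrict_Ioo_eq_restrict_Ioc]; exact ae_restrict_mem measurableSet_Ioo
  have hee : ∀ᵐ P ∂(volume.restrict (Ioc (0:ℝ) 1)), c √(1 - P^(1/b)) = c (Real.exp (1/2 * Real.log (1 - P^(1/b)))) := by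
    filter_upwards [hne] with P hP
    have : 0 < 1 - P^(1/b) := by
      linarith [Real.rpow_lt_one hP.1.le hP.2 (by positivity : 0 < 1/b)]
    rw [Real.sqrt_eq_rpow, Real.rpow_def_of_pos this, mul_comm]
  have hi : Integrable (fun P : ℝ => c √(1 - P^(1/b))) (volume.restrict (Ioc (0:ℝ) 1)) :=
    ((nn_cont _ cV hb).intervalIntegrable 0 1).1
  have J := hJ.map_integral_le (μ := volume.restrict (Ioc (0:ℝ) 1)) (f := fun P => 1/2 * Real.log (1 - P^(1/b)))
    (ccont.comp Real.continuous_exp).continuousOn isClosed_univ (ae_of_all _ fun _ => mem_univ _)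
    (l1.const_mul _) (hi.congr hee)
  rw [polar_P hα cV, intervalIntegral.integral_of_le zero_le_one, ← hb', ← hc, integral_congr_ae hee]
  refine le_trans ?_ J
  rw [integral_const_mul]
  have hκe : √κ = Real.exp (1/2 * Real.log κ) := by
    rw [Real.sqrt_eq_rpow, Real.rpow_def_of_pos hκ, mul_comm]
  rw [hκe]
  have hlog : Real.log κ ≤ -1 := by
    have h1 := Real.log_le_log hκ hκ4
    have h2 : Real.log (1/4) = -(2*Real.log 2) := by
      rw [one_div, Real.log_inv, show (4:ℝ) = 2^2 by norm_num, Real.log_pow]; push_cast; ring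
    have := Real.log_two_gt_d9
    linarith
  refine cmono_eps h hε (by positivity) ⟨(Real.exp_pos _).le, ?_⟩ ⟨(Real.exp_pos _).le, ?_⟩ (Real.exp_le_exp.2 (by linarith))
  · exact Real.exp_le_one_iff.2 (by linarith)
  · exact Real.exp_le_one_iff.2 (by linarith)

lemma goodD2 {α p q : ℝ} (hα : 1 < α) (hα2 : α ≤ 5/4) (hp : 0 < p) (hpq : p < q) (hq2 : q < 2) (hk : 1 ≤ q/p*(α-1)) :
    Good α p q √((α-1)/(q/p*α-1)) := by
  intro f
  have hq : 0 < q := hp.trans hpq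
  set b := α - 1 with hb'
  set k := q/p with hk'
  have hb : 0 < b := by linarith
  have hk1 : 1 < k := (one_lt_div hp).2 hpq
  have hk0 : 0 < k := by linarith
  have hpk : p/q = 1/k := by rw [hk', one_div_div]
  have hden : 0 < k*α-1 := by nlinarith
  set r2 := b/(k*α-1) with hr2
  have hr0 : 0 < r2 := by positivity
  have hκ : r2*k ≤ 1/4 := by
    have : r2*k ≤ b := by
      rw [hr2, div_mul_eq_mul_div, div_le_iff₀ hden]
      have : α = b + 1 := by rw [hb']; ring
      rw [this]; nlinarith
    linarith
  have hr21 : r2 ≤ 1 := by nlinarith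
  have mq := cmono f hq hq2.le
  have s1 := small_circle hα (by linarith) hp (by linarith) (by positivity) hκ f
  have s2 := circ_hyper hp hpq f (t := r2*k) (by positivity)
  rw [show r2*k*(p/q) = r2 by rw [hpk]; field_simp] at s2
  have h0 : 0 ≤ Real.circleAverage (fun z => ‖f.eval z‖^p) 0 √(r2*k) :=
    Real.circleAverage_nonneg_of_nonneg fun z _ => by positivity
  refine le_trans ?_ (s2.trans (Real.rpow_le_rpow h0 s1 hk0.le))
  rw [polar_P hα (cont_npow f hq _)]
  simp only [cA_scale (fun z => ‖f.eval z‖^q)]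
  have : ∫ P in (0:ℝ)..1, Real.circleAverage (fun z => ‖f.eval z‖^q) 0 (√r2 * √(1 - P^(1/(α-1)))) ≤
      ∫ P in (0:ℝ)..1, Real.circleAverage (fun z => ‖f.eval z‖^q) 0 √r2 := by
    refine intervalIntegral.integral_mono_on zero_le_one ?_ intervalIntegrable_const ?_
    · refine Continuous.intervalIntegrable ?_ _ _
      refine (cca (cont_npow1 f hq)).comp (continuous_const.mul (Real.continuous_sqrt.comp (continuous_const.sub ?_)))
      exact Real.continuous_rpow_const (by positivity)
    · intro P hP
      have ht := sq_mem (tP_mem hb hP).2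
      have hle : √r2 * √(1 - P^(1/b)) ≤ √r2 := mul_le_of_le_one_right (Real.sqrt_nonneg _) ht.2
      exact mq ⟨mul_nonneg (Real.sqrt_nonneg _) ht.1, hle.trans (sq_mem hr21).2⟩ (sq_mem hr21) hle
  simpa using this

end HC
namespace HC
open Set Filter Topology

theorem good_all {α p q : ℝ} (hp : 0 < p) (hpq : p < q) (hq2 : q < 2) (hα : 1 < α) :
    Good α p q (Real.sqrt (max (p/2) ((p*α-p)/(q*α-p)))) := by
  have hq : 0 < q := hp.trans hpq
  have e : (p*α-p)/(q*α-p) = (α-1)/(q/p*α-1) := by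
    have h1 : q*α-p ≠ 0 := by nlinarith
    have h2 : q/p*α-1 = (q*α-p)/p := by field_simp
    rw [h2]; field_simp
  rcases le_total ((p*α-p)/(q*α-p)) (p/2) with h | h
  · rw [max_eq_left h]; exact goodB hα hp hpq hq2
  rw [max_eq_right h]
  rcases le_total (5/4) α with h5 | h5
  · refine goodE h5 hp hpq (by linarith) (Real.sqrt_nonneg _) (Real.sqrt_le_sqrt ?_)
    have : 0 < q*α-p := by nlinarith
    rw [div_le_div_iff₀ this hq]
    nlinarith [mul_pos hp hp]
  rw [e]
  rcases le_total (q/p*(α-1)) 1 with hk | hk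
  · exact goodD1 hα hp hpq hq2 hk
  · exact goodD2 hα h5 hp hpq hq2 hk

noncomputable def chi (n : ℕ) (t : ℝ) : ℝ := max 0 (min 1 ((n+1)*(1-t) - 1))

lemma chi_nonneg (n t) : 0 ≤ chi n t := le_max_left _ _
lemma chi_le (n t) : chi n t ≤ 1 := max_le zero_le_one (min_le_left _ _)
lemma chi_cont (n) : Continuous (chi n) := by unfold chi; fun_prop

lemma chi_zero (n : ℕ) {t : ℝ} (h : 1 - 1/((n:ℝ)+1) < t) : chi n t = 0 := by
  unfold chi
  have hn : (0:ℝ) < n + 1 := by positivity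
  have : ((n:ℝ)+1)*(1-t) - 1 ≤ 0 := by
    have : 1 - t < 1/((n:ℝ)+1) := by linarith
    rw [lt_div_iff₀ hn] at this
    linarith
  rw [max_eq_left]; exact (min_le_right _ _).trans this

lemma chi_one (n : ℕ) {t : ℝ} (h : 1 ≤ t) : chi n t = 0 := by
  apply chi_zero
  have : (0:ℝ) < 1/((n:ℝ)+1) := by positivity
  linarith

lemma chi_tend {t : ℝ} (h : t < 1) : Tendsto (fun n => chi n t) atTop (𝓝 1) := by
  refine tendsto_const_nhds.congr' ?_
  obtain ⟨N, hN⟩ := exists_nat_gt (2/(1-t))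
  filter_upwards [eventually_ge_atTop N] with n hn
  unfold chi
  have h1 : 0 < 1 - t := by linarith
  rw [div_lt_iff₀ h1] at hN
  have : (N:ℝ) ≤ n := by exact_mod_cast hn
  have : 1 ≤ ((n:ℝ)+1)*(1-t) - 1 := by nlinarith
  rw [min_eq_left this, max_eq_right zero_le_one]

lemma cut_cont (n : ℕ) {F : ℂ → ℂ} (hF : DifferentiableOn ℂ F (ball 0 1)) {p : ℝ} (hp : 0 < p) :
    Continuous fun z : ℂ => chi n ‖z‖ * ‖F z‖^p := by
  rw [continuous_iff_continuousAt]
  intro z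
  by_cases hz : ‖z‖ < 1
  · have hc : ContinuousAt F z := (hF.differentiableAt (isOpen_ball.mem_nhds (by simpa using hz))).continuousAt
    exact ((chi_cont n).comp continuous_norm).continuousAt.mul (hc.norm.rpow_const (Or.inr hp.le))
  · have hlt : 1 - 1/((n:ℝ)+1) < ‖z‖ := by
      have : (0:ℝ) < 1/((n:ℝ)+1) := by positivity
      linarith [not_lt.1 hz]
    have : (fun z : ℂ => chi n ‖z‖ * ‖F z‖^p) =ᶠ[𝓝 z] fun _ => 0 := by
      filter_upwards [(continuous_norm.tendsto z).eventually_const_lt hlt] with y hy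
      rw [chi_zero n hy, zero_mul]
    exact continuousAt_const.congr this.symm

lemma cut_cA (n : ℕ) (F : ℂ → ℂ) (p : ℝ) {y : ℝ} (hy : 0 ≤ y) :
    Real.circleAverage (fun z : ℂ => chi n ‖z‖ * ‖F z‖^p) 0 y = chi n y * Real.circleAverage (fun z => ‖F z‖^p) 0 y := by
  have : Real.circleAverage (fun z : ℂ => chi n ‖z‖ * ‖F z‖^p) 0 y = Real.circleAverage (fun z : ℂ => chi n y * ‖F z‖^p) 0 y := by
    refine Real.circleAverage_congr_sphere fun z hz => ?_
    have : ‖z‖ = y := by simpa [abs_of_nonneg hy] using hz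
    simp only [this]
  rw [this]
  unfold Real.circleAverage
  rw [intervalIntegral.integral_const_mul, smul_eq_mul, smul_eq_mul]; ring

lemma dil_hol {f : ℂ → ℂ} (hf : DifferentiableOn ℂ f (ball 0 1)) {ρ : ℝ} (h0 : 0 < ρ) :
    DifferentiableOn ℂ (fun z => f ((ρ:ℂ)*z)) (ball 0 (1/ρ)) := by
  refine hf.comp (by fun_prop) ?_
  intro z hz
  have : ‖z‖ < 1/ρ := by simpa using hz
  rw [lt_div_iff₀ h0] at this
  simp only [mem_ball_zero_iff, norm_mul, Complex.norm_real, Real.norm_of_nonneg h0.le]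
  linarith

lemma cmono_hol {f : ℂ → ℂ} (hf : DifferentiableOn ℂ f (ball 0 1)) {p : ℝ} (hp : 0 < p) (hp2 : p ≤ 2) {ρ y : ℝ}
    (hρ : 0 < ρ) (hρ1 : ρ ≤ 1) (hy : 0 < y) (hy1 : y < 1) :
    Real.circleAverage (fun z => ‖f ((ρ:ℂ)*z)‖^p) 0 y ≤ Real.circleAverage (fun z => ‖f z‖^p) 0 y := by
  have hR : 1 < 1/y := (one_lt_div hy).2 hy1
  have hd := dil_hol hf hy
  obtain ⟨P, hP⟩ := poly_approx hR hd
  have hc : ContinuousOn (fun z => f ((y:ℂ)*z)) (closedBall 0 1) := hd.continuousOn.mono (closedBall_subset_ball hR)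
  have hF : ∀ n, Continuous fun z => (P n).eval z := fun n => by fun_prop
  have l1 := avg_lim hF hc hP hp hρ.le hρ1
  have l2 := avg_lim hF hc hP hp zero_le_one le_rfl
  have := le_of_tendsto_of_tendsto' l1 l2 fun n => cmono (P n) hp hp2 ⟨hρ.le, hρ1⟩ ⟨zero_le_one, le_rfl⟩ hρ1
  rw [cA_scale (fun z => ‖f z‖^p), cA_scale (fun z => ‖f z‖^p), mul_one] at this
  rw [cA_scale (fun z => ‖f z‖^p), mul_comm]
  exact this

lemma dil_le {f : ℂ → ℂ} (hf : DifferentiableOn ℂ f (ball 0 1)) {p : ℝ} (hp : 0 < p) (hp2 : p ≤ 2) {α : ℝ} (hα : 1 < α)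
    (hfp : Integrable (fun z => ‖f z‖^p) (bergmanMeasure α)) {ρ : ℝ} (hρ : 0 < ρ) (hρ1 : ρ < 1) :
    ∫ z : ℂ, ‖f ((ρ:ℂ)*z)‖^p ∂(bergmanMeasure α) ≤ ∫ z, ‖f z‖^p ∂(bergmanMeasure α) := by
  have hb : 0 < α - 1 := by linarith
  have hR : 1 < 1/ρ := (one_lt_div hρ).2 hρ1
  have hd := dil_hol hf hρ
  have hd1 : DifferentiableOn ℂ (fun z => f ((ρ:ℂ)*z)) (ball 0 1) := hd.mono (ball_subset_ball hR.le)
  have hc : ContinuousOn (fun z => f ((ρ:ℂ)*z)) (closedBall 0 1) := hd.continuousOn.mono (closedBall_subset_ball hR)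
  obtain ⟨K, hK⟩ := (isCompact_closedBall (0:ℂ) 1).exists_bound_of_continuousOn hc
  have hK0 : 0 ≤ K := (norm_nonneg _).trans (hK 0 (by simp))
  have step : ∀ n : ℕ, ∫ z : ℂ, chi n ‖z‖ * ‖f ((ρ:ℂ)*z)‖^p ∂(bergmanMeasure α) ≤ ∫ z, ‖f z‖^p ∂(bergmanMeasure α) := by
    intro n
    have c1 := cut_cont n hd1 hp
    have c2 := cut_cont n hf hp
    refine le_trans (b := ∫ z : ℂ, chi n ‖z‖ * ‖f z‖^p ∂(bergmanMeasure α)) ?_ ?_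
    · rw [polar_P hα c1, polar_P hα c2]
      refine intervalIntegral.integral_mono_on zero_le_one ((nn_cont _ c1 hb).intervalIntegrable _ _)
        ((nn_cont _ c2 hb).intervalIntegrable _ _) ?_
      intro P hP
      obtain ⟨m0, m1⟩ := sq_mem (tP_mem hb hP).2
      set y := √(1 - P^(1/(α-1)))
      rw [cut_cA n _ p m0, cut_cA n _ p m0]
      rcases m0.eq_or_lt with h | h
      · rw [← h]; simp
      rcases m1.eq_or_lt with h' | h'
      · rw [h', chi_one n le_rfl]; simp
      · exact mul_le_mul_of_nonneg_left (cmono_hol hf hp hp2 hρ hρ1.le h h') (chi_nonneg _ _)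
    · refine integral_mono (integrable_cont hα c2.continuousOn) hfp fun z => ?_
      exact mul_le_of_le_one_left (by positivity) (chi_le _ _)
  have lim := dct hα (F := fun n z => chi n ‖z‖ * ‖f ((ρ:ℂ)*z)‖^p)
    (G := fun z => (ball (0:ℂ) 1).indicator (fun z => ‖f ((ρ:ℂ)*z)‖^p) z) (K^p)
    (Eventually.of_forall fun n => (cut_cont n hd1 hp).continuousOn)
    (Eventually.of_forall fun n z hz => ?_) ?_
  · have e : ∫ z, (ball (0:ℂ) 1).indicator (fun z => ‖f ((ρ:ℂ)*z)‖^p) z ∂(bergmanMeasure α) =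
        ∫ z : ℂ, ‖f ((ρ:ℂ)*z)‖^p ∂(bergmanMeasure α) := by
      refine integral_congr_ae ?_
      filter_upwards [berg_ae_ball α] with z hz
      rw [indicator_of_mem hz]
    rw [e] at lim
    exact le_of_tendsto' lim step
  · rw [abs_of_nonneg (mul_nonneg (chi_nonneg _ _) (by positivity))]
    refine (mul_le_of_le_one_left (by positivity) (chi_le _ _)).trans ?_
    exact Real.rpow_le_rpow (norm_nonneg _) (hK z hz) hp.le
  · intro z hz
    by_cases h : z ∈ ball (0:ℂ) 1
    · rw [indicator_of_mem h]
      have := (chi_tend (by simpa using h : ‖z‖ < 1)).mul_const (‖f ((ρ:ℂ)*z)‖^p)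
      simpa using this
    · rw [indicator_of_notMem h]
      have h1 : 1 ≤ ‖z‖ := by simpa using h
      simp only [chi_one _ h1, zero_mul]
      exact tendsto_const_nhds

lemma disc_lim {F : ℕ → ℂ → ℂ} {G : ℂ → ℂ} (hF : ∀ n, Continuous (F n)) (hG : ContinuousOn G (closedBall 0 1))
    (hu : TendstoUniformlyOn F G atTop (closedBall 0 1)) {s α : ℝ} (hs : 0 < s) (hα : 1 < α) {r : ℝ} (h0 : 0 ≤ r) (h1 : r ≤ 1) :
    Tendsto (fun n => ∫ z : ℂ, ‖F n ((r:ℂ)*z)‖^s ∂(bergmanMeasure α)) atTop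
      (𝓝 (∫ z : ℂ, ‖G ((r:ℂ)*z)‖^s ∂(bergmanMeasure α))) := by
  obtain ⟨K, hK⟩ := (isCompact_closedBall (0:ℂ) 1).exists_bound_of_continuousOn hG
  have hm : ∀ z ∈ closedBall (0:ℂ) 1, (r:ℂ)*z ∈ closedBall (0:ℂ) 1 := fun z hz => by
    have hz : ‖z‖ ≤ 1 := by simpa using hz
    simp only [mem_closedBall_zero_iff, norm_mul, Complex.norm_real, Real.norm_of_nonneg h0]
    exact mul_le_one₀ h1 (norm_nonneg _) hz
  refine dct hα ((K+1)^s) (Eventually.of_forall fun n => Continuous.continuousOn ?_) ?_ ?_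
  · exact ((hF n).comp (by fun_prop)).norm.rpow_const fun _ => Or.inr hs.le
  · filter_upwards [Metric.tendstoUniformlyOn_iff.mp hu 1 one_pos] with n hn z hz
    rw [abs_of_nonneg (by positivity)]
    refine Real.rpow_le_rpow (norm_nonneg _) ?_ hs.le
    have a := hn _ (hm z hz)
    have b := hK _ (hm z hz)
    rw [dist_comm, dist_eq_norm] at a
    have := norm_le_norm_add_norm_sub' (F n ((r:ℂ)*z)) (G ((r:ℂ)*z))
    linarith
  · intro z hz
    exact (hu.tendsto_at (hm z hz)).norm.rpow_const (Or.inr hs.le)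

lemma main_rho {p q α r : ℝ} (hp : 0 < p) (hpq : p < q) (hq2 : q < 2) (hα : 1 < α) (hg : Good α p q r)
    (h0 : 0 ≤ r) (h1 : r < 1) {f : ℂ → ℂ} (hf : DifferentiableOn ℂ f (ball 0 1))
    (hfp : Integrable (fun z => ‖f z‖^p) (bergmanMeasure α)) {ρ : ℝ} (hρ : 0 < ρ) (hρ1 : ρ < 1) :
    ∫ z : ℂ, ‖f ((ρ:ℂ)*((r:ℂ)*z))‖^q ∂(bergmanMeasure α) ≤ (∫ z, ‖f z‖^p ∂(bergmanMeasure α))^(q/p) := by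
  have hq : 0 < q := hp.trans hpq
  have hR : 1 < 1/ρ := (one_lt_div hρ).2 hρ1
  have hd := dil_hol hf hρ
  obtain ⟨P, hP⟩ := poly_approx hR hd
  have hc : ContinuousOn (fun z => f ((ρ:ℂ)*z)) (closedBall 0 1) := hd.continuousOn.mono (closedBall_subset_ball hR)
  have hF : ∀ n, Continuous fun z => (P n).eval z := fun n => by fun_prop
  have l1 := disc_lim hF hc hP hq hα h0 h1.le
  have l2 := (disc_lim hF hc hP hp hα zero_le_one le_rfl).rpow_const (p := q/p) (Or.inr (by positivity))
  simp only [Complex.ofReal_one, one_mul] at l2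
  refine (le_of_tendsto_of_tendsto' l1 l2 fun n => hg (P n)).trans ?_
  exact Real.rpow_le_rpow (integral_nonneg fun z => by positivity) (dil_le hf hp (by linarith) hα hfp hρ hρ1) (by positivity)

lemma main_X {p q α r : ℝ} (hp : 0 < p) (hpq : p < q) (hq2 : q < 2) (hα : 1 < α) (hg : Good α p q r)
    (h0 : 0 ≤ r) (h1 : r < 1) {f : ℂ → ℂ} (hf : DifferentiableOn ℂ f (ball 0 1))
    (hfp : Integrable (fun z => ‖f z‖^p) (bergmanMeasure α)) :
    ∫ z : ℂ, ‖f ((r:ℂ)*z)‖^q ∂(bergmanMeasure α) ≤ (∫ z, ‖f z‖^p ∂(bergmanMeasure α))^(q/p) := by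
  have hq : 0 < q := hp.trans hpq
  have hc : ContinuousOn f (closedBall 0 r) := hf.continuousOn.mono (closedBall_subset_ball h1)
  obtain ⟨K, hK⟩ := (isCompact_closedBall (0:ℂ) r).exists_bound_of_continuousOn hc
  set ρ : ℕ → ℝ := fun n => 1 - 1/((n:ℝ)+2) with hρ
  have ρ0 : ∀ n, 0 < ρ n ∧ ρ n < 1 := by
    intro n
    have : (0:ℝ) < 1/((n:ℝ)+2) := by positivity
    have h2 : 1/((n:ℝ)+2) < 1 := by rw [div_lt_one (by positivity)]; linarith [(Nat.cast_nonneg n : (0:ℝ) ≤ n)]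
    simp only [hρ]; constructor <;> linarith
  have ρl : Tendsto ρ atTop (𝓝 1) := by
    have h := tendsto_one_div_add_atTop_nhds_zero_nat (𝕜 := ℝ)
    have h2 := (h.comp (tendsto_add_atTop_nat 1)).const_sub 1
    rw [sub_zero] at h2
    refine h2.congr fun n => ?_
    simp only [hρ, Function.comp]; push_cast; ring_nf
  have hm : ∀ z ∈ closedBall (0:ℂ) 1, ∀ t : ℝ, 0 ≤ t → t ≤ 1 → (t:ℂ)*((r:ℂ)*z) ∈ closedBall (0:ℂ) r := by
    intro z hz t ht ht1
    have hz : ‖z‖ ≤ 1 := by simpa using hz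
    simp only [mem_closedBall_zero_iff, norm_mul, Complex.norm_real, Real.norm_of_nonneg h0, Real.norm_of_nonneg ht]
    calc t*(r*‖z‖) ≤ 1*(r*1) := by gcongr
      _ = r := by ring
  have lim := dct hα (F := fun n z => ‖f ((ρ n:ℂ)*((r:ℂ)*z))‖^q) (G := fun z => ‖f ((r:ℂ)*z)‖^q) (K^q)
    (Eventually.of_forall fun n => ?_) (Eventually.of_forall fun n z hz => ?_) ?_
  · exact le_of_tendsto' lim fun n => main_rho hp hpq hq2 hα hg h0 h1 hf hfp (ρ0 n).1 (ρ0 n).2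
  · refine ContinuousOn.rpow_const (ContinuousOn.norm ?_) fun _ _ => Or.inr hq.le
    exact hc.comp (by fun_prop) fun z hz => hm z hz _ (ρ0 n).1.le (ρ0 n).2.le
  · rw [abs_of_nonneg (by positivity)]
    exact Real.rpow_le_rpow (norm_nonneg _) (hK _ (hm z hz _ (ρ0 n).1.le (ρ0 n).2.le)) hq.le
  · intro z hz
    have hmem : (r:ℂ)*z ∈ ball (0:ℂ) 1 := by
      have := hm z hz 1 zero_le_one le_rfl
      rw [Complex.ofReal_one, one_mul] at this
      exact closedBall_subset_ball h1 this
    have hca : ContinuousAt f ((r:ℂ)*z) := (hf.differentiableAt (isOpen_ball.mem_nhds hmem)).continuousAt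
    have ht : Tendsto (fun n => (ρ n:ℂ)*((r:ℂ)*z)) atTop (𝓝 ((r:ℂ)*z)) := by
      have := ((Complex.continuous_ofReal.tendsto 1).comp ρl).mul_const ((r:ℂ)*z)
      simpa using this
    exact (hca.tendsto.comp ht).norm.rpow_const (Or.inr hq.le)

end HC

theorem hypercontractivity_q_lt_two
    (p q α : ℝ) (hp : 0 < p) (hpq : p < q) (hq2 : q < 2) (hα : 1 < α)
    (f : ℂ → ℂ) (hf : DifferentiableOn ℂ f (ball (0 : ℂ) 1))
    (hfp : Integrable (fun z => ‖f z‖ ^ p) (bergmanMeasure α))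
    (r : ℝ) (hr : r = Real.sqrt (max (p / 2) ((p * α - p) / (q * α - p)))) :
    (∫ z, ‖f ((r : ℂ) * z)‖ ^ q ∂(bergmanMeasure α)) ^ (1 / q) ≤
      (∫ z, ‖f z‖ ^ p ∂(bergmanMeasure α)) ^ (1 / p) := by
  have hq : 0 < q := hp.trans hpq
  have hg := HC.good_all hp hpq hq2 hα
  rw [← hr] at hg
  have h0 : 0 ≤ r := hr ▸ Real.sqrt_nonneg _
  have h1 : r < 1 := by
    rw [hr, Real.sqrt_lt' one_pos, one_pow]
    refine max_lt (by linarith) ?_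
    rw [div_lt_one (by nlinarith)]
    nlinarith
  have hX := HC.main_X hp hpq hq2 hα hg h0 h1 hf hfp
  have hY : 0 ≤ ∫ z, ‖f z‖ ^ p ∂(bergmanMeasure α) := integral_nonneg fun z => by positivity
  have hX0 : 0 ≤ ∫ z, ‖f ((r : ℂ) * z)‖ ^ q ∂(bergmanMeasure α) :=
    integral_nonneg fun z => by positivity
  refine (Real.rpow_le_rpow hX0 hX (by positivity)).trans ?_
  rw [← Real.rpow_mul hY]
  apply le_of_eq
  congr 1
  field_simp
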